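/- There exists an absolute constant c > 0 such that every simple graph G on n ≥ 2 vertices with degree sequence d_1, …, d_n admits a convex drawing (a drawing in which the vertices are represented by points in convex position and every edge is drawn as the straight-line segment between its endpoints) with at most c · log n · (pcr(G) + Σ_{k=1}^n d_k²) crossings. -/

import Mathlib

open scoped BigOperators

/-- A drawing of a simple graph in the plane: vertices are distinct points, each edge is a
simple continuous curve joining its endpoints, not passing through any other vertex point;
two distinct edge curves share only finitely many points, and no three edge curves pass
through a common interior point. -/
structure Drawing {V : Type*} (G : SimpleGraph V) where
  pos : V → ℝ × ℝ
  pos_inj : Function.Injective pos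
  curve : G.edgeSet → ℝ → ℝ × ℝ
  curve_cont : ∀ e, ContinuousOn (curve e) (Set.Icc 0 1)
  curve_inj : ∀ e, Set.InjOn (curve e) (Set.Icc 0 1)
  curve_ends : ∀ e : G.edgeSet, ∃ u v : V, (e : Sym2 V) = s(u, v) ∧
    curve e 0 = pos u ∧ curve e 1 = pos v
  curve_avoid : ∀ (e : G.edgeSet), ∀ t ∈ Set.Ioo (0:ℝ) 1, curve e t ∉ Set.range pos
  curve_finite_inter : ∀ e f : G.edgeSet, e ≠ f →
    (curve e '' Set.Icc 0 1 ∩ curve f '' Set.Icc 0 1).Finite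
  no_triple_point : ∀ e f g : G.edgeSet, e ≠ f → f ≠ g → e ≠ g → ∀ p : ℝ × ℝ,
    ¬ (p ∈ curve e '' Set.Ioo 0 1 ∧ p ∈ curve f '' Set.Ioo 0 1 ∧ p ∈ curve g '' Set.Ioo 0 1)

namespace Drawing

variable {V : Type*} {G : SimpleGraph V} (D : Drawing G)

/-- `p` is a crossing point of the edges `e` and `f`: a common interior point of their curves. -/
def IsCross (e f : G.edgeSet) (p : ℝ × ℝ) : Prop :=
  p ∈ D.curve e '' Set.Ioo 0 1 ∧ p ∈ D.curve f '' Set.Ioo 0 1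

/-- The set of crossings of a drawing, recorded as (unordered pair of edges, crossing point). -/
def crossings : Set (Sym2 G.edgeSet × (ℝ × ℝ)) :=
  { x | ∃ e f : G.edgeSet, e ≠ f ∧ x.1 = s(e, f) ∧ D.IsCross e f x.2 }

/-- The number of crossings of a drawing. -/
noncomputable def numCrossings : ℕ := D.crossings.ncard

/-- The set of unordered pairs of distinct edges that cross each other. -/
def crossingPairs : Set (Sym2 G.edgeSet) :=
  { q | ∃ e f : G.edgeSet, e ≠ f ∧ q = s(e, f) ∧ ∃ p, D.IsCross e f p }

/-- The number of pairs of edges that cross each other. -/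
noncomputable def numCrossingPairs : ℕ := D.crossingPairs.ncard

/-- An edge participating in at least one crossing. -/
def CrossingEdge (e : G.edgeSet) : Prop :=
  ∃ f : G.edgeSet, e ≠ f ∧ ∃ p, D.IsCross e f p

/-- A drawing is straight-line if every edge is the line segment between its endpoints. -/
def IsStraightLine : Prop :=
  ∀ (e : G.edgeSet), ∀ t ∈ Set.Icc (0:ℝ) 1,
    D.curve e t = D.curve e 0 + t • (D.curve e 1 - D.curve e 0)

/-- A convex drawing: the vertices are in convex position and edges are straight segments. -/
def IsConvex : Prop :=
  ConvexIndependent ℝ D.pos ∧ D.IsStraightLine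

end Drawing

/-- The crossing number of a graph. -/
noncomputable def crNum {V : Type*} (G : SimpleGraph V) : ℕ :=
  sInf { n | ∃ D : Drawing G, D.numCrossings = n }

/-- The pair crossing number of a graph. -/
noncomputable def pcrNum {V : Type*} (G : SimpleGraph V) : ℕ :=
  sInf { n | ∃ D : Drawing G, D.numCrossingPairs = n }

/-- The sum of the squares of the degrees of a graph. -/
noncomputable def ssqd {V : Type*} (G : SimpleGraph V) : ℕ :=
  ∑ᶠ v : V, ((G.neighborSet v).ncard) ^ 2

/-- The sum over all vertices of (degree choose 2). -/
noncomputable def bds {V : Type*} (G : SimpleGraph V) : ℕ :=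
  ∑ᶠ v : V, ((G.neighborSet v).ncard).choose 2


theorem K33_parity (eab eaa ebb : Fin 3 → Fin 3 → ℤ) (nA nB : Fin 3 → Fin 3 → Fin 3 → ℤ)
    (h : ∀ i k j l, i ≠ k → j ≠ l → - eab k j + eaa k i + ebb l j + eab i l
      + 2 * (nA i j k + nB k l j - nB i j l - nA k l i) = 0)
    (hodd : ∀ i k, i ≠ k → Odd (eaa i k)) (hbb : ∀ j l, j ≠ l → ebb l j = - ebb j l) : False := by
  obtain ⟨x, hx⟩ := hodd 1 0 (by decide)
  obtain ⟨y, hy⟩ := hodd 2 0 (by decide)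
  obtain ⟨z, hz⟩ := hodd 2 1 (by decide)
  have b1 := hbb 0 1 (by decide)
  have b2 := hbb 0 2 (by decide)
  have b3 := hbb 1 2 (by decide)
  have h1 := h 0 1 0 1 (by decide) (by decide)
  have h2 := h 0 1 1 0 (by decide) (by decide)
  have h3 := h 0 1 0 2 (by decide) (by decide)
  have h4 := h 0 1 2 0 (by decide) (by decide)
  have h5 := h 0 1 1 2 (by decide) (by decide)
  have h6 := h 0 1 2 1 (by decide) (by decide)
  have i1 := h 0 2 0 1 (by decide) (by decide)
  have i2 := h 0 2 1 0 (by decide) (by decide)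
  have i3 := h 0 2 0 2 (by decide) (by decide)
  have i4 := h 0 2 2 0 (by decide) (by decide)
  have i5 := h 0 2 1 2 (by decide) (by decide)
  have i6 := h 0 2 2 1 (by decide) (by decide)
  have j1 := h 1 2 0 1 (by decide) (by decide)
  have j2 := h 1 2 1 0 (by decide) (by decide)
  have j3 := h 1 2 0 2 (by decide) (by decide)
  have j4 := h 1 2 2 0 (by decide) (by decide)
  have j5 := h 1 2 1 2 (by decide) (by decide)
  have j6 := h 1 2 2 1 (by decide) (by decide)
  clear h hodd hbb
  omega

theorem exists_log_lift {X : Type*} [TopologicalSpace X] [LocallyPathConnectedSpace X]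
    [SimplyConnectedSpace X] (g : X → ℂ) (hg : Continuous g) (h0 : ∀ x, g x ≠ 0) :
    ∃ f : X → ℂ, Continuous f ∧ ∀ x, Complex.exp (f x) = g x := by
  obtain ⟨x₀⟩ : Nonempty X := inferInstance
  obtain ⟨f, ⟨-, hf⟩, -⟩ := Complex.isCoveringMapOn_exp.existsUnique_continuousMap_lifts
    ⟨g, hg⟩ (Complex.exp_log (h0 x₀)) (fun x => h0 x)
  exact ⟨f, map_continuous f, fun x => congrFun hf x⟩

theorem log_lift_const (f g : ℝ → ℂ) (hf : Continuous f) (hg : Continuous g)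
    (h : ∀ x, Complex.exp (f x) = Complex.exp (g x)) : f 1 - f 0 = g 1 - g 0 := by
  have hc : Continuous (fun x => ((f x - g x) / (2 * Real.pi * Complex.I))) := by fun_prop
  have hz : ∀ x, ∃ n : ℤ, (f x - g x) / (2 * Real.pi * Complex.I) = n := by
    intro x
    obtain ⟨n, hn⟩ := Complex.exp_eq_exp_iff_exists_int.mp (h x)
    refine ⟨n, ?_⟩
    rw [hn]
    field_simp [Complex.I_ne_zero, Real.pi_ne_zero]
    ring
  choose n hn using hz
  have hre : Continuous (fun x => ((n x : ℤ) : ℝ)) := by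
    have : (fun x => ((n x : ℤ) : ℝ)) = fun x => ((f x - g x) / (2 * Real.pi * Complex.I)).re := by
      funext x; rw [hn]; simp
    rw [this]
    exact Complex.continuous_re.comp hc
  have hnc : Continuous n := by
    exact Int.isClosedEmbedding_coe_real.isInducing.continuous_iff.mpr hre
  have hconst : n 1 = n 0 := PreconnectedSpace.constant inferInstance hnc
  have e1 := hn 1
  have e0 := hn 0
  rw [hconst, ← e0] at e1
  have hne : (2 * Real.pi * Complex.I : ℂ) ≠ 0 := by
    simp [Complex.I_ne_zero, Real.pi_ne_zero]
  have := (div_left_inj' hne).mp e1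
  linear_combination this

theorem winding_exists (γ : ℝ → ℂ) (hγ : Continuous γ) (p : ℂ) (hp : ∀ t, γ t ≠ p) :
    ∃ n : ℤ, ∀ L : ℝ → ℂ, Continuous L → (∀ t, Complex.exp (L t) = γ t - p) →
      L 1 - L 0 = Complex.log (γ 1 - p) - Complex.log (γ 0 - p) + n * (2 * Real.pi * Complex.I) := by
  obtain ⟨f, hf, he⟩ := exists_log_lift (fun t => γ t - p) (by fun_prop) (fun t => sub_ne_zero.mpr (hp t))
  have key : ∀ t, ∃ n : ℤ, f t = Complex.log (γ t - p) + n * (2 * Real.pi * Complex.I) := by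
    intro t
    apply Complex.exp_eq_exp_iff_exists_int.mp
    rw [he, Complex.exp_log (sub_ne_zero.mpr (hp t))]
  obtain ⟨n1, h1⟩ := key 1
  obtain ⟨n0, h0⟩ := key 0
  refine ⟨n1 - n0, fun L hL hLe => ?_⟩
  rw [log_lift_const L f hL hf (fun x => by rw [hLe, he]), h1, h0]
  push_cast
  ring

theorem log_neg_odd (z : ℂ) (hz : z ≠ 0) :
    ∃ e : ℤ, Odd e ∧ Complex.log z - Complex.log (-z) = e * (Real.pi * Complex.I) := by
  have : Complex.exp (Complex.log z) = Complex.exp (Complex.log (-z) + Real.pi * Complex.I) := by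
    rw [Complex.exp_add, Complex.exp_log hz, Complex.exp_log (neg_ne_zero.mpr hz), Complex.exp_pi_mul_I]
    ring
  obtain ⟨n, hn⟩ := Complex.exp_eq_exp_iff_exists_int.mp this
  refine ⟨2 * n + 1, ⟨n, rfl⟩, ?_⟩
  rw [hn]; push_cast; ring

theorem K33_plane (a b : Fin 3 → ℂ) (γ : Fin 3 → Fin 3 → ℝ → ℂ) (hc : ∀ i j, Continuous (γ i j))
    (h0 : ∀ i j, γ i j 0 = a i) (h1 : ∀ i j, γ i j 1 = b j) :
    ∃ i k j l, i ≠ k ∧ j ≠ l ∧ ∃ s t, γ i j s = γ k l t := by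
  by_contra hcon
  push Not at hcon
  have hpi : (Real.pi * Complex.I : ℂ) ≠ 0 := by simp [Complex.I_ne_zero, Real.pi_ne_zero]
  -- other indices
  have oth : ∀ j : Fin 3, ∃ l, j ≠ l := by decide
  have hA : ∀ i j k, i ≠ k → ∀ t, γ i j t ≠ a k := by
    intro i j k hik t
    obtain ⟨l, hl⟩ := oth j
    rw [← h0 k l]; exact hcon i k j l hik hl t 0
  have hB : ∀ i j l, j ≠ l → ∀ t, γ i j t ≠ b l := by
    intro i j l hjl t
    obtain ⟨k, hk⟩ := oth i
    rw [← h1 k l]; exact hcon i k j l hk hjl t 1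
  have eA : ∀ i j k, ∃ n : ℤ, i ≠ k → ∀ L : ℝ → ℂ, Continuous L →
      (∀ t, Complex.exp (L t) = γ i j t - a k) →
      L 1 - L 0 = Complex.log (b j - a k) - Complex.log (a i - a k) + n * (2 * Real.pi * Complex.I) := by
    intro i j k
    by_cases hik : i = k
    · exact ⟨0, fun h => absurd hik h⟩
    · obtain ⟨n, hn⟩ := winding_exists (γ i j) (hc i j) (a k) (hA i j k hik)
      rw [h0, h1] at hn
      exact ⟨n, fun _ => hn⟩
  have eB : ∀ i j l, ∃ n : ℤ, j ≠ l → ∀ L : ℝ → ℂ, Continuous L →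
      (∀ t, Complex.exp (L t) = γ i j t - b l) →
      L 1 - L 0 = Complex.log (b j - b l) - Complex.log (a i - b l) + n * (2 * Real.pi * Complex.I) := by
    intro i j l
    by_cases hik : j = l
    · exact ⟨0, fun h => absurd hik h⟩
    · obtain ⟨n, hn⟩ := winding_exists (γ i j) (hc i j) (b l) (hB i j l hik)
      rw [h0, h1] at hn
      exact ⟨n, fun _ => hn⟩
  choose nA hnA using eA
  choose nB hnB using eB
  have ee : ∀ z : ℂ, ∃ e : ℤ, z ≠ 0 → Odd e ∧
      Complex.log z - Complex.log (-z) = e * (Real.pi * Complex.I) := by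
    intro z
    by_cases hz : z = 0
    · exact ⟨0, fun h => absurd hz h⟩
    · obtain ⟨e, he⟩ := log_neg_odd z hz
      exact ⟨e, fun _ => he⟩
  choose ε hε using ee
  have aa : ∀ i k, i ≠ k → a i - a k ≠ 0 := fun i k h => by
    have := hA i 0 k h 0
    rw [h0] at this; exact sub_ne_zero.mpr this
  have bb : ∀ i k, i ≠ k → b i - b k ≠ 0 := fun i k h => by
    have := hB 0 i k h 1
    rw [h1] at this; exact sub_ne_zero.mpr this
  have ab : ∀ i k, a i - b k ≠ 0 := fun i k => by
    obtain ⟨j, hj⟩ := oth k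
    have := hB i j k hj.symm 0
    rw [h0] at this; exact sub_ne_zero.mpr this
  apply K33_parity (fun i j => ε (a i - b j)) (fun i j => ε (a i - a j)) (fun i j => ε (b i - b j)) nA nB
  · intro i k j l hik hjl
    obtain ⟨L, hL, hLe⟩ := exists_log_lift (X := ℝ × ℝ) (fun x => γ i j x.1 - γ k l x.2)
      (((hc i j).comp continuous_fst).sub ((hc k l).comp continuous_snd))
      (fun x => sub_ne_zero.mpr (hcon i k j l hik hjl _ _))
    have bot := hnA i j k hik (fun s => L (s, 0)) (by fun_prop) (fun t => by rw [hLe]; simp [h0])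
    have top := hnB i j l hjl (fun s => L (s, 1)) (by fun_prop) (fun t => by rw [hLe]; simp [h1])
    have left := hnA k l i hik.symm (fun s => L (0, s) - Real.pi * Complex.I) (by fun_prop) (fun t => by
      rw [Complex.exp_sub, hLe, Complex.exp_pi_mul_I]; simp only [h0]; ring)
    have right := hnB k l j hjl.symm (fun s => L (1, s) - Real.pi * Complex.I) (by fun_prop) (fun t => by
      rw [Complex.exp_sub, hLe, Complex.exp_pi_mul_I]; simp only [h1]; ring)
    have q1 := (hε _ (ab k j)).2
    have q2 := (hε _ (aa k i hik.symm)).2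
    have q3 := (hε _ (bb l j hjl.symm)).2
    have q4 := (hε _ (ab i l)).2
    rw [neg_sub] at q1 q2 q3 q4
    have : ((- ε (a k - b j) + ε (a k - a i) + ε (b l - b j) + ε (a i - b l)
      + 2 * (nA i j k + nB k l j - nB i j l - nA k l i) : ℤ) : ℂ) * (Real.pi * Complex.I) = 0 := by
      push_cast
      linear_combination q1 - q2 - q3 - q4 - bot - right + left + top
    have := (mul_eq_zero.mp this).resolve_right hpi
    exact_mod_cast this
  · intro i k hik
    exact (hε _ (aa i k hik)).1
  · intro j l hjl
    have q1 := (hε _ (bb l j hjl.symm)).2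
    have q2 := (hε _ (bb j l hjl)).2
    rw [neg_sub] at q1 q2
    have : ((ε (b l - b j) + ε (b j - b l) : ℤ) : ℂ) * (Real.pi * Complex.I) = 0 := by
      push_cast
      linear_combination - q1 - q2
    have := (mul_eq_zero.mp this).resolve_right hpi
    have : ε (b l - b j) + ε (b j - b l) = 0 := by exact_mod_cast this
    show ε (b l - b j) = - ε (b j - b l)
    omega

section Reach
variable {α : Type*}

def Rch (Γ : α → α → Prop) (X : Set α) (p q : α) : Prop :=
  Relation.ReflTransGen (fun a b => Γ a b ∧ a ∈ X ∧ b ∈ X) p q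

def NPl (Γ : α → α → Prop) : Prop :=
  ∀ (a b : Fin 3 → α) (P : Fin 3 → Fin 3 → Set α), (∀ i j, a i ∈ P i j) →
    (∀ i j, Rch Γ (P i j) (a i) (b j)) →
    ∃ i k j l, i ≠ k ∧ j ≠ l ∧ (P i j ∩ P k l).Nonempty

variable {Γ : α → α → Prop} {X Y : Set α} {p q r : α}

theorem Rch.refl : Rch Γ X p p := Relation.ReflTransGen.refl

theorem Rch.trans (h : Rch Γ X p q) (h' : Rch Γ X q r) : Rch Γ X p r :=
  Relation.ReflTransGen.trans h h'

theorem Rch.mono (hXY : X ⊆ Y) (h : Rch Γ X p q) : Rch Γ Y p q :=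
  Relation.ReflTransGen.mono (fun _ _ h => ⟨h.1, hXY h.2.1, hXY h.2.2⟩) _ _ h

theorem Rch.single (h : Γ p q) (hp : p ∈ X) (hq : q ∈ X) : Rch Γ X p q :=
  Relation.ReflTransGen.single ⟨h, hp, hq⟩

theorem Rch.symm (hs : ∀ a b, Γ a b → Γ b a) (h : Rch Γ X p q) : Rch Γ X q p := by
  induction h with
  | refl => exact Rch.refl
  | tail _ hbc ih => exact (Rch.single (hs _ _ hbc.1) hbc.2.2 hbc.2.1).trans ih

theorem Rch.mem (h : Rch Γ X p q) (hp : p ∈ X) : q ∈ X := by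
  induction h with
  | refl => exact hp
  | tail _ hbc ih => exact hbc.2.2

theorem Rch.restrict (h : Rch Γ X p q) (hY : ∀ m, Rch Γ X p m → m ∈ Y) : Rch Γ (X ∩ Y) p q := by
  induction h with
  | refl => exact Rch.refl
  | tail hab hbc ih =>
    exact ih.trans (Rch.single hbc.1 ⟨hbc.2.1, hY _ hab⟩ ⟨hbc.2.2, hY _ (hab.tail hbc)⟩)

theorem Rch.split (h : Rch Γ X p q) (hp : p ∈ Y) :
    (Rch Γ (X ∩ Y) p q ∧ q ∈ Y) ∨
    ∃ t s, Rch Γ (X ∩ Y) p t ∧ t ∈ Y ∧ t ∈ X ∧ Γ t s ∧ s ∉ Y ∧ s ∈ X ∧ Rch Γ X s q := by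
  induction h with
  | refl => exact Or.inl ⟨Rch.refl, hp⟩
  | @tail b c hab hbc ih =>
    rcases ih with ⟨h1, h2⟩ | ⟨t, s, h1, h2, h3, h4, h5, h6, h7⟩
    · by_cases hc : c ∈ Y
      · exact Or.inl ⟨h1.trans (Rch.single hbc.1 ⟨hbc.2.1, h2⟩ ⟨hbc.2.2, hc⟩), hc⟩
      · exact Or.inr ⟨b, c, h1, h2, hbc.2.1, hbc.1, hc, hbc.2.2, Rch.refl⟩
    · exact Or.inr ⟨t, s, h1, h2, h3, h4, h5, h6, h7.tail hbc⟩

end Reach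

section Fares
variable {α E : Type*}

def Ride (Γ : α → α → Prop) (pts : E → Set α) (C : Set α) (x : E) (p q : α) : Prop :=
  p ∈ pts x ∩ C ∧ Rch Γ (pts x ∩ C) p q

inductive Fare (Γ : α → α → Prop) (pts : E → Set α) (ω : E → ℝ) (C : Set α) : ℝ → α → α → Prop
  | refl (p : α) (hp : p ∈ C) : Fare Γ pts ω C 0 p p
  | cons (x : E) (c : ℝ) (p q s : α) (h : Ride Γ pts C x p q) (h' : Fare Γ pts ω C c q s) :
      Fare Γ pts ω C (ω x + c) p s

def fball (Γ : α → α → Prop) (pts : E → Set α) (ω : E → ℝ) (C : Set α) (p : α) (ρ : ℝ) : Set α :=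
  {t | ∃ c ≤ ρ, Fare Γ pts ω C c p t}

noncomputable def lam (Γ : α → α → Prop) (pts : E → Set α) (ω : E → ℝ) (C : Set α) (r p : α) : ℝ :=
  sInf {c | Fare Γ pts ω C c r p}

variable {Γ : α → α → Prop} {pts : E → Set α} {ω : E → ℝ} {C C' X : Set α} {c c' κ τ : ℝ} {p q r s : α}

theorem Ride.mem_right {x : E} (h : Ride Γ pts C x p q) : q ∈ pts x ∩ C := h.2.mem h.1

theorem Ride.symm (hs : ∀ a b, Γ a b → Γ b a) {x : E} (h : Ride Γ pts C x p q) :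
    Ride Γ pts C x q p := ⟨h.mem_right, h.2.symm hs⟩

theorem Ride.mono (hC : C ⊆ C') {x : E} (h : Ride Γ pts C x p q) : Ride Γ pts C' x p q :=
  ⟨⟨h.1.1, hC h.1.2⟩, h.2.mono (Set.inter_subset_inter_right _ hC)⟩

theorem Fare.left_mem (h : Fare Γ pts ω C c p q) : p ∈ C := by
  cases h with
  | refl p hp => exact hp
  | cons x c p q s h h' => exact h.1.2

theorem Fare.right_mem (h : Fare Γ pts ω C c p q) : q ∈ C := by
  induction h with
  | refl p hp => exact hp
  | cons x c p q s h h' ih => exact ih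

theorem Fare.trans (h : Fare Γ pts ω C c p q) (h' : Fare Γ pts ω C c' q r) :
    Fare Γ pts ω C (c + c') p r := by
  induction h with
  | refl p hp => simpa using h'
  | cons x c p q s h _ ih =>
    rw [add_assoc]; exact Fare.cons x _ p q r h (ih h')

theorem Fare.of_ride {x : E} (h : Ride Γ pts C x p q) : Fare Γ pts ω C (ω x) p q := by
  have := Fare.cons (ω := ω) x 0 p q q h (Fare.refl q h.mem_right.2)
  simpa using this

theorem Fare.symm (hs : ∀ a b, Γ a b → Γ b a) (h : Fare Γ pts ω C c p q) : Fare Γ pts ω C c q p := by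
  induction h with
  | refl p hp => exact Fare.refl p hp
  | cons x c p q s h _ ih =>
    rw [add_comm]; exact ih.trans (Fare.of_ride (h.symm hs))

theorem Fare.mono (hC : C ⊆ C') (h : Fare Γ pts ω C c p q) : Fare Γ pts ω C' c p q := by
  induction h with
  | refl p hp => exact Fare.refl p (hC hp)
  | cons x c p q s h _ ih => exact Fare.cons x c p q s (h.mono hC) ih

theorem Fare.nonneg (h0 : ∀ x, 0 ≤ ω x) (h : Fare Γ pts ω C c p q) : 0 ≤ c := by
  induction h with
  | refl p hp => exact le_rfl
  | cons x c p q s h _ ih => exact add_nonneg (h0 x) ih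

theorem Fare.of_adj (hΓ : ∀ a b, Γ a b → ∃ x, a ∈ pts x ∧ b ∈ pts x) (hκ : ∀ x, ω x ≤ κ)
    (h : Γ p q) (hp : p ∈ C) (hq : q ∈ C) : ∃ c ≤ κ, Fare Γ pts ω C c p q := by
  obtain ⟨x, h1, h2⟩ := hΓ _ _ h
  exact ⟨ω x, hκ x, Fare.of_ride ⟨⟨h1, hp⟩, Rch.single h ⟨h1, hp⟩ ⟨h2, hq⟩⟩⟩

theorem Fare.of_rch (hΓ : ∀ a b, Γ a b → ∃ x, a ∈ pts x ∧ b ∈ pts x)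
    (h : Rch Γ C p q) (hp : p ∈ C) : ∃ c, Fare Γ pts ω C c p q := by
  induction h with
  | refl => exact ⟨0, Fare.refl p hp⟩
  | tail _ hbc ih =>
    obtain ⟨c, hc⟩ := ih
    obtain ⟨x, h1, h2⟩ := hΓ _ _ hbc.1
    exact ⟨c + ω x, hc.trans (Fare.of_ride ⟨⟨h1, hbc.2.1⟩, Rch.single hbc.1 ⟨h1, hbc.2.1⟩ ⟨h2, hbc.2.2⟩⟩)⟩

theorem lam_le (h0 : ∀ x, 0 ≤ ω x) (h : Fare Γ pts ω C c r p) : lam Γ pts ω C r p ≤ c :=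
  csInf_le ⟨0, fun _ h => Fare.nonneg h0 h⟩ h

theorem exists_fare_of_lam_lt (hex : ∃ c, Fare Γ pts ω C c r p) (h : lam Γ pts ω C r p < τ) :
    ∃ c < τ, Fare Γ pts ω C c r p := by
  obtain ⟨c, hc, hlt⟩ := exists_lt_of_csInf_lt (s := {c | Fare Γ pts ω C c r p}) hex h
  exact ⟨c, hlt, hc⟩

theorem lam_lip (h0 : ∀ x, 0 ≤ ω x) (hex : ∃ c, Fare Γ pts ω C c r p) (h : Fare Γ pts ω C c p q) :
    lam Γ pts ω C r q ≤ lam Γ pts ω C r p + c := by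
  apply le_of_forall_pos_lt_add
  intro ε hε
  obtain ⟨c1, h1, h2⟩ := exists_fare_of_lam_lt hex (lt_add_of_pos_right (lam Γ pts ω C r p) hε)
  have := lam_le h0 (h2.trans h)
  linarith

theorem lam_self (h0 : ∀ x, 0 ≤ ω x) (hr : r ∈ C) : lam Γ pts ω C r r ≤ 0 :=
  lam_le h0 (Fare.refl r hr)

/-- following a fare inside a sublevel set -/
theorem Fare.sublevel_aux (h0 : ∀ x, 0 ≤ ω x) {Z : Set α} {r : α} {ρ : ℝ}
    (hZ : ∀ m c, c ≤ ρ → Fare Γ pts ω C c r m → m ∈ Z)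
    (h : Fare Γ pts ω C c p q) : ∀ c0, Fare Γ pts ω C c0 r p → c0 + c ≤ ρ →
      Fare Γ pts ω (C ∩ Z) c p q := by
  induction h with
  | refl p hp => exact fun c0 h1 h2 => Fare.refl p ⟨hp, hZ p c0 (by linarith) h1⟩
  | cons x c p q s h h' ih =>
    intro c0 h1 h2
    have hc := h'.nonneg h0
    have hr : ∀ m, Rch Γ (pts x ∩ C) p m → m ∈ Z := fun m hm =>
      hZ m (c0 + ω x) (by linarith) (h1.trans (Fare.of_ride ⟨h.1, hm⟩))
    refine Fare.cons x c p q s ?_ (ih (c0 + ω x) (h1.trans (Fare.of_ride h)) (by linarith))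
    refine ⟨⟨h.1.1, h.1.2, hr p Rch.refl⟩, ?_⟩
    rw [← Set.inter_assoc]
    exact h.2.restrict hr

theorem Fare.sublevel (h0 : ∀ x, 0 ≤ ω x) (h : Fare Γ pts ω C c r p) (hc : c < τ) :
    Fare Γ pts ω (C ∩ {m | lam Γ pts ω C r m < τ}) c r p := by
  refine Fare.sublevel_aux (ρ := c) h0 ?_ h 0 (Fare.refl r h.left_mem) (by linarith)
  intro m c1 h1 h2
  have := lam_le h0 h2
  show _ < τ
  linarith

theorem Fare.rch (h : Fare Γ pts ω C c p q) : Rch Γ C p q := by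
  induction h with
  | refl p hp => exact Rch.refl
  | cons x c p q s h _ ih => exact (h.2.mono Set.inter_subset_right).trans ih

theorem fball_rch (h0 : ∀ x, 0 ≤ ω x) {ρ : ℝ} (h : q ∈ fball Γ pts ω C p ρ) :
    Rch Γ (fball Γ pts ω C p ρ) p q := by
  obtain ⟨c, hc, h⟩ := h
  have := Fare.sublevel_aux (Z := fball Γ pts ω C p ρ) (r := p) (ρ := ρ) h0
    (fun m c h1 h2 => ⟨c, h1, h2⟩) h 0 (Fare.refl p h.left_mem) (by linarith)
  exact this.rch.mono Set.inter_subset_right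

theorem Fare.exit (h0 : ∀ x, 0 ≤ ω x) (hκ : ∀ x, ω x ≤ κ) (hXC : X ⊆ C)
    (h : Fare Γ pts ω C c p q) : p ∈ X → q ∉ X → ∃ t s c1 c2, t ∈ X ∧ s ∉ X ∧ Γ t s ∧
      Fare Γ pts ω X c1 p t ∧ Fare Γ pts ω C c1 p s ∧ Fare Γ pts ω C c2 s q ∧ c2 ≤ c ∧
      c1 + c2 ≤ c + κ := by
  induction h with
  | refl p hp => exact fun h h' => absurd h h'
  | cons x c p q w h h' ih =>
    intro hp hw
    rcases h.2.split hp with ⟨h1, h2⟩ | ⟨t, s, h1, h2, h3, h4, h5, h6, h7⟩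
    · obtain ⟨t, s, c1, c2, a1, a2, a3, a4, a5, a6, a7, a8⟩ := ih h2 hw
      have e : pts x ∩ C ∩ X = pts x ∩ X := by
        ext m; constructor
        · rintro ⟨⟨h, _⟩, h'⟩; exact ⟨h, h'⟩
        · rintro ⟨h, h'⟩; exact ⟨⟨h, hXC h'⟩, h'⟩
      rw [e] at h1
      have := h0 x
      exact ⟨t, s, ω x + c1, c2, a1, a2, a3, Fare.cons x _ _ _ _ ⟨⟨h.1.1, hp⟩, h1⟩ a4,
        Fare.cons x _ _ _ _ h a5, a6, by linarith, by linarith⟩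
    · have e : pts x ∩ C ∩ X = pts x ∩ X := by
        ext m; constructor
        · rintro ⟨⟨h, _⟩, h'⟩; exact ⟨h, h'⟩
        · rintro ⟨h, h'⟩; exact ⟨⟨h, hXC h'⟩, h'⟩
      rw [e] at h1
      refine ⟨t, s, ω x, ω x + c, h2, h5, h4, Fare.of_ride ⟨⟨h.1.1, hp⟩, h1⟩, Fare.of_ride ⟨h.1, ?_⟩,
        Fare.cons x _ _ _ _ ⟨h6, h7⟩ h', le_rfl, ?_⟩
      · rw [← e] at h1
        exact (h1.mono Set.inter_subset_left).tail ⟨h4, h3, h6⟩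
      · have := hκ x; linarith

/-- Descend to a lower level along a fare. -/
theorem Fare.descend (h0 : ∀ x, 0 ≤ ω x) (hκ : ∀ x, ω x ≤ κ) (hs : ∀ a b, Γ a b → Γ b a)
    (hΓ : ∀ a b, Γ a b → ∃ x, a ∈ pts x ∧ b ∈ pts x) {Y : Set α} (hY : Y ⊆ C)
    (hτ : 0 < τ)
    (h : Fare Γ pts ω Y c r p) (hp : τ ≤ lam Γ pts ω C r p) :
    ∃ t, t ∈ Y ∧ lam Γ pts ω C r t < τ ∧ τ - κ ≤ lam Γ pts ω C r t ∧
      (∃ c' < τ, Fare Γ pts ω C c' r t) ∧ 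
      ∃ c' ≤ c - τ + 2 * κ, Fare Γ pts ω Y c' p t := by
  have hr : r ∈ C := hY h.left_mem
  have hlr := lam_self (Γ := Γ) (pts := pts) (r := r) h0 hr
  obtain ⟨t, s, c1, c2, a1, a2, a3, a4, a5, a6, a7, a8⟩ := Fare.exit (X := {m | m ∈ Y ∧ lam Γ pts ω C r m < τ})
    h0 hκ (fun m hm => hm.1) h ⟨h.left_mem, by linarith⟩ (fun hm => absurd hm.2 (not_lt.mpr hp))
  have hsY := a5.right_mem
  have hls : τ ≤ lam Γ pts ω C r s := by
    by_contra hcon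
    exact a2 ⟨hsY, not_le.mp hcon⟩
  obtain ⟨c3, b1, b2⟩ := Fare.of_adj (C := Y) (κ := κ) hΓ hκ (hs _ _ a3) hsY a1.1
  have e1 := lam_le h0 (a5.mono hY)
  have htex : Fare Γ pts ω C c1 r t := (a4.mono (fun m hm => hY hm.1))
  have e2 := lam_lip h0 ⟨_, htex⟩ ((b2.symm hs).mono hY)
  exact ⟨t, a1.1, a1.2, by linarith, exists_fare_of_lam_lt ⟨_, htex⟩ a1.2, c2 + c3, by linarith, (a6.symm hs).trans b2⟩


structure Layer (Γ : α → α → Prop) (pts : E → Set α) (ω : E → ℝ) (δ : ℝ) (C C' : Set α) (r : α) (τ : ℝ) :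
    Prop where
  hr : r ∈ C
  conn : ∀ p ∈ C, ∃ c, Fare Γ pts ω C c r p
  sub : C' ⊆ C
  lo : ∀ p ∈ C', τ ≤ lam Γ pts ω C r p
  hi : ∀ p ∈ C', lam Γ pts ω C r p < τ + δ
  closed : ∀ p ∈ C', ∀ q ∈ C, Γ p q → τ ≤ lam Γ pts ω C r q → lam Γ pts ω C r q < τ + δ → q ∈ C'

theorem Layer.exitwin {δ : ℝ} (h0 : ∀ x, 0 ≤ ω x) (hκ : ∀ x, ω x ≤ δ) (hs : ∀ a b, Γ a b → Γ b a)
    (hΓ : ∀ a b, Γ a b → ∃ x, a ∈ pts x ∧ b ∈ pts x) (hL : Layer Γ pts ω δ C C' r τ) (hτ : 0 < τ)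
    {x : α} (hx : x ∈ C') : ∃ t s, t ∈ C' ∧ Γ t s ∧ s ∈ C ∧ lam Γ pts ω C r s < τ ∧
      τ - δ ≤ lam Γ pts ω C r s ∧ ∃ c ≤ 3 * δ, Fare Γ pts ω C' c x t := by
  obtain ⟨c, hc, hF⟩ := exists_fare_of_lam_lt (hL.conn x (hL.sub hx)) (hL.hi x hx)
  have hrn : r ∉ C' := fun h => by
    have := hL.lo r h
    have := lam_self (Γ := Γ) (pts := pts) (r := r) h0 hL.hr
    linarith
  obtain ⟨t, s, c1, c2, a1, a2, a3, a4, a5, a6, a7, a8⟩ := Fare.exit (X := C')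
    h0 hκ hL.sub (hF.symm hs) hx hrn
  have hsC := a5.right_mem
  have e1 := lam_le h0 (a6.symm hs)
  have hlt : lam Γ pts ω C r s < τ := by
    by_contra hcon
    exact a2 (hL.closed t a1 s hsC a3 (not_lt.mp hcon) (by linarith))
  obtain ⟨c3, b1, b2⟩ := Fare.of_adj (C := C) (κ := δ) hΓ hκ (hs _ _ a3) hsC (hL.sub a1)
  have e2 := lam_lip h0 (hL.conn s hsC) b2
  have e3 := hL.lo t a1
  exact ⟨t, s, a1, a3, hsC, hlt, by linarith, c1, by linarith, a4⟩

theorem fball_self {ρ : ℝ} (hρ : 0 ≤ ρ) (hp : p ∈ C) : p ∈ fball Γ pts ω C p ρ := ⟨0, hρ, Fare.refl p hp⟩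

theorem sublevel_rch (h0 : ∀ x, 0 ≤ ω x) (hex : ∃ c, Fare Γ pts ω C c r p) (h : lam Γ pts ω C r p < τ) :
    Rch Γ {m | m ∈ C ∧ lam Γ pts ω C r m < τ} r p := by
  obtain ⟨c, hc, hF⟩ := exists_fare_of_lam_lt hex h
  exact (Fare.sublevel h0 hF hc).rch

theorem KPR_three {δ : ℝ} (hδ : 0 < δ) (h0 : ∀ x, 0 ≤ ω x) (hκ : ∀ x, ω x ≤ δ) (hs : ∀ a b, Γ a b → Γ b a)
    (hΓ : ∀ a b, Γ a b → ∃ x, a ∈ pts x ∧ b ∈ pts x) (hNP : NPl Γ)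
    {C0 C1 C2 C3 : Set α} {r1 r2 r3 : α} {τ1 τ2 τ3 : ℝ}
    (L1 : Layer Γ pts ω δ C0 C1 r1 τ1) (L2 : Layer Γ pts ω δ C1 C2 r2 τ2)
    (L3 : Layer Γ pts ω δ C2 C3 r3 τ3) (x : Fin 3 → α) (hx : ∀ j, x j ∈ C3)
    (hfar : ∀ j l, j ≠ l → ∀ c, Fare Γ pts ω C0 c (x j) (x l) → 33 * δ ≤ c) : False := by
  have hx2 : ∀ j, x j ∈ C2 := fun j => L3.sub (hx j)
  have hx1 : ∀ j, x j ∈ C1 := fun j => L2.sub (hx2 j)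
  have hx0 : ∀ j, x j ∈ C0 := fun j => L1.sub (hx1 j)
  have near : ∀ r : α, ∀ ρ : ℝ, (∀ j, ∃ c < ρ, Fare Γ pts ω C0 c r (x j)) → 33 * δ < 2 * ρ := by
    intro r ρ h
    obtain ⟨c, hc, h1⟩ := h 0
    obtain ⟨c', hc', h2⟩ := h 1
    have := hfar 0 1 (by decide) _ ((h1.symm hs).trans h2)
    linarith
  have hτ3 : 0 < τ3 - 5 * δ := by
    by_contra hcon
    have := near r3 (τ3 + δ) (fun j => by
      obtain ⟨c, hc, h⟩ := exists_fare_of_lam_lt (L3.conn _ (hx2 j)) (L3.hi _ (hx j))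
      exact ⟨c, hc, h.mono (L2.sub.trans L1.sub)⟩)
    linarith
  have hτ2 : 0 < τ2 - 9 * δ := by
    by_contra hcon
    have := near r2 (τ2 + δ) (fun j => by
      obtain ⟨c, hc, h⟩ := exists_fare_of_lam_lt (L2.conn _ (hx1 j)) (L2.hi _ (hx2 j))
      exact ⟨c, hc, h.mono L1.sub⟩)
    linarith
  have hτ1 : 0 < τ1 := by
    by_contra hcon
    have := near r1 (τ1 + δ) (fun j => by
      obtain ⟨c, hc, h⟩ := exists_fare_of_lam_lt (L1.conn _ (hx0 j)) (L1.hi _ (hx1 j))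
      exact ⟨c, hc, h⟩)
    linarith
  set l1 := lam Γ pts ω C0 r1 with hl1
  set l2 := lam Γ pts ω C1 r2 with hl2
  set l3 := lam Γ pts ω C2 r3 with hl3
  set Y : Set α := {m | m ∈ C1 ∧ l2 m < τ2} with hY
  have hYC : Y ⊆ C1 := fun m hm => hm.1
  -- level 3 descent
  have d3 : ∀ j, ∃ t, t ∈ C2 ∧ l3 t < τ3 - 5 * δ ∧ t ∈ fball Γ pts ω C2 (x j) (9 * δ) := by
    intro j
    obtain ⟨c, hc, h⟩ := exists_fare_of_lam_lt (L3.conn _ (hx2 j)) (L3.hi _ (hx j))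
    have := L3.lo _ (hx j)
    obtain ⟨t, a1, a2, a3, a4, c', a5, a6⟩ := Fare.descend h0 hκ hs hΓ (subset_refl C2) hτ3 h (by linarith)
    exact ⟨t, a1, a2, c', by linarith, a6⟩
  -- exit from C2
  have d2 : ∀ j, ∃ t s, t ∈ C2 ∧ Γ t s ∧ s ∈ C1 ∧ l2 s < τ2 ∧
      τ2 - δ ≤ l2 s ∧ ∃ c ≤ 3 * δ, Fare Γ pts ω C2 c (x j) t := fun j =>
    L2.exitwin h0 hκ hs hΓ (by linarith) (hx2 j)
  choose t s ht hts hsC hs2 hs2' htF using d2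
  have hsY : ∀ j, s j ∈ Y := fun j => ⟨hsC j, hs2 j⟩
  have hsF : ∀ j, ∃ c < τ2, Fare Γ pts ω Y c r2 (s j) := by
    intro j
    obtain ⟨c, hc, h⟩ := exists_fare_of_lam_lt (L2.conn _ (hsC j)) (hs2 j)
    exact ⟨c, hc, h.sublevel h0 hc⟩
  have e2 : ∀ j, ∃ u, u ∈ C1 ∧ l2 u < τ2 - 9 * δ ∧ u ∈ fball Γ pts ω Y (s j) (12 * δ) := by
    intro j
    obtain ⟨c, hc, h⟩ := hsF j
    have := hs2' j
    obtain ⟨t, a1, a2, a3, a4, c', a5, a6⟩ := Fare.descend h0 hκ hs hΓ hYC hτ2 h (by linarith)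
    exact ⟨t, a1.1, a2, c', by linarith, a6⟩
  have e1 : ∀ j, ∃ v, v ∈ C1 ∧ l2 v < τ2 - 4 * δ ∧ τ2 - 5 * δ ≤ l2 v ∧ v ∈ fball Γ pts ω Y (s j) (7 * δ) := by
    intro j
    obtain ⟨c, hc, h⟩ := hsF j
    have := hs2' j
    obtain ⟨t, a1, a2, a3, a4, c', a5, a6⟩ := Fare.descend h0 hκ hs hΓ hYC
      (τ := τ2 - 4 * δ) (by linarith) h (by linarith)
    exact ⟨t, a1.1, a2, by linarith, c', by linarith, a6⟩
  choose u hu hul huF using e2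
  choose v hv hvl hvl' hvF using e1
  have d1 : ∀ j, ∃ t s, t ∈ C1 ∧ Γ t s ∧ s ∈ C0 ∧ l1 s < τ1 ∧
      τ1 - δ ≤ l1 s ∧ ∃ c ≤ 3 * δ, Fare Γ pts ω C1 c (v j) t := fun j =>
    L1.exitwin h0 hκ hs hΓ (by linarith) (hv j)
  choose t' s' ht' hts' hsC' hs1 hs1' htF' using d1
  choose w hw hwl hwF using d3
  -- the sets
  let A3 : Set α := {m | m ∈ C2 ∧ l3 m < τ3 - 5 * δ}
  let A2 : Set α := {m | m ∈ C1 ∧ l2 m < τ2 - 9 * δ}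
  let A1 : Set α := {m | m ∈ C0 ∧ l1 m < τ1}
  let N3 : Fin 3 → Set α := fun j => fball Γ pts ω C2 (x j) (9 * δ)
  let N2 : Fin 3 → Set α := fun j => fball Γ pts ω C2 (x j) (4 * δ) ∪ fball Γ pts ω Y (s j) (12 * δ)
  let N1 : Fin 3 → Set α := fun j => fball Γ pts ω C2 (x j) (4 * δ) ∪ fball Γ pts ω Y (s j) (7 * δ) ∪
    fball Γ pts ω C1 (v j) (4 * δ)
  have hA3 : r3 ∈ A3 := ⟨L3.hr, by
    have := lam_self (Γ := Γ) (pts := pts) (ω := ω) h0 L3.hr; linarith⟩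
  have hA2 : r2 ∈ A2 := ⟨L2.hr, by
    have := lam_self (Γ := Γ) (pts := pts) (ω := ω) h0 L2.hr; linarith⟩
  have hA1 : r1 ∈ A1 := ⟨L1.hr, by
    have := lam_self (Γ := Γ) (pts := pts) (ω := ω) h0 L1.hr; linarith⟩
  -- connectivity
  have htball : ∀ j, t j ∈ fball Γ pts ω C2 (x j) (4 * δ) := fun j => by
    obtain ⟨c, hc, h⟩ := htF j
    exact ⟨c, by linarith, h⟩
  have c3 : ∀ j, Rch Γ (N3 j ∪ A3) r3 (x j) := fun j =>
    ((sublevel_rch h0 (L3.conn _ (hw j)) (hwl j)).mono Set.subset_union_right).trans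
      (((fball_rch h0 (hwF j)).symm hs).mono Set.subset_union_left)
  have c2 : ∀ j, Rch Γ (N2 j ∪ A2) r2 (x j) := fun j => by
    have q1 := (sublevel_rch h0 (L2.conn _ (hu j)) (hul j)).mono (Y := N2 j ∪ A2) Set.subset_union_right
    have q2 := ((fball_rch h0 (huF j)).symm hs).mono (Y := N2 j ∪ A2) (fun m hm => Or.inl (Or.inr hm))
    have q3 : Rch Γ (N2 j ∪ A2) (s j) (t j) := Rch.single (hs _ _ (hts j))
      (Or.inl (Or.inr (fball_self (by linarith) (hsY j)))) (Or.inl (Or.inl (htball j)))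
    have q4 := ((fball_rch h0 (htball j)).symm hs).mono (Y := N2 j ∪ A2) (fun m hm => Or.inl (Or.inl hm))
    exact ((q1.trans q2).trans q3).trans q4
  have c1 : ∀ j, Rch Γ (N1 j ∪ A1) r1 (x j) := fun j => by
    have htb' : t' j ∈ fball Γ pts ω C1 (v j) (4 * δ) := by
      obtain ⟨c, hc, h⟩ := htF' j
      exact ⟨c, by linarith, h⟩
    have q1 := (sublevel_rch h0 (L1.conn _ (hsC' j)) (hs1 j)).mono (Y := N1 j ∪ A1) Set.subset_union_right
    have q2 : Rch Γ (N1 j ∪ A1) (s' j) (t' j) := Rch.single (hs _ _ (hts' j))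
      (Or.inr ⟨hsC' j, hs1 j⟩) (Or.inl (Or.inr htb'))
    have q3 := ((fball_rch h0 htb').symm hs).mono (Y := N1 j ∪ A1) (fun m hm => Or.inl (Or.inr hm))
    have q4 := ((fball_rch h0 (hvF j)).symm hs).mono (Y := N1 j ∪ A1)
      (fun m hm => Or.inl (Or.inl (Or.inr hm)))
    have q5 : Rch Γ (N1 j ∪ A1) (s j) (t j) := Rch.single (hs _ _ (hts j))
      (Or.inl (Or.inl (Or.inr (fball_self (by linarith) (hsY j)))))
      (Or.inl (Or.inl (Or.inl (htball j))))
    have q6 := ((fball_rch h0 (htball j)).symm hs).mono (Y := N1 j ∪ A1)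
      (fun m hm => Or.inl (Or.inl (Or.inl hm)))
    exact ((((q1.trans q2).trans q3).trans q4).trans q5).trans q6
  -- distances
  have hsx : ∀ j, ∃ c ≤ 4 * δ, Fare Γ pts ω C1 c (x j) (s j) := fun j => by
    obtain ⟨c, hc, h⟩ := htF j
    obtain ⟨c', hc', h'⟩ := Fare.of_adj (C := C1) (κ := δ) hΓ hκ (hts j) (L2.sub (ht j)) (hsC j)
    exact ⟨c + c', by linarith, (h.mono L2.sub).trans h'⟩
  have f3 : ∀ j m, m ∈ N3 j → ∃ c ≤ 16 * δ, Fare Γ pts ω C0 c (x j) m := by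
    rintro j m ⟨c, hc, h⟩
    exact ⟨c, by linarith, h.mono (L2.sub.trans L1.sub)⟩
  have f2 : ∀ j m, m ∈ N2 j → ∃ c ≤ 16 * δ, Fare Γ pts ω C0 c (x j) m := by
    rintro j m (⟨c, hc, h⟩ | ⟨c, hc, h⟩)
    · exact ⟨c, by linarith, h.mono (L2.sub.trans L1.sub)⟩
    · obtain ⟨c', hc', h'⟩ := hsx j
      exact ⟨c' + c, by linarith, (h'.mono L1.sub).trans (h.mono (hYC.trans L1.sub))⟩
  have f1 : ∀ j m, m ∈ N1 j → ∃ c ≤ 16 * δ, Fare Γ pts ω C0 c (x j) m := by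
    rintro j m ((⟨c, hc, h⟩ | ⟨c, hc, h⟩) | ⟨c, hc, h⟩)
    · exact ⟨c, by linarith, h.mono (L2.sub.trans L1.sub)⟩
    · obtain ⟨c', hc', h'⟩ := hsx j
      exact ⟨c' + c, by linarith, (h'.mono L1.sub).trans (h.mono (hYC.trans L1.sub))⟩
    · obtain ⟨c', hc', h'⟩ := hsx j
      obtain ⟨c'', hc'', h''⟩ := hvF j
      exact ⟨c' + c'' + c, by linarith, ((h'.mono L1.sub).trans (h''.mono (hYC.trans L1.sub))).trans
        (h.mono L1.sub)⟩
  have dfar : ∀ j l m, j ≠ l → (∃ c ≤ 16 * δ, Fare Γ pts ω C0 c (x j) m) →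
      (∃ c ≤ 16 * δ, Fare Γ pts ω C0 c (x l) m) → False := by
    rintro j l m hjl ⟨c, hc, h⟩ ⟨c', hc', h'⟩
    have := hfar j l hjl _ (h.trans (h'.symm hs))
    linarith
  -- levels
  have lev : ∀ j m, m ∈ fball Γ pts ω C2 (x j) (4 * δ) → m ∈ C2 ∧ τ3 - 5 * δ ≤ l3 m := by
    rintro j m ⟨c, hc, h⟩
    refine ⟨h.right_mem, ?_⟩
    have a := lam_lip h0 (L3.conn m h.right_mem) (h.symm hs)
    have b := L3.lo _ (hx j)
    simp only [← hl3] at a b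
    linarith
  have levY : ∀ j m, m ∈ fball Γ pts ω Y (s j) (7 * δ) → τ2 - 9 * δ ≤ l2 m := by
    rintro j m ⟨c, hc, h⟩
    have a := lam_lip h0 (L2.conn m h.right_mem.1) ((h.mono hYC).symm hs)
    have b := hs2' j
    simp only [← hl2] at a
    linarith
  have levv : ∀ j m, m ∈ fball Γ pts ω C1 (v j) (4 * δ) → m ∈ C1 ∧ τ2 - 9 * δ ≤ l2 m ∧ l2 m < τ2 := by
    rintro j m ⟨c, hc, h⟩
    have a := lam_lip h0 (L2.conn m h.right_mem) (h.symm hs)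
    have a' := lam_lip h0 (L2.conn _ (hv j)) h
    have b := hvl j
    have b' := hvl' j
    simp only [← hl2] at a a'
    exact ⟨h.right_mem, by linarith, by linarith⟩
  have g32 : ∀ j l m, j ≠ l → m ∈ N3 j ∪ A3 → m ∈ N2 l ∪ A2 → False := by
    rintro j l m hjl (h | h) (h' | h')
    · exact dfar j l m hjl (f3 j m h) (f2 l m h')
    · obtain ⟨c, -, h⟩ := h
      have := L2.lo m h.right_mem
      have := h'.2
      linarith
    · rcases h' with h' | ⟨c, -, h'⟩
      · have := (lev l m h').2
        have := h.2
        linarith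
      · have := L2.lo m h.1
        have := h'.right_mem.2
        linarith
    · have := L2.lo m h.1
      have := h'.2
      linarith
  have g31 : ∀ j l m, j ≠ l → m ∈ N3 j ∪ A3 → m ∈ N1 l ∪ A1 → False := by
    rintro j l m hjl (h | h) (h' | h')
    · exact dfar j l m hjl (f3 j m h) (f1 l m h')
    · obtain ⟨c, -, h⟩ := h
      have := L1.lo m (L2.sub h.right_mem)
      have := h'.2
      linarith
    · rcases h' with (h' | ⟨c, -, h'⟩) | h'
      · have := (lev l m h').2
        have := h.2
        linarith
      · have := L2.lo m h.1
        have := h'.right_mem.2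
        linarith
      · have := L2.lo m h.1
        have := (levv l m h').2.2
        linarith
    · have := L1.lo m (L2.sub h.1)
      have := h'.2
      linarith
  have g21 : ∀ j l m, j ≠ l → m ∈ N2 j ∪ A2 → m ∈ N1 l ∪ A1 → False := by
    rintro j l m hjl (h | h) (h' | h')
    · exact dfar j l m hjl (f2 j m h) (f1 l m h')
    · have hm : m ∈ C1 := by
        rcases h with ⟨c, -, h⟩ | ⟨c, -, h⟩
        · exact L2.sub h.right_mem
        · exact h.right_mem.1
      have := L1.lo m hm
      have := h'.2
      linarith
    · rcases h' with (⟨c, -, h'⟩ | h') | h'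
      · have := L2.lo m h'.right_mem
        have := h.2
        linarith
      · have := levY l m h'
        have := h.2
        linarith
      · have := (levv l m h').2.1
        have := h.2
        linarith
    · have := L1.lo m h.1
      have := h'.2
      linarith
  obtain ⟨i, k, j, l, hik, hjl, m, hm1, hm2⟩ := hNP ![r1, r2, r3] x
    ![fun j => N1 j ∪ A1, fun j => N2 j ∪ A2, fun j => N3 j ∪ A3]
    (by intro i j; fin_cases i
        · exact Or.inr hA1
        · exact Or.inr hA2
        · exact Or.inr hA3)
    (by intro i j; fin_cases i
        · exact c1 j
        · exact c2 j
        · exact c3 j)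
  fin_cases i <;> fin_cases k <;> first | exact hik rfl | skip
  · exact g21 l j m hjl.symm hm2 hm1
  · exact g31 l j m hjl.symm hm2 hm1
  · exact g21 j l m hjl hm1 hm2
  · exact g32 l j m hjl.symm hm2 hm1
  · exact g31 j l m hjl hm1 hm2
  · exact g32 j l m hjl hm1 hm2

/-- the diameter bound -/
theorem KPR_diam {δ : ℝ} (hδ : 0 < δ) (h0 : ∀ x, 0 ≤ ω x) (hκ : ∀ x, ω x ≤ δ) (hs : ∀ a b, Γ a b → Γ b a)
    (hΓ : ∀ a b, Γ a b → ∃ x, a ∈ pts x ∧ b ∈ pts x) (hNP : NPl Γ)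
    {C0 C1 C2 C3 : Set α} {r1 r2 r3 : α} {τ1 τ2 τ3 : ℝ}
    (L1 : Layer Γ pts ω δ C0 C1 r1 τ1) (L2 : Layer Γ pts ω δ C1 C2 r2 τ2)
    (L3 : Layer Γ pts ω δ C2 C3 r3 τ3) {x y : α} (hx : x ∈ C3) (hxy : Rch Γ C3 x y) :
    ∃ c < 67 * δ, Fare Γ pts ω C0 c x y := by
  by_contra hcon
  push Not at hcon
  have hC : C3 ⊆ C0 := L3.sub.trans (L2.sub.trans L1.sub)
  have hex := Fare.of_rch (ω := ω) hΓ (hxy.mono hC) (hC hx)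
  set X : Set α := {m | m ∈ C3 ∧ ∃ c < 33 * δ, Fare Γ pts ω C0 c x m} with hX
  rcases hxy.split (Y := X) ⟨hx, 0, by linarith, Fare.refl x (hC hx)⟩ with ⟨h1, h2⟩ | ⟨t, s, -, h2, -, h4, h5, h6, -⟩
  · obtain ⟨-, c, hc, h⟩ := h2
    exact hcon c (by linarith) h
  · obtain ⟨ht, c, hc, h⟩ := h2
    obtain ⟨c', hc', h'⟩ := Fare.of_adj (C := C0) (κ := δ) hΓ hκ h4 (hC ht) (hC h6)
    have hxs := h.trans h'
    have hy := hxy.mem hx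
    have a1 : ∀ c, Fare Γ pts ω C0 c x s → 33 * δ ≤ c := fun c hc => by
      by_contra hlt
      exact h5 ⟨h6, c, not_le.mp hlt, hc⟩
    have a2 : ∀ c, Fare Γ pts ω C0 c s y → 33 * δ ≤ c := fun c2 hc2 => by
      by_contra hlt
      exact hcon _ (by linarith) (hxs.trans hc2)
    have a3 : ∀ c, Fare Γ pts ω C0 c x y → 33 * δ ≤ c := fun c hc => by
      by_contra hlt
      exact hcon c (by linarith) hc
    refine KPR_three hδ h0 hκ hs hΓ hNP L1 L2 L3 ![x, s, y] ?_ ?_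
    · intro j; fin_cases j
      · exact hx
      · exact h6
      · exact hy
    · intro j l hjl c hF
      fin_cases j <;> fin_cases l <;> first | exact absurd rfl hjl | skip
      · exact a1 c hF
      · exact a3 c hF
      · exact a1 c (hF.symm hs)
      · exact a2 c hF
      · exact a3 c (hF.symm hs)
      · exact a2 c (hF.symm hs)

end Fares

section Chop
variable {α E : Type*}

structure Comp (Γ : α → α → Prop) (K : α → Set α) : Prop where
  self : ∀ p, p ∈ K p
  eq : ∀ p q, q ∈ K p → K q = K p
  conn : ∀ p q, q ∈ K p → Rch Γ (K p) p q

variable {Γ : α → α → Prop} {pts : E → Set α} {ω : E → ℝ} {δ : ℝ}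

theorem offset_count [Fintype E] (m : E → ℝ) (hδ : 0 < δ) (h0 : ∀ x, 0 ≤ ω x)
    (bad : ℝ → E → Prop)
    (hbad : ∀ θ x, bad θ x → ∃ k : ℤ, m x < k * δ + θ ∧ k * δ + θ ≤ m x + ω x) :
    ∃ θ : ℝ, (Set.ncard {x | bad θ x} : ℝ) ≤ (∑ x, ω x) / δ + 1 := by
  classical
  set N : ℕ := Fintype.card E + 1 with hN
  have hNpos : (0:ℝ) < N := by positivity
  by_contra hcon
  push Not at hcon
  let B : ℕ → Finset E := fun i => Finset.univ.filter (fun x => bad (i * δ / N) x)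
  have hB : ∀ i : ℕ, (∑ x, ω x) / δ + 1 < (B i).card := by
    intro i
    have := hcon (i * δ / N)
    have e : {x | bad (i * δ / N) x} = (B i : Set E) := by ext x; simp [B]
    rw [e, Set.ncard_coe_finset] at this
    exact this
  have hx : ∀ x, (((Finset.range N).filter (fun i => x ∈ B i)).card : ℝ) ≤ ω x * N / δ + 1 := by
    intro x
    have key : ((Finset.range N).filter (fun i => x ∈ B i)).card ≤
        (Finset.Ioc ⌊m x * N / δ⌋ ⌊(m x + ω x) * N / δ⌋).card := by
      have hk : ∀ i ∈ (Finset.range N).filter (fun i => x ∈ B i), ∃ k : ℤ,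
          m x < k * δ + i * δ / N ∧ k * δ + i * δ / N ≤ m x + ω x := by
        intro i hi
        have hi := (Finset.mem_filter.mp hi).2
        exact hbad _ _ (by simpa [B] using hi)
      choose! k hk1 hk2 using hk
      apply Finset.card_le_card_of_injOn (fun i : ℕ => k i * N + i)
      · intro i hi
        have a := hk1 i hi
        have b := hk2 i hi
        simp only [Finset.coe_Ioc, Set.mem_Ioc]
        constructor
        · rw [Int.floor_lt]
          push_cast
          rw [div_lt_iff₀ hδ]
          have : (↑(k i) * ↑N + (i:ℝ)) * δ = (k i * δ + i * δ / N) * N := by field_simp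
          rw [this]
          exact mul_lt_mul_of_pos_right a hNpos
        · rw [Int.le_floor]
          push_cast
          rw [le_div_iff₀ hδ]
          have : (↑(k i) * ↑N + (i:ℝ)) * δ = (k i * δ + i * δ / N) * N := by field_simp
          rw [this]
          exact mul_le_mul_of_nonneg_right b hNpos.le
      · intro i hi j hj hij
        have hi := Finset.mem_range.mp (Finset.mem_filter.mp (Finset.mem_coe.mp hi)).1
        have hj := Finset.mem_range.mp (Finset.mem_filter.mp (Finset.mem_coe.mp hj)).1
        simp only at hij
        have h1 : ((i:ℤ)) % N = (j:ℤ) % N := by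
          have := congrArg (· % (N:ℤ)) hij
          simpa [Int.add_emod, Int.mul_emod] using this
        rw [Int.emod_eq_of_lt (by omega) (by omega), Int.emod_eq_of_lt (by omega) (by omega)] at h1
        exact_mod_cast h1
    have c2 : ((Finset.Ioc ⌊m x * N / δ⌋ ⌊(m x + ω x) * N / δ⌋).card : ℝ) ≤ ω x * N / δ + 1 := by
      rw [Int.card_Ioc]
      have hnn : 0 ≤ ⌊(m x + ω x) * N / δ⌋ - ⌊m x * N / δ⌋ := by
        have : ⌊m x * N / δ⌋ ≤ ⌊(m x + ω x) * N / δ⌋ := by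
          apply Int.floor_le_floor
          have := h0 x
          gcongr
          linarith
        omega
      have e : (((⌊(m x + ω x) * N / δ⌋ - ⌊m x * N / δ⌋).toNat : ℕ) : ℝ) =
        ((⌊(m x + ω x) * N / δ⌋ - ⌊m x * N / δ⌋ : ℤ) : ℝ) := by
        exact_mod_cast Int.toNat_of_nonneg hnn
      rw [e]
      push_cast
      have := Int.floor_le ((m x + ω x) * N / δ)
      have := Int.lt_floor_add_one (m x * N / δ)
      have : (m x + ω x) * N / δ = m x * N / δ + ω x * N / δ := by ring
      linarith
    have : (((Finset.range N).filter (fun i => x ∈ B i)).card : ℝ) ≤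
        ((Finset.Ioc ⌊m x * N / δ⌋ ⌊(m x + ω x) * N / δ⌋).card : ℝ) := by exact_mod_cast key
    linarith
  have dc : ∑ i ∈ Finset.range N, ((B i).card : ℝ) = ∑ x : E, (((Finset.range N).filter (fun i => x ∈ B i)).card : ℝ) := by
    have := Finset.sum_card_bipartiteAbove_eq_sum_card_bipartiteBelow (s := Finset.range N)
      (t := (Finset.univ : Finset E)) (fun i x => x ∈ B i)
    have h2 : ∀ i, Finset.bipartiteAbove (fun i x => x ∈ B i) (Finset.univ : Finset E) i = B i := by
      intro i; ext x; simp [Finset.bipartiteAbove]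
    simp only [h2] at this
    exact_mod_cast this
  have l1 : (N:ℝ) * ((∑ x, ω x) / δ + 1) < ∑ i ∈ Finset.range N, ((B i).card : ℝ) := by
    have := Finset.sum_lt_sum_of_nonempty (s := Finset.range N) (by simp [hN])
      (f := fun _ => (∑ x, ω x) / δ + 1) (g := fun i => ((B i).card : ℝ)) (fun i _ => hB i)
    rw [Finset.sum_const, Finset.card_range, nsmul_eq_mul] at this
    exact this
  have l2 : ∑ x : E, (((Finset.range N).filter (fun i => x ∈ B i)).card : ℝ) ≤ (∑ x, ω x) * N / δ + Fintype.card E := by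
    calc _ ≤ ∑ x : E, (ω x * N / δ + 1) := Finset.sum_le_sum (fun x _ => hx x)
      _ = _ := by
        rw [Finset.sum_add_distrib, ← Finset.sum_div, ← Finset.sum_mul]; simp
  have : (N:ℝ) * ((∑ x, ω x) / δ + 1) = (∑ x, ω x) * N / δ + N := by ring
  have : (N:ℝ) = Fintype.card E + 1 := by simp [hN]
  linarith

theorem chop_step [Fintype E] (hδ : 0 < δ) (h0 : ∀ x, 0 ≤ ω x)
    (hs : ∀ a b, Γ a b → Γ b a)
    (hΓ : ∀ a b, Γ a b → ∃ x, a ∈ pts x ∧ b ∈ pts x)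
    (hconn : ∀ x, ∀ p ∈ pts x, ∀ q ∈ pts x, Rch Γ (pts x) p q) {K : α → Set α} (hK : Comp Γ K) :
    ∃ K' : α → Set α, Comp Γ K' ∧ (∀ p, ∃ r τ, Layer Γ pts ω δ (K p) (K' p) r τ) ∧
      (Set.ncard {x | (∀ p ∈ pts x, ∀ q ∈ pts x, K p = K q) ∧ ¬ (∀ p ∈ pts x, ∀ q ∈ pts x, K' p = K' q)} : ℝ)
        ≤ (∑ x, ω x) / δ + 1 := by
  classical
  have hne : ∀ p, (K p).Nonempty := fun p => ⟨p, hK.self p⟩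
  let rt : α → α := fun p => (hne p).some
  have hrt : ∀ p, rt p ∈ K p := fun p => (hne p).some_mem
  have hsome : ∀ (s t : Set α) (hs : s.Nonempty) (ht : t.Nonempty), s = t → hs.some = ht.some := by
    intro s t hs ht h; subst h; rfl
  have hrteq : ∀ p q, K p = K q → rt p = rt q := fun p q h => hsome _ _ _ _ h
  let l : α → ℝ := fun p => lam Γ pts ω (K p) (rt p) p
  have hl : ∀ p q, q ∈ K p → l q = lam Γ pts ω (K p) (rt p) q := by
    intro p q hq
    have := hK.eq p q hq
    show lam Γ pts ω (K q) (rt q) q = _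
    rw [hrteq q p this, this]
  have hfare : ∀ p, ∀ q ∈ K p, ∃ c, Fare Γ pts ω (K p) c (rt p) q := by
    intro p q hq
    have h1 := hK.conn p q hq
    have h2 := hK.conn p _ (hrt p)
    exact Fare.of_rch hΓ ((h2.symm hs).trans h1) (hrt p)
  have hlip : ∀ x, (∀ p ∈ pts x, ∀ q ∈ pts x, K p = K q) → ∀ p ∈ pts x, ∀ q ∈ pts x, l q ≤ l p + ω x := by
    intro x hx p hp q hq
    have hsub : pts x ⊆ K p := fun m hm => by rw [hx p hp m hm]; exact hK.self m
    rw [hl p q (hsub hq)]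
    apply lam_lip h0 (hfare p p (hK.self p))
    apply Fare.of_ride
    refine ⟨⟨hp, hK.self p⟩, ?_⟩
    rw [Set.inter_eq_left.mpr hsub]
    exact hconn x p hp q hq
  let cell : ℝ → α → ℤ := fun θ p => ⌊(l p - θ) / δ⌋
  have hcell : ∀ θ p (k : ℤ), cell θ p = k ↔ k * δ + θ ≤ l p ∧ l p < k * δ + θ + δ := by
    intro θ p k
    show ⌊(l p - θ) / δ⌋ = k ↔ _
    rw [Int.floor_eq_iff, le_div_iff₀ hδ, div_lt_iff₀ hδ]
    constructor
    · rintro ⟨h1, h2⟩; constructor <;> nlinarith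
    · rintro ⟨h1, h2⟩; constructor <;> nlinarith
  obtain ⟨θ, hθ⟩ := offset_count (ω := ω) (δ := δ) (fun x => sInf (l '' pts x)) hδ h0
    (fun θ x => (∀ p ∈ pts x, ∀ q ∈ pts x, K p = K q) ∧ ¬ (∀ p ∈ pts x, ∀ q ∈ pts x, cell θ p = cell θ q)) (by
      rintro θ x ⟨hx, hc⟩
      push Not at hc
      obtain ⟨p, hp, q, hq, hpq⟩ := hc
      wlog hlt : cell θ p < cell θ q generalizing p q
      · exact this q hq p hp hpq.symm (lt_of_le_of_ne (not_lt.mp hlt) hpq.symm)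
      obtain ⟨a1, a2⟩ := (hcell θ p _).mp rfl
      obtain ⟨b1, b2⟩ := (hcell θ q _).mp rfl
      have hbd : BddBelow (l '' pts x) := ⟨l p - ω x, by
        rintro _ ⟨m, hm, rfl⟩
        have := hlip x hx m hm p hp
        linarith⟩
      have c1 : sInf (l '' pts x) ≤ l p := csInf_le hbd ⟨p, hp, rfl⟩
      have c2 : l q - ω x ≤ sInf (l '' pts x) := le_csInf ⟨_, p, hp, rfl⟩ (by
        rintro _ ⟨m, hm, rfl⟩
        have := hlip x hx m hm q hq
        linarith)
      refine ⟨cell θ q, ?_, ?_⟩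
      · have : ((cell θ p : ℝ) + 1) ≤ cell θ q := by exact_mod_cast hlt
        nlinarith
      · linarith)
  let Z : α → Set α := fun p => {m | m ∈ K p ∧ cell θ m = cell θ p}
  have hZeq : ∀ p q, q ∈ Z p → Z q = Z p := by
    intro p q hq
    show {m | m ∈ K q ∧ cell θ m = cell θ q} = {m | m ∈ K p ∧ cell θ m = cell θ p}
    rw [hK.eq p q hq.1, hq.2]
  have hZself : ∀ p, p ∈ Z p := fun p => ⟨hK.self p, rfl⟩
  let K' : α → Set α := fun p => {q | Rch Γ (Z p) p q}
  have hKZ : ∀ p, K' p ⊆ Z p := fun p q hq => Rch.mem hq (hZself p)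
  refine ⟨K', ⟨fun p => Rch.refl, ?_, ?_⟩, ?_, ?_⟩
  · intro p q hq
    have hz := hZeq p q (hKZ p hq)
    ext m
    show Rch Γ (Z q) q m ↔ Rch Γ (Z p) p m
    rw [hz]
    exact ⟨fun h => Rch.trans hq h, fun h => (Rch.symm hs hq).trans h⟩
  · intro p q hq
    have := Rch.restrict (Y := K' p) hq (fun m hm => hm)
    exact this.mono Set.inter_subset_right
  · intro p
    refine ⟨rt p, cell θ p * δ + θ, hrt p, hfare p, fun q hq => (hKZ p hq).1, ?_, ?_, ?_⟩
    · intro q hq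
      have hq := hKZ p hq
      rw [← hl p q hq.1]
      exact ((hcell θ q _).mp hq.2).1
    · intro q hq
      have hq := hKZ p hq
      rw [← hl p q hq.1]
      exact ((hcell θ q _).mp hq.2).2
    · intro m hm q hq hmq h1 h2
      rw [← hl p q hq] at h1 h2
      have hqZ : q ∈ Z p := ⟨hq, (hcell θ q _).mpr ⟨h1, h2⟩⟩
      exact Rch.trans hm (Rch.single hmq (hKZ p hm) hqZ)
  · refine le_trans ?_ hθ
    have : Set.ncard {x | (∀ p ∈ pts x, ∀ q ∈ pts x, K p = K q) ∧ ¬ (∀ p ∈ pts x, ∀ q ∈ pts x, K' p = K' q)} ≤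
      Set.ncard {x | (∀ p ∈ pts x, ∀ q ∈ pts x, K p = K q) ∧ ¬ (∀ p ∈ pts x, ∀ q ∈ pts x, cell θ p = cell θ q)} := by
      apply Set.ncard_le_ncard _ (Set.toFinite _)
      rintro x ⟨h1, h2⟩
      refine ⟨h1, fun h3 => h2 ?_⟩
      intro p hp q hq
      have hsub : pts x ⊆ Z p := fun m hm => ⟨by rw [h1 p hp m hm]; exact hK.self m, h3 m hm p hp⟩
      have hz := hZeq p q (hsub hq)
      have hpq : Rch Γ (Z p) p q := (hconn x p hp q hq).mono hsub
      ext m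
      show Rch Γ (Z p) p m ↔ Rch Γ (Z q) q m
      rw [hz]
      exact ⟨fun h => (Rch.symm hs hpq).trans h, fun h => Rch.trans hpq h⟩
    exact_mod_cast this

theorem Fare.support [DecidableEq E] (h0 : ∀ x, 0 ≤ ω x) {C : Set α} {c : ℝ} {p q : α} (h : Fare Γ pts ω C c p q) :
    ∃ P : Finset E, ∑ z ∈ P, ω z ≤ c ∧ Rch Γ (⋃ z ∈ P, pts z) p q := by
  induction h with
  | refl p hp => exact ⟨∅, by simp, Rch.refl⟩
  | cons x c p q s h _ ih =>
    obtain ⟨P, h1, h2⟩ := ih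
    refine ⟨insert x P, ?_, ?_⟩
    · by_cases hx : x ∈ P
      · rw [Finset.insert_eq_of_mem hx]
        have := h0 x
        linarith
      · rw [Finset.sum_insert hx]; linarith
    · refine (h.2.mono ?_).trans (h2.mono ?_)
      · intro m hm; simp only [Set.mem_iUnion]; exact ⟨x, by simp, hm.1⟩
      · intro m hm
        simp only [Set.mem_iUnion] at hm ⊢
        obtain ⟨z, hz, hm⟩ := hm
        exact ⟨z, Finset.mem_insert_of_mem hz, hm⟩

/-- Chopping, all strings light -/
theorem chop_light [Fintype E] (hδ : 0 < δ) (h0 : ∀ x, 0 ≤ ω x) (hκ : ∀ x, ω x ≤ δ)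
    (hs : ∀ a b, Γ a b → Γ b a)
    (hΓ : ∀ a b, Γ a b → ∃ x, a ∈ pts x ∧ b ∈ pts x) (hNP : NPl Γ)
    (hconn : ∀ x, ∀ p ∈ pts x, ∀ q ∈ pts x, Rch Γ (pts x) p q) :
    ∃ S : Set E, (S.ncard : ℝ) ≤ 3 * ((∑ x, ω x) / δ + 1) ∧
      ∀ x y, x ∉ S → Relation.ReflTransGen (fun a b => a ∉ S ∧ b ∉ S ∧ (pts a ∩ pts b).Nonempty) x y →
        ∀ p ∈ pts x, ∀ q ∈ pts y, ∃ c < 67 * δ, Fare Γ pts ω Set.univ c p q := by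
  classical
  let K0 : α → Set α := fun p => {q | Rch Γ Set.univ p q}
  have hK0 : Comp Γ K0 := by
    refine ⟨fun p => Rch.refl, ?_, ?_⟩
    · intro p q hq
      ext m
      exact ⟨fun h => Rch.trans hq h, fun h => (Rch.symm hs hq).trans h⟩
    · intro p q hq
      exact (Rch.restrict (Y := K0 p) hq (fun m hm => hm)).mono Set.inter_subset_right
  obtain ⟨K1, hK1, hL1, hc1⟩ := chop_step hδ h0 hs hΓ hconn hK0
  obtain ⟨K2, hK2, hL2, hc2⟩ := chop_step hδ h0 hs hΓ hconn hK1
  obtain ⟨K3, hK3, hL3, hc3⟩ := chop_step hδ h0 hs hΓ hconn hK2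
  refine ⟨{x | ¬ (∀ p ∈ pts x, ∀ q ∈ pts x, K3 p = K3 q)}, ?_, ?_⟩
  · set S1 := {x | (∀ p ∈ pts x, ∀ q ∈ pts x, K0 p = K0 q) ∧ ¬ (∀ p ∈ pts x, ∀ q ∈ pts x, K1 p = K1 q)}
    set S2 := {x | (∀ p ∈ pts x, ∀ q ∈ pts x, K1 p = K1 q) ∧ ¬ (∀ p ∈ pts x, ∀ q ∈ pts x, K2 p = K2 q)}
    set S3 := {x | (∀ p ∈ pts x, ∀ q ∈ pts x, K2 p = K2 q) ∧ ¬ (∀ p ∈ pts x, ∀ q ∈ pts x, K3 p = K3 q)}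
    have hsub : {x | ¬ (∀ p ∈ pts x, ∀ q ∈ pts x, K3 p = K3 q)} ⊆ S1 ∪ S2 ∪ S3 := by
      intro x hx
      by_cases h2 : ∀ p ∈ pts x, ∀ q ∈ pts x, K2 p = K2 q
      · exact Or.inr ⟨h2, hx⟩
      · by_cases h1 : ∀ p ∈ pts x, ∀ q ∈ pts x, K1 p = K1 q
        · exact Or.inl (Or.inr ⟨h1, h2⟩)
        · refine Or.inl (Or.inl ⟨?_, h1⟩)
          intro p hp q hq
          refine (hK0.eq p q ?_).symm
          exact (hconn x p hp q hq).mono (Set.subset_univ _)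
    have h1 := Set.ncard_le_ncard hsub (Set.toFinite _)
    have h2 := Set.ncard_union_le (S1 ∪ S2) S3
    have h3 := Set.ncard_union_le S1 S2
    have : (Set.ncard {x | ¬ (∀ p ∈ pts x, ∀ q ∈ pts x, K3 p = K3 q)} : ℝ) ≤ S1.ncard + S2.ncard + S3.ncard := by
      exact_mod_cast (by omega)
    linarith
  · intro x y hx hxy p hp q hq
    have key : ∀ q ∈ pts y, K3 p = K3 q := by
      clear hq q
      induction hxy with
      | refl => intro q hq; exact not_not.mp hx p hp q hq
      | tail _ hbc ih =>
        intro q hq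
        obtain ⟨h1, h2, m, hm1, hm2⟩ := hbc
        rw [ih m hm1]
        exact not_not.mp h2 m hm2 q hq
    have hqp : q ∈ K3 p := by rw [key q hq]; exact hK3.self q
    obtain ⟨r1, τ1, L1⟩ := hL1 p
    obtain ⟨r2, τ2, L2⟩ := hL2 p
    obtain ⟨r3, τ3, L3⟩ := hL3 p
    obtain ⟨c, hc, h⟩ := KPR_diam hδ h0 hκ hs hΓ hNP L1 L2 L3 (hK3.self p) (hK3.conn p q hqp)
    exact ⟨c, hc, h.mono (Set.subset_univ _)⟩

theorem NPl.mono {Γ Γ' : α → α → Prop} (h : ∀ a b, Γ' a b → Γ a b) (hNP : NPl Γ) : NPl Γ' := by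
  intro a b P ha hP
  refine hNP a b P ha (fun i j => ?_)
  exact Relation.ReflTransGen.mono (fun _ _ hh => ⟨h _ _ hh.1, hh.2⟩) _ _ (hP i j)

theorem chop [Fintype E] [DecidableEq E] (hδ : 0 < δ) (h0 : ∀ x, 0 ≤ ω x)
    (hs : ∀ a b, Γ a b → Γ b a) (hNP : NPl Γ)
    (hconn : ∀ x, ∀ p ∈ pts x, ∀ q ∈ pts x, Rch Γ (pts x) p q) :
    ∃ S : Set E, (S.ncard : ℝ) ≤ 4 * ((∑ x, ω x) / δ) + 3 ∧
      ∀ x y, x ∉ S → Relation.ReflTransGen (fun a b => a ∉ S ∧ b ∉ S ∧ (pts a ∩ pts b).Nonempty) x y →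
        ∀ p ∈ pts x, ∀ q ∈ pts y, ∃ P : Finset E, x ∈ P ∧ ∑ z ∈ P, ω z < 68 * δ ∧
          Rch Γ (⋃ z ∈ P, pts z) p q := by
  classical
  let E' := {x : E // ω x ≤ δ}
  let Γ' : α → α → Prop := fun a b => Γ a b ∧ ∃ x : E', a ∈ pts x ∧ b ∈ pts x
  obtain ⟨S, hS, hS2⟩ := chop_light (Γ := Γ') (pts := fun x : E' => pts x) (ω := fun x : E' => ω x)
    hδ (fun x => h0 x) (fun x => x.2) (fun a b h => ⟨hs _ _ h.1, by
      obtain ⟨x, h1, h2⟩ := h.2; exact ⟨x, h2, h1⟩⟩) (fun a b h => h.2) (hNP.mono (fun a b h => h.1))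
    (by
      intro x p hp q hq
      have := hconn x p hp q hq
      exact Relation.ReflTransGen.mono (fun _ _ hh => ⟨⟨hh.1, x, hh.2.1, hh.2.2⟩, hh.2⟩) _ _ this)
  let H : Finset E := Finset.univ.filter (fun x => δ < ω x)
  have hH : (H.card : ℝ) ≤ (∑ x, ω x) / δ := by
    rw [le_div_iff₀ hδ]
    calc (H.card : ℝ) * δ = ∑ x ∈ H, δ := by simp
      _ ≤ ∑ x ∈ H, ω x := Finset.sum_le_sum (fun x hx => (Finset.mem_filter.mp hx).2.le)
      _ ≤ _ := Finset.sum_le_sum_of_subset_of_nonneg (Finset.subset_univ _) (fun x _ _ => h0 x)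
  have hsum : ∑ x : E', ω x ≤ ∑ x, ω x := by
    have : ∑ x : E', ω x = ∑ x ∈ Finset.univ.filter (fun x => ω x ≤ δ), ω x := by
      rw [Finset.sum_subtype (p := fun x => ω x ≤ δ)]
      intro x; simp
    rw [this]
    exact Finset.sum_le_sum_of_subset_of_nonneg (Finset.subset_univ _) (fun x _ _ => h0 x)
  have hdiv : (∑ x : E', ω x) / δ ≤ (∑ x, ω x) / δ := div_le_div_of_nonneg_right hsum hδ.le
  refine ⟨(H : Set E) ∪ (Subtype.val '' S), ?_, ?_⟩
  · have h1 := Set.ncard_union_le (H : Set E) (Subtype.val '' S)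
    have h2 : (Subtype.val '' S : Set E).ncard ≤ S.ncard := Set.ncard_image_le (Set.toFinite _)
    rw [Set.ncard_coe_finset] at h1
    have : ((((H : Set E) ∪ (Subtype.val '' S)).ncard : ℕ) : ℝ) ≤ H.card + S.ncard := by
      exact_mod_cast (by omega)
    linarith
  · intro x y hx hxy p hp q hq
    have light : ∀ z, z ∉ (H : Set E) ∪ (Subtype.val '' S) → ∃ h : ω z ≤ δ, (⟨z, h⟩ : E') ∉ S := by
      intro z hz
      have hz1 : ω z ≤ δ := by
        by_contra hcon
        exact hz (Or.inl (by simpa [H] using hcon))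
      exact ⟨hz1, fun h => hz (Or.inr ⟨_, h, rfl⟩)⟩
    obtain ⟨hxl, hxS⟩ := light x hx
    have key : ∃ hy : ω y ≤ δ, Relation.ReflTransGen (fun a b : E' => a ∉ S ∧ b ∉ S ∧
        (pts a ∩ pts b).Nonempty) ⟨x, hxl⟩ ⟨y, hy⟩ := by
      clear hq q
      induction hxy with
      | refl => exact ⟨hxl, Relation.ReflTransGen.refl⟩
      | @tail b c _ hbc ih =>
        obtain ⟨hb, ih⟩ := ih
        obtain ⟨hb1, hb2⟩ := light b hbc.1
        obtain ⟨hc1, hc2⟩ := light c hbc.2.1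
        exact ⟨hc1, ih.tail ⟨hb2, hc2, hbc.2.2⟩⟩
    obtain ⟨hyl, hch⟩ := key
    obtain ⟨c, hc, hF⟩ := hS2 _ _ hxS hch p hp q hq
    obtain ⟨P, hP1, hP2⟩ := Fare.support (ω := fun x : E' => ω x) (fun x => h0 x) hF
    have hP3 : ∑ z ∈ P.image Subtype.val, ω z = ∑ z ∈ P, ω z := by
      rw [Finset.sum_image (by intro a _ b _ h; exact Subtype.ext h)]
    refine ⟨insert x (P.image Subtype.val), Finset.mem_insert_self _ _, ?_, ?_⟩
    · have hle : ∑ z ∈ insert x (P.image Subtype.val), ω z ≤ ω x + ∑ z ∈ P.image Subtype.val, ω z := by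
        by_cases hx : x ∈ P.image Subtype.val
        · rw [Finset.insert_eq_of_mem hx]; linarith [h0 x]
        · rw [Finset.sum_insert hx]
      linarith
    · have h1 : Rch Γ (⋃ z ∈ P, pts z) p q :=
        Relation.ReflTransGen.mono (fun _ _ hh => ⟨hh.1.1, hh.2⟩) _ _ hP2
      refine h1.mono ?_
      intro m hm
      simp only [Set.mem_iUnion] at hm ⊢
      obtain ⟨z, hz, hm⟩ := hm
      exact ⟨z, Finset.mem_insert_of_mem (Finset.mem_image_of_mem _ hz), hm⟩

end Chop

section LPsec

theorem pair_marg {ι : Type*} [Fintype ι] [DecidableEq ι] (lm : ι → ℝ) (h1 : ∑ t, lm t = 1) (i k : Fin 3) (hik : i ≠ k)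
    (F G : ι → ℝ) :
    ∑ T : Fin 3 → ι, (∏ m, lm (T m)) * (F (T i) * G (T k)) = (∑ t, lm t * F t) * (∑ t, lm t * G t) := by
  have e := Finset.prod_univ_sum (fun _ : Fin 3 => (Finset.univ : Finset ι))
    (fun m t => lm t * ((if m = i then F t else 1) * (if m = k then G t else 1)))
  have e2 : ∀ T : Fin 3 → ι, ∏ m, (lm (T m) * ((if m = i then F (T m) else 1) * (if m = k then G (T m) else 1)))
      = (∏ m, lm (T m)) * (F (T i) * G (T k)) := by
    intro T
    rw [Finset.prod_mul_distrib, Finset.prod_mul_distrib]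
    simp
  simp only [e2, Fintype.piFinset_univ] at e
  rw [← e]
  fin_cases i <;> fin_cases k <;> first | exact absurd rfl hik | simp [Fin.prod_univ_three, h1, mul_comm]

theorem single_marg {ι : Type*} [Fintype ι] [DecidableEq ι] (lm : ι → ℝ) (h1 : ∑ t, lm t = 1) (i : Fin 3)
    (F : ι → ℝ) :
    ∑ T : Fin 3 → ι, (∏ m, lm (T m)) * F (T i) = ∑ t, lm t * F t := by
  obtain ⟨k, hk⟩ : ∃ k, i ≠ k := by revert i; decide
  have := pair_marg lm h1 i k hk F (fun _ => 1)
  simpa [h1] using this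

theorem total_marg {ι : Type*} [Fintype ι] [DecidableEq ι] (lm : ι → ℝ) (h1 : ∑ t, lm t = 1) :
    ∑ T : Fin 3 → ι, (∏ m, lm (T m)) = 1 := by
  have := single_marg lm h1 0 (fun _ => 1)
  simpa [h1] using this

/-- Lower bound by sampling -/
theorem sample_bound {ι V E : Type*} [Fintype ι] [Fintype V] [Fintype E] [DecidableEq ι] [DecidableEq V]
    (lm : ι → ℝ) (hl0 : ∀ t, 0 ≤ lm t) (hl1 : ∑ t, lm t = 1)
    (μ : V → ℝ) (hm0 : ∀ v, 0 ≤ μ v) (hm1 : ∑ v, μ v = 1)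
    (n : ι → V → ℝ) (z : ι → V → E → ℝ) (ρ : E → E → ℝ) (hρ0 : ∀ x y, 0 ≤ ρ x y)
    (hρs : ∀ x y, ρ x y = ρ y x)
    (hn : ∀ t, ∑ v, μ v * n t v ≤ 1 / 18)
    (hev : ∀ (T : Fin 3 → ι) (B : Fin 3 → V), 1 ≤ (∑ i, ∑ j, n (T i) (B j)) +
      ∑ i, ∑ k, ∑ j, ∑ l, if i ≠ k ∧ j ≠ l then
        ∑ x, ∑ y, ρ x y * (z (T i) (B j) x * z (T k) (B l) y) else 0) :
    1 / 72 ≤ ∑ x, (∑ y, ρ x y) * (∑ t, lm t * ∑ v, μ v * z t v x) ^ 2 := by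
  set c : E → ℝ := fun x => ∑ t, lm t * ∑ v, μ v * z t v x with hc
  have key : (1:ℝ) ≤ 9 * (1 / 18) + 36 * ∑ x, ∑ y, ρ x y * (c x * c y) := by
    have hw : ∀ T : Fin 3 → ι, ∀ B : Fin 3 → V, 0 ≤ (∏ m, lm (T m)) * ∏ m, μ (B m) := fun T B =>
      mul_nonneg (Finset.prod_nonneg fun m _ => hl0 _) (Finset.prod_nonneg fun m _ => hm0 _)
    have e1 : ∑ T : Fin 3 → ι, ∑ B : Fin 3 → V, (∏ m, lm (T m)) * ∏ m, μ (B m) = 1 := by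
      simp only [← Finset.mul_sum, total_marg μ hm1, mul_one, total_marg lm hl1]
    have e2 : ∀ i j, ∑ T : Fin 3 → ι, ∑ B : Fin 3 → V, ((∏ m, lm (T m)) * ∏ m, μ (B m)) * n (T i) (B j)
        ≤ 1 / 18 := by
      intro i j
      have : ∀ T : Fin 3 → ι, ∑ B : Fin 3 → V, ((∏ m, lm (T m)) * ∏ m, μ (B m)) * n (T i) (B j)
          = (∏ m, lm (T m)) * ∑ v, μ v * n (T i) v := by
        intro T
        rw [← single_marg μ hm1 j (fun v => n (T i) v), Finset.mul_sum]
        exact Finset.sum_congr rfl fun B _ => by ring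
      simp only [this]
      rw [single_marg lm hl1 i (fun t => ∑ v, μ v * n t v)]
      calc _ ≤ ∑ t, lm t * (1 / 18) := Finset.sum_le_sum fun t _ => mul_le_mul_of_nonneg_left (hn t) (hl0 t)
        _ = 1 / 18 := by rw [← Finset.sum_mul, hl1, one_mul]
    have e3 : ∀ i k, i ≠ k → ∀ j l, j ≠ l → ∀ x y, ∑ T : Fin 3 → ι, ∑ B : Fin 3 → V,
        ((∏ m, lm (T m)) * ∏ m, μ (B m)) * (z (T i) (B j) x * z (T k) (B l) y) = c x * c y := by
      intro i k hik j l hjl x y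
      have : ∀ T : Fin 3 → ι, ∑ B : Fin 3 → V, ((∏ m, lm (T m)) * ∏ m, μ (B m)) * (z (T i) (B j) x * z (T k) (B l) y)
          = (∏ m, lm (T m)) * ((∑ v, μ v * z (T i) v x) * (∑ v, μ v * z (T k) v y)) := by
        intro T
        rw [← pair_marg μ hm1 j l hjl (fun v => z (T i) v x) (fun v => z (T k) v y), Finset.mul_sum]
        exact Finset.sum_congr rfl fun B _ => by ring
      simp only [this]
      rw [pair_marg lm hl1 i k hik (fun t => ∑ v, μ v * z t v x) (fun t => ∑ v, μ v * z t v y)]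
    have e4 : ∀ i k j l, ∑ T : Fin 3 → ι, ∑ B : Fin 3 → V, ((∏ m, lm (T m)) * ∏ m, μ (B m)) *
        (if i ≠ k ∧ j ≠ l then ∑ x, ∑ y, ρ x y * (z (T i) (B j) x * z (T k) (B l) y) else 0) =
        if i ≠ k ∧ j ≠ l then ∑ x, ∑ y, ρ x y * (c x * c y) else 0 := by
      intro i k j l
      by_cases h : i ≠ k ∧ j ≠ l
      · simp only [if_pos h]
        have : ∀ x y, ρ x y * (c x * c y) = ∑ T : Fin 3 → ι, ∑ B : Fin 3 → V,
          ((∏ m, lm (T m)) * ∏ m, μ (B m)) * (ρ x y * (z (T i) (B j) x * z (T k) (B l) y)) := by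
          intro x y
          rw [← e3 i k h.1 j l h.2 x y, Finset.mul_sum]
          refine Finset.sum_congr rfl fun T _ => ?_
          rw [Finset.mul_sum]
          exact Finset.sum_congr rfl fun B _ => by ring
        simp only [this, Finset.mul_sum]
        calc _ = ∑ T : Fin 3 → ι, ∑ x, ∑ y, ∑ B : Fin 3 → V,
          ((∏ m, lm (T m)) * ∏ m, μ (B m)) * (ρ x y * (z (T i) (B j) x * z (T k) (B l) y)) := by
              refine Finset.sum_congr rfl fun T _ => ?_
              rw [Finset.sum_comm]
              refine Finset.sum_congr rfl fun x _ => ?_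
              rw [Finset.sum_comm]
          _ = _ := by
              rw [Finset.sum_comm]
              refine Finset.sum_congr rfl fun x _ => ?_
              rw [Finset.sum_comm]
      · simp only [if_neg h, mul_zero, Finset.sum_const_zero]
    calc (1:ℝ) = ∑ T : Fin 3 → ι, ∑ B : Fin 3 → V, (∏ m, lm (T m)) * ∏ m, μ (B m) := e1.symm
      _ ≤ ∑ T : Fin 3 → ι, ∑ B : Fin 3 → V, ((∏ m, lm (T m)) * ∏ m, μ (B m)) * ((∑ i, ∑ j, n (T i) (B j)) +
        ∑ i, ∑ k, ∑ j, ∑ l, if i ≠ k ∧ j ≠ l then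
        ∑ x, ∑ y, ρ x y * (z (T i) (B j) x * z (T k) (B l) y) else 0) := by
          refine Finset.sum_le_sum fun T _ => Finset.sum_le_sum fun B _ => ?_
          exact le_mul_of_one_le_right (hw T B) (hev T B)
      _ = (∑ i, ∑ j, ∑ T : Fin 3 → ι, ∑ B : Fin 3 → V, ((∏ m, lm (T m)) * ∏ m, μ (B m)) * n (T i) (B j)) +
          ∑ i, ∑ k, ∑ j, ∑ l, ∑ T : Fin 3 → ι, ∑ B : Fin 3 → V, ((∏ m, lm (T m)) * ∏ m, μ (B m)) *
        (if i ≠ k ∧ j ≠ l then ∑ x, ∑ y, ρ x y * (z (T i) (B j) x * z (T k) (B l) y) else 0) := by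
          obtain ⟨L, hL⟩ : ∃ L : ((Fin 3 → ι) → (Fin 3 → V) → ℝ) → ℝ, ∀ f, L f =
            ∑ T : Fin 3 → ι, ∑ B : Fin 3 → V, ((∏ m, lm (T m)) * ∏ m, μ (B m)) * f T B := ⟨_, fun _ => rfl⟩
          have hLs : ∀ f : Fin 3 → (Fin 3 → ι) → (Fin 3 → V) → ℝ, L (fun T B => ∑ i, f i T B) = ∑ i, L (f i) := by
            intro f
            simp only [hL, Fin.sum_univ_three, mul_add, Finset.sum_add_distrib]
          have hLa : ∀ f g : (Fin 3 → ι) → (Fin 3 → V) → ℝ, L (fun T B => f T B + g T B) = L f + L g := by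
            intro f g
            simp only [hL, mul_add, Finset.sum_add_distrib]
          simp only [← hL (fun T B => (∑ i, ∑ j, n (T i) (B j)) +
        ∑ i, ∑ k, ∑ j, ∑ l, if i ≠ k ∧ j ≠ l then
        ∑ x, ∑ y, ρ x y * (z (T i) (B j) x * z (T k) (B l) y) else 0),
            ← hL (fun T B => n (T _) (B _)), ← hL (fun T B => if _ ≠ _ ∧ _ ≠ _ then
        ∑ x, ∑ y, ρ x y * (z (T _) (B _) x * z (T _) (B _) y) else 0)]
          simp only [hLa, hLs]
      _ ≤ (∑ i : Fin 3, ∑ j : Fin 3, (1/18 : ℝ)) + ∑ i : Fin 3, ∑ k : Fin 3, ∑ j : Fin 3, ∑ l : Fin 3,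
          if i ≠ k ∧ j ≠ l then ∑ x, ∑ y, ρ x y * (c x * c y) else 0 := by
          simp only [e4]
          gcongr with i _ j _
          exact e2 i j
      _ = 9 * (1 / 18) + 36 * ∑ x, ∑ y, ρ x y * (c x * c y) := by
          generalize ∑ x, ∑ y, ρ x y * (c x * c y) = Q
          simp only [Fin.sum_univ_three]
          simp
          ring
  have k2 : ∑ x, ∑ y, ρ x y * (c x * c y) ≤ ∑ x, (∑ y, ρ x y) * c x ^ 2 := by
    have s1 : ∑ x, ∑ y, ρ x y * (c x * c y) ≤ ∑ x, ∑ y, (ρ x y * (c x ^ 2) / 2 + ρ x y * (c y ^ 2) / 2) := by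
      refine Finset.sum_le_sum fun x _ => Finset.sum_le_sum fun y _ => ?_
      nlinarith [mul_nonneg (hρ0 x y) (sq_nonneg (c x - c y))]
    have s2 : ∑ x, ∑ y, ρ x y * (c y ^ 2) / 2 = ∑ x, ∑ y, ρ x y * (c x ^ 2) / 2 := by
      rw [Finset.sum_comm]
      refine Finset.sum_congr rfl fun x _ => Finset.sum_congr rfl fun y _ => ?_
      rw [hρs]
    simp only [Finset.sum_add_distrib] at s1
    rw [s2] at s1
    have s3 : ∑ x, (∑ y, ρ x y) * c x ^ 2 = ∑ x, ∑ y, ρ x y * (c x ^ 2) / 2 + ∑ x, ∑ y, ρ x y * (c x ^ 2) / 2 := by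
      rw [← Finset.sum_add_distrib]
      refine Finset.sum_congr rfl fun x _ => ?_
      rw [← Finset.sum_add_distrib, Finset.sum_mul]
      exact Finset.sum_congr rfl fun y _ => by ring
    linarith
  linarith

/-- first order optimality -/
theorem qp_opt {ι E : Type*} [Fintype ι] [Fintype E] [Nonempty ι] [DecidableEq ι] (q : E → ℝ) 
    (cc : ι → E → ℝ) : ∃ lm : ι → ℝ, (∀ t, 0 ≤ lm t) ∧ ∑ t, lm t = 1 ∧
      ∀ t, ∑ x, q x * (∑ s, lm s * cc s x) ^ 2 ≤ ∑ x, q x * (∑ s, lm s * cc s x) * cc t x := by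
  let Φ : (ι → ℝ) → ℝ := fun lm => ∑ x, q x * (∑ s, lm s * cc s x) ^ 2
  have hcont : Continuous Φ := by fun_prop
  obtain ⟨lm, hlm, hmin⟩ := (isCompact_stdSimplex ℝ ι).exists_isMinOn
    ⟨Pi.single (Classical.arbitrary ι) 1, single_mem_stdSimplex ℝ _⟩ hcont.continuousOn
  refine ⟨lm, hlm.1, hlm.2, fun t => ?_⟩
  set c : E → ℝ := fun x => ∑ s, lm s * cc s x with hc
  have h1 : ∀ s : ℝ, 0 ≤ s → s ≤ 1 → ∑ x, q x * c x ^ 2 ≤ ∑ x, q x * (c x + s * (cc t x - c x)) ^ 2 := by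
    intro s hs0 hs1
    have hmem : (1 - s) • lm + s • (Pi.single t 1 : ι → ℝ) ∈ stdSimplex ℝ ι :=
      (convex_stdSimplex ℝ ι) hlm (single_mem_stdSimplex ℝ t) (by linarith) hs0 (by ring)
    have := hmin hmem
    refine le_trans this (le_of_eq ?_)
    show ∑ x, q x * (∑ s', ((1 - s) • lm + s • (Pi.single t 1 : ι → ℝ)) s' * cc s' x) ^ 2 = _
    refine Finset.sum_congr rfl fun x _ => ?_
    congr 2
    simp only [Pi.add_apply, Pi.smul_apply, smul_eq_mul, add_mul, Finset.sum_add_distrib, hc]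
    have : ∑ i, s * (Pi.single t 1 : ι → ℝ) i * cc i x = s * cc t x := by
      rw [Finset.sum_eq_single t]
      · simp
      · intro b _ hb; simp [Pi.single_eq_of_ne hb]
      · simp
    rw [this]
    have : ∑ i, (1 - s) * lm i * cc i x = (1 - s) * ∑ i, lm i * cc i x := by
      rw [Finset.mul_sum]; exact Finset.sum_congr rfl fun i _ => by ring
    rw [this]; ring
  set A := ∑ x, q x * c x * (cc t x - c x) with hA
  set B := ∑ x, q x * (cc t x - c x) ^ 2 with hB
  have h2 : ∀ s : ℝ, ∑ x, q x * (c x + s * (cc t x - c x)) ^ 2 = ∑ x, q x * c x ^ 2 + 2 * s * A + s ^ 2 * B := by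
    intro s
    rw [hA, hB, Finset.mul_sum, Finset.mul_sum, ← Finset.sum_add_distrib, ← Finset.sum_add_distrib]
    exact Finset.sum_congr rfl fun x _ => by ring
  have hA0 : 0 ≤ A := by
    by_contra hneg
    push Not at hneg
    have hpos : 0 < |B| + 1 - A := by have := abs_nonneg B; linarith
    set s := -A / (|B| + 1 - A) with hsdef
    have hs0 : 0 < s := div_pos (by linarith) hpos
    have hs1 : s ≤ 1 := by
      rw [hsdef, div_le_one hpos]
      have := abs_nonneg B; linarith
    have := h1 s hs0.le hs1
    rw [h2] at this
    have e : s * (|B| + 1 - A) = -A := by rw [hsdef]; field_simp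
    have h3 : 0 ≤ 2 * A + s * B := by
      by_contra h
      push Not at h
      nlinarith
    have h4 : s * B ≤ s * |B| := mul_le_mul_of_nonneg_left (le_abs_self B) hs0.le
    nlinarith
  have : A = ∑ x, q x * c x * cc t x - ∑ x, q x * c x ^ 2 := by
    rw [hA, ← Finset.sum_sub_distrib]
    exact Finset.sum_congr rfl fun x _ => by ring
  linarith

end LPsec

section Sep
variable {α E V : Type*} {Γ : α → α → Prop} {pts : E → Set α}

theorem chain_symm {S : Set E} {x y : E}
    (h : Relation.ReflTransGen (fun a b => a ∉ S ∧ b ∉ S ∧ (pts a ∩ pts b).Nonempty) x y) :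
    Relation.ReflTransGen (fun a b => a ∉ S ∧ b ∉ S ∧ (pts a ∩ pts b).Nonempty) y x := by
  induction h with
  | refl => exact Relation.ReflTransGen.refl
  | tail _ hbc ih =>
    exact Relation.ReflTransGen.head ⟨hbc.2.1, hbc.1, by rw [Set.inter_comm]; exact hbc.2.2⟩ ih

theorem chain_notin {S : Set E} {x y : E} (hx : x ∉ S)
    (h : Relation.ReflTransGen (fun a b => a ∉ S ∧ b ∉ S ∧ (pts a ∩ pts b).Nonempty) x y) : y ∉ S := by
  induction h with
  | refl => exact hx
  | tail _ hbc ih => exact hbc.2.1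

open Classical in
/-- A triple certificate for heavy connected families. -/
def GoodTriple (Γ : α → α → Prop) (pts : E → Set α) (loc : V → α) (μ : V → ℝ)
    (t : V × Finset V × (V → Finset E)) : Prop :=
  17 / 18 ≤ ∑ v ∈ t.2.1, μ v ∧ ∀ v ∈ t.2.1, (∃ x ∈ t.2.2 v, loc t.1 ∈ pts x) ∧
    Rch Γ (⋃ x ∈ t.2.2 v, pts x) (loc t.1) (loc v)

open Classical in
theorem triple_of_chop [Fintype E] [Fintype V] (loc : V → α) (μ : V → ℝ) 
    (ω : E → ℝ) (δ : ℝ) (hδ : 0 < δ) (h0 : ∀ x, 0 ≤ ω x) (hs : ∀ a b, Γ a b → Γ b a) (hNP : NPl Γ)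
    (hconn : ∀ x, ∀ p ∈ pts x, ∀ q ∈ pts x, Rch Γ (pts x) p q) :
    ∃ S : Set E, (S.ncard : ℝ) ≤ 4 * ((∑ x, ω x) / δ) + 3 ∧ 
      ∀ x, x ∉ S → 17 / 18 ≤ ∑ v with (∃ y, Relation.ReflTransGen
          (fun a b => a ∉ S ∧ b ∉ S ∧ (pts a ∩ pts b).Nonempty) x y ∧ loc v ∈ pts y), μ v →
        ∃ t, GoodTriple Γ pts loc μ t ∧ ∀ v ∈ t.2.1, ∑ z ∈ t.2.2 v, ω z < 68 * δ := by
  obtain ⟨S, hS, hS2⟩ := chop (Γ := Γ) (pts := pts) (ω := ω) hδ h0 hs hNP hconn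
  refine ⟨S, hS, fun x hx hmass => ?_⟩
  set A : Finset V := Finset.univ.filter (fun v => ∃ y, Relation.ReflTransGen
          (fun a b => a ∉ S ∧ b ∉ S ∧ (pts a ∩ pts b).Nonempty) x y ∧ loc v ∈ pts y) with hA
  have hne : A.Nonempty := by
    by_contra h
    rw [Finset.not_nonempty_iff_eq_empty] at h
    rw [h] at hmass
    norm_num at hmass
  obtain ⟨u, hu⟩ := hne
  obtain ⟨y, hy, huy⟩ := (Finset.mem_filter.mp hu).2
  have hex : ∀ v, ∃ P : Finset E, v ∈ A → y ∈ P ∧ ∑ z ∈ P, ω z < 68 * δ ∧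
      Rch Γ (⋃ z ∈ P, pts z) (loc u) (loc v) := by
    intro v
    by_cases hv : v ∈ A
    · obtain ⟨w, hw, hvw⟩ := (Finset.mem_filter.mp hv).2
      obtain ⟨P, h⟩ := hS2 y w (chain_notin hx hy) ((chain_symm hy).trans hw) _ huy _ hvw
      exact ⟨P, fun _ => h⟩
    · exact ⟨∅, fun h => absurd h hv⟩
  choose P hP using hex
  exact ⟨(u, A, P), ⟨hmass, fun v hv => ⟨⟨y, (hP v hv).1, huy⟩, (hP v hv).2.2⟩⟩, fun v hv => (hP v hv).2.1⟩

open Classical in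
theorem sep_lemma [Fintype E] [Fintype V] (loc : V → α) (μ : V → ℝ) (hμ0 : ∀ v, 0 ≤ μ v)
    (hμ1 : ∑ v, μ v = 1) (hs : ∀ a b, Γ a b → Γ b a) (hNP : NPl Γ)
    (hconn : ∀ x, ∀ p ∈ pts x, ∀ q ∈ pts x, Rch Γ (pts x) p q) (hne : ∀ x, (pts x).Nonempty) :
    ∃ S : Set E, (S.ncard : ℝ) ≤ 2315 * √(∑ x, ∑ y, if (pts x ∩ pts y).Nonempty then (1:ℝ) else 0) ∧ 
      ∀ x, x ∉ S → ∑ v with (∃ y, Relation.ReflTransGen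
          (fun a b => a ∉ S ∧ b ∉ S ∧ (pts a ∩ pts b).Nonempty) x y ∧ loc v ∈ pts y), μ v ≤ 17 / 18 := by
  set ρ : E → E → ℝ := fun x y => if (pts x ∩ pts y).Nonempty then (1:ℝ) else 0 with hρ
  set M := ∑ x, ∑ y, ρ x y with hM
  have hρ0 : ∀ x y, 0 ≤ ρ x y := fun x y => by simp only [hρ]; split_ifs <;> norm_num
  have hρs : ∀ x y, ρ x y = ρ y x := fun x y => by simp only [hρ, Set.inter_comm]
  rcases isEmpty_or_nonempty E with hE | hE
  · refine ⟨∅, by simp, fun x => (IsEmpty.false x).elim⟩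
  have hM1 : 1 ≤ M := by
    obtain ⟨x⟩ := hE
    have h1 : ρ x x = 1 := by simp [hρ, hne x]
    calc (1:ℝ) = ρ x x := h1.symm
      _ ≤ ∑ y, ρ x y := Finset.single_le_sum (fun y _ => hρ0 x y) (Finset.mem_univ x)
      _ ≤ M := Finset.single_le_sum (f := fun x => ∑ y, ρ x y)
        (fun x _ => Finset.sum_nonneg fun y _ => hρ0 x y) (Finset.mem_univ x)
  have hM2 : 1 ≤ √M := by rw [Real.one_le_sqrt]; exact hM1
  let ι := {t : V × Finset V × (V → Finset E) // GoodTriple Γ pts loc μ t}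
  rcases isEmpty_or_nonempty ι with hι | hι
  · obtain ⟨S, hS, hS2⟩ := triple_of_chop (pts := pts) (Γ := Γ) loc μ (fun _ => 0) 1 one_pos (fun _ => le_rfl) hs hNP hconn
    refine ⟨S, ?_, fun x hx => ?_⟩
    · simp at hS
      have : (S.ncard:ℝ) ≤ 3 := by exact_mod_cast hS
      linarith
    · by_contra hcon
      obtain ⟨t, ht, -⟩ := hS2 x hx (not_le.mp hcon).le
      exact hι.false ⟨t, ht⟩
  haveI : Fintype ι := Fintype.ofFinite ι
  let z : ι → V → E → ℝ := fun t v x => if v ∈ t.1.2.1 ∧ x ∈ t.1.2.2 v then 1 else 0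
  let n : ι → V → ℝ := fun t v => if v ∈ t.1.2.1 then 0 else 1
  let q : E → ℝ := fun x => ∑ y, ρ x y
  have hq0 : ∀ x, 0 ≤ q x := fun x => Finset.sum_nonneg fun y _ => hρ0 x y
  have hz0 : ∀ t v x, 0 ≤ z t v x := fun t v x => by simp only [z]; split_ifs <;> norm_num
  have hn0 : ∀ t v, 0 ≤ n t v := fun t v => by simp only [n]; split_ifs <;> norm_num
  let cc : ι → E → ℝ := fun t x => ∑ v, μ v * z t v x
  obtain ⟨lm, hl0, hl1, hopt⟩ := qp_opt q cc
  set c : E → ℝ := fun x => ∑ s, lm s * cc s x with hc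
  set Φ := ∑ x, q x * c x ^ 2 with hΦ
  have hc0 : ∀ x, 0 ≤ c x := fun x => Finset.sum_nonneg fun s _ => mul_nonneg (hl0 s)
    (Finset.sum_nonneg fun v _ => mul_nonneg (hμ0 v) (hz0 s v x))
  have hΦ1 : 1 / 72 ≤ Φ := by
    apply sample_bound lm hl0 hl1 μ hμ0 hμ1 n z ρ hρ0 hρs
    · intro t
      have h1 := t.2.1
      have h2 : ∑ v, μ v * n t v + ∑ v ∈ t.1.2.1, μ v = 1 := by
        rw [← hμ1, ← Finset.sum_filter_add_sum_filter_not Finset.univ (fun v => v ∈ t.1.2.1) μ]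
        have e1 : ∑ v, μ v * n t v = ∑ v with ¬ v ∈ t.1.2.1, μ v := by
          rw [Finset.sum_filter]
          refine Finset.sum_congr rfl fun v _ => ?_
          by_cases hv : v ∈ t.1.2.1 <;> simp [n, hv]
        have e2 : Finset.univ.filter (fun v => v ∈ t.1.2.1) = t.1.2.1 := by ext v; simp
        rw [e1, e2]; ring
      linarith
    · intro T B
      have hnn : 0 ≤ ∑ i, ∑ j, n (T i) (B j) := Finset.sum_nonneg fun i _ => Finset.sum_nonneg fun j _ => hn0 _ _
      have hin : ∀ i k j l, 0 ≤ ∑ x, ∑ y, ρ x y * (z (T i) (B j) x * z (T k) (B l) y) := fun i k j l =>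
        Finset.sum_nonneg fun x _ => Finset.sum_nonneg fun y _ => mul_nonneg (hρ0 _ _) (mul_nonneg (hz0 _ _ _) (hz0 _ _ _))
      have hin' : ∀ i k j l, 0 ≤ if i ≠ k ∧ j ≠ l then
        ∑ x, ∑ y, ρ x y * (z (T i) (B j) x * z (T k) (B l) y) else 0 := fun i k j l => by
        split_ifs
        · exact hin i k j l
        · exact le_rfl
      by_cases hall : ∀ i j, B j ∈ (T i).1.2.1
      · obtain ⟨i, k, j, l, hik, hjl, p, hp1, hp2⟩ := hNP (fun i => loc (T i).1.1) (fun j => loc (B j))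
          (fun i j => ⋃ x ∈ (T i).1.2.2 (B j), pts x)
          (fun i j => by
            obtain ⟨x, hx, hx2⟩ := ((T i).2.2 (B j) (hall i j)).1
            simp only [Set.mem_iUnion]
            exact ⟨x, hx, hx2⟩) (fun i j => ((T i).2.2 (B j) (hall i j)).2)
        simp only [Set.mem_iUnion] at hp1 hp2
        obtain ⟨x, hx, hpx⟩ := hp1
        obtain ⟨y, hy, hpy⟩ := hp2
        have h1 : (1:ℝ) ≤ ∑ x, ∑ y, ρ x y * (z (T i) (B j) x * z (T k) (B l) y) := by
          have e : ρ x y * (z (T i) (B j) x * z (T k) (B l) y) = 1 := by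
            have : (pts x ∩ pts y).Nonempty := ⟨p, hpx, hpy⟩
            simp [ρ, z, hall, hx, hy, this]
          calc (1:ℝ) = _ := e.symm
            _ ≤ ∑ y, ρ x y * (z (T i) (B j) x * z (T k) (B l) y) :=
              Finset.single_le_sum (f := fun y => ρ x y * (z (T i) (B j) x * z (T k) (B l) y))
                (fun y _ => mul_nonneg (hρ0 _ _) (mul_nonneg (hz0 _ _ _) (hz0 _ _ _))) (Finset.mem_univ y)
            _ ≤ _ := Finset.single_le_sum (f := fun x => ∑ y, ρ x y * (z (T i) (B j) x * z (T k) (B l) y))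
                (fun x _ => Finset.sum_nonneg fun y _ => mul_nonneg (hρ0 _ _) (mul_nonneg (hz0 _ _ _) (hz0 _ _ _)))
                (Finset.mem_univ x)
        have h2 : (∑ x, ∑ y, ρ x y * (z (T i) (B j) x * z (T k) (B l) y)) ≤ ∑ i, ∑ k, ∑ j, ∑ l, if i ≠ k ∧ j ≠ l then
        ∑ x, ∑ y, ρ x y * (z (T i) (B j) x * z (T k) (B l) y) else 0 := by
          have e : (∑ x, ∑ y, ρ x y * (z (T i) (B j) x * z (T k) (B l) y)) = if i ≠ k ∧ j ≠ l then
            ∑ x, ∑ y, ρ x y * (z (T i) (B j) x * z (T k) (B l) y) else 0 := by rw [if_pos ⟨hik, hjl⟩]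
          rw [e]
          refine le_trans ?_ (Finset.single_le_sum (fun i _ => Finset.sum_nonneg fun k _ => Finset.sum_nonneg fun j _ =>
            Finset.sum_nonneg fun l _ => hin' i k j l) (Finset.mem_univ i))
          refine le_trans ?_ (Finset.single_le_sum (fun k _ => Finset.sum_nonneg fun j _ =>
            Finset.sum_nonneg fun l _ => hin' i k j l) (Finset.mem_univ k))
          refine le_trans ?_ (Finset.single_le_sum (fun j _ => 
            Finset.sum_nonneg fun l _ => hin' i k j l) (Finset.mem_univ j))
          exact (Finset.single_le_sum (f := fun l => if i ≠ k ∧ j ≠ l then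
            ∑ x, ∑ y, ρ x y * (z (T i) (B j) x * z (T k) (B l) y) else 0)
            (fun l _ => hin' i k j l) (Finset.mem_univ l))
        linarith
      · push Not at hall
        obtain ⟨i, j, hij⟩ := hall
        have h1 : (1:ℝ) ≤ ∑ i, ∑ j, n (T i) (B j) := by
          have e : n (T i) (B j) = 1 := by simp [n, hij]
          calc (1:ℝ) = _ := e.symm
            _ ≤ ∑ j, n (T i) (B j) := Finset.single_le_sum (f := fun j => n (T i) (B j)) (fun j _ => hn0 _ _) (Finset.mem_univ j)
            _ ≤ _ := Finset.single_le_sum (f := fun i => ∑ j, n (T i) (B j))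
              (fun i _ => Finset.sum_nonneg fun j _ => hn0 _ _) (Finset.mem_univ i)
        have h2 : 0 ≤ ∑ i, ∑ k, ∑ j, ∑ l, if i ≠ k ∧ j ≠ l then
        ∑ x, ∑ y, ρ x y * (z (T i) (B j) x * z (T k) (B l) y) else 0 :=
          Finset.sum_nonneg fun i _ => Finset.sum_nonneg fun k _ => Finset.sum_nonneg fun j _ =>
            Finset.sum_nonneg fun l _ => hin' i k j l
        linarith
  have hΦpos : 0 < Φ := by linarith
  set ω : E → ℝ := fun x => q x * c x with hω
  have hω0 : ∀ x, 0 ≤ ω x := fun x => mul_nonneg (hq0 x) (hc0 x)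
  obtain ⟨S, hS, hS2⟩ := triple_of_chop (pts := pts) (Γ := Γ) loc μ ω (Φ / 68) (by positivity) hω0 hs hNP hconn
  have hCS : (∑ x, ω x) ^ 2 ≤ M * Φ := by
    apply Finset.sum_sq_le_sum_mul_sum_of_sq_eq_mul
    · exact fun x _ => hq0 x
    · exact fun x _ => mul_nonneg (hq0 x) (sq_nonneg _)
    · intro x _; simp only [hω]; ring
  refine ⟨S, ?_, fun x hx => ?_⟩
  · have hW : (∑ x, ω x) / Φ ≤ 8.5 * √M := by
      have hW0 : 0 ≤ ∑ x, ω x := Finset.sum_nonneg fun x _ => hω0 x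
      rw [div_le_iff₀ hΦpos]
      refine (pow_le_pow_iff_left₀ hW0 (by positivity) two_ne_zero).mp ?_
      have : (8.5 * √M * Φ) ^ 2 = 72.25 * Φ * (M * Φ) := by
        have := Real.sq_sqrt (show 0 ≤ M by linarith)
        rw [mul_pow, mul_pow, this]; ring
      rw [this]
      have h3 : 1 ≤ 72.25 * Φ := by linarith
      have : 0 ≤ M * Φ := by positivity
      nlinarith
    have e : (∑ x, ω x) / (Φ / 68) = 68 * ((∑ x, ω x) / Φ) := by field_simp
    rw [e] at hS
    linarith
  · by_contra hcon
    obtain ⟨t, ht, htw⟩ := hS2 x hx (not_le.mp hcon).le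
    have h1 := hopt ⟨t, ht⟩
    have h2 : ∑ x, q x * (∑ s, lm s * cc s x) * cc ⟨t, ht⟩ x = ∑ v ∈ t.2.1, μ v * ∑ x ∈ t.2.2 v, ω x := by
      calc ∑ x, q x * (∑ s, lm s * cc s x) * cc ⟨t, ht⟩ x = ∑ x, ∑ v, ω x * (μ v * z ⟨t, ht⟩ v x) := by
            refine Finset.sum_congr rfl fun x _ => ?_
            rw [← Finset.mul_sum]
        _ = ∑ v, ∑ x, ω x * (μ v * z ⟨t, ht⟩ v x) := Finset.sum_comm
        _ = ∑ v, if v ∈ t.2.1 then μ v * ∑ x ∈ t.2.2 v, ω x else 0 := by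
            refine Finset.sum_congr rfl fun v _ => ?_
            by_cases hv : v ∈ t.2.1
            · simp only [z, hv, true_and, if_true, Finset.mul_sum]
              rw [← Finset.sum_filter_add_sum_filter_not Finset.univ (fun x => x ∈ t.2.2 v)]
              have : Finset.univ.filter (fun x => x ∈ t.2.2 v) = t.2.2 v := by ext; simp
              rw [this]
              have z1 : ∑ x with ¬ x ∈ t.2.2 v, ω x * (μ v * if x ∈ t.2.2 v then 1 else 0) = 0 :=
                Finset.sum_eq_zero fun x hx => by simp [(Finset.mem_filter.mp hx).2]
              rw [z1, add_zero]
              exact Finset.sum_congr rfl fun x hx => by simp [hx, mul_comm]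
            · simp [z, hv]
        _ = _ := by rw [← Finset.sum_filter]; congr 1; ext; simp
    rw [h2] at h1
    have h68 : 68 * (Φ / 68) = Φ := by ring
    rw [h68] at htw
    have hA1 : ∑ v ∈ t.2.1, μ v ≤ 1 := by
      rw [← hμ1]
      exact Finset.sum_le_sum_of_subset_of_nonneg (Finset.subset_univ _) (fun x _ _ => hμ0 x)
    have hex : ∃ v ∈ t.2.1, 0 < μ v := by
      by_contra hno
      push Not at hno
      have := Finset.sum_nonpos hno
      have := ht.1
      linarith
    have h3 : ∑ v ∈ t.2.1, μ v * ∑ x ∈ t.2.2 v, ω x < ∑ v ∈ t.2.1, μ v * Φ := by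
      obtain ⟨v, hv, hpos⟩ := hex
      apply Finset.sum_lt_sum
      · exact fun v hv => mul_le_mul_of_nonneg_left (htw v hv).le (hμ0 v)
      · exact ⟨v, hv, mul_lt_mul_of_pos_left (htw v hv) hpos⟩
    rw [← Finset.sum_mul] at h3
    have h4 : (∑ v ∈ t.2.1, μ v) * Φ ≤ Φ := by nlinarith
    have h5 : Φ ≤ ∑ v ∈ t.2.1, μ v * ∑ x ∈ t.2.2 v, ω x := h1
    linarith

end Sep

section Planar
variable {E : Type*} {c : E → ℝ → ℝ × ℝ} {PT : Set (ℝ × ℝ)}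

def Gap (c : E → ℝ → ℝ × ℝ) (PT : Set (ℝ × ℝ)) (e : E) (s t : ℝ) : Prop :=
  s ∈ Set.Icc (0:ℝ) 1 ∧ t ∈ Set.Icc (0:ℝ) 1 ∧ s < t ∧ c e s ∈ PT ∧ c e t ∈ PT ∧
    ∀ u ∈ Set.Ioo s t, c e u ∉ PT

def Gam (c : E → ℝ → ℝ × ℝ) (PT : Set (ℝ × ℝ)) (p q : ℝ × ℝ) : Prop :=
  ∃ e s t, Gap c PT e s t ∧ ((c e s = p ∧ c e t = q) ∨ (c e s = q ∧ c e t = p))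

theorem Gam_symm (p q : ℝ × ℝ) (h : Gam c PT p q) : Gam c PT q p := by
  obtain ⟨e, s, t, h1, h2⟩ := h
  exact ⟨e, s, t, h1, h2.symm⟩

def Pts (c : E → ℝ → ℝ × ℝ) (PT : Set (ℝ × ℝ)) (e : E) : Set (ℝ × ℝ) := PT ∩ c e '' Set.Icc 0 1

theorem Pts_conn_aux (hPT : PT.Finite) (hinj : ∀ e, Set.InjOn (c e) (Set.Icc 0 1)) (e : E) (n : ℕ) :
    ∀ s t, s ∈ Set.Icc (0:ℝ) 1 → t ∈ Set.Icc (0:ℝ) 1 → s < t → c e s ∈ PT → c e t ∈ PT →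
      {u | u ∈ Set.Ioo s t ∧ c e u ∈ PT}.ncard = n → Rch (Gam c PT) (Pts c PT e) (c e s) (c e t) := by
  induction n using Nat.strong_induction_on with
  | _ n ih =>
  intro s t hs ht hst hsP htP hn
  have hfin : ∀ s t, s ∈ Set.Icc (0:ℝ) 1 → t ∈ Set.Icc (0:ℝ) 1 → {u | u ∈ Set.Ioo s t ∧ c e u ∈ PT}.Finite := by
    intro s t hs ht
    apply Set.Finite.of_finite_image (f := c e)
    · apply hPT.subset
      rintro _ ⟨u, hu, rfl⟩
      exact hu.2
    · intro u hu v hv huv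
      exact hinj e ⟨hs.1.trans hu.1.1.le, hu.1.2.le.trans ht.2⟩ ⟨hs.1.trans hv.1.1.le, hv.1.2.le.trans ht.2⟩ huv
  by_cases hem : ∃ u ∈ Set.Ioo s t, c e u ∈ PT
  · obtain ⟨u, hu, huP⟩ := hem
    have huI : u ∈ Set.Icc (0:ℝ) 1 := ⟨hs.1.trans hu.1.le, hu.2.le.trans ht.2⟩
    have h1 : Rch (Gam c PT) (Pts c PT e) (c e s) (c e u) := by
      refine ih _ ?_ s u hs huI hu.1 hsP huP rfl
      rw [← hn]
      apply Set.ncard_lt_ncard _ (hfin s t hs ht)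
      refine ⟨fun v hv => ⟨⟨hv.1.1, hv.1.2.trans hu.2⟩, hv.2⟩, fun hh => ?_⟩
      exact lt_irrefl _ (hh (show u ∈ _ from ⟨hu, huP⟩)).1.2
    have h2 : Rch (Gam c PT) (Pts c PT e) (c e u) (c e t) := by
      refine ih _ ?_ u t huI ht hu.2 huP htP rfl
      rw [← hn]
      apply Set.ncard_lt_ncard _ (hfin s t hs ht)
      refine ⟨fun v hv => ⟨⟨hu.1.trans hv.1.1, hv.1.2⟩, hv.2⟩, fun hh => ?_⟩
      exact lt_irrefl _ (hh (show u ∈ _ from ⟨hu, huP⟩)).1.1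
    exact h1.trans h2
  · push Not at hem
    exact Rch.single ⟨e, s, t, ⟨hs, ht, hst, hsP, htP, hem⟩, Or.inl ⟨rfl, rfl⟩⟩ ⟨hsP, s, hs, rfl⟩ ⟨htP, t, ht, rfl⟩

theorem Pts_conn (hPT : PT.Finite) (hinj : ∀ e, Set.InjOn (c e) (Set.Icc 0 1)) (e : E) :
    ∀ p ∈ Pts c PT e, ∀ q ∈ Pts c PT e, Rch (Gam c PT) (Pts c PT e) p q := by
  rintro _ ⟨hsP, s, hs, rfl⟩ _ ⟨htP, t, ht, rfl⟩
  rcases lt_trichotomy s t with h | h | h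
  · exact Pts_conn_aux hPT hinj e _ s t hs ht h hsP htP rfl
  · subst h; exact Rch.refl
  · exact (Pts_conn_aux hPT hinj e _ t s ht hs h htP hsP rfl).symm Gam_symm

def Wd (c : E → ℝ → ℝ × ℝ) (PT X : Set (ℝ × ℝ)) : Set (ℝ × ℝ) :=
  (X ∩ PT) ∪ {z | ∃ e s t, Gap c PT e s t ∧ c e s ∈ X ∧ c e t ∈ X ∧ z ∈ c e '' Set.Ioo s t}

theorem Wd_inter (hinj : ∀ e, Set.InjOn (c e) (Set.Icc 0 1))
    (hPT : ∀ e f, e ≠ f → c e '' Set.Icc 0 1 ∩ c f '' Set.Icc 0 1 ⊆ PT) {X Y : Set (ℝ × ℝ)}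
    (h : (Wd c PT X ∩ Wd c PT Y).Nonempty) : (X ∩ Y).Nonempty := by
  obtain ⟨z, hz1, hz2⟩ := h
  rcases hz1 with hz1 | ⟨e, s, t, hg, hs, ht, u, hu, rfl⟩
  · rcases hz2 with hz2 | ⟨e, s, t, hg, hs, ht, u, hu, rfl⟩
    · exact ⟨z, hz1.1, hz2.1⟩
    · exact absurd hz1.2 (hg.2.2.2.2.2 u hu)
  · have hno := hg.2.2.2.2.2 u hu
    have huI : u ∈ Set.Icc (0:ℝ) 1 := ⟨hg.1.1.trans hu.1.le, hu.2.le.trans hg.2.1.2⟩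
    rcases hz2 with hz2 | ⟨e', s', t', hg', hs', ht', u', hu', heq⟩
    · exact absurd hz2.2 hno
    · have huI' : u' ∈ Set.Icc (0:ℝ) 1 := ⟨hg'.1.1.trans hu'.1.le, hu'.2.le.trans hg'.2.1.2⟩
      by_cases hee : e = e'
      · subst hee
        have := hinj e huI' huI heq
        subst this
        have hss : s = s' := by
          rcases lt_trichotomy s s' with h | h | h
          · exact absurd hg'.2.2.2.1 (hg.2.2.2.2.2 s' ⟨h, hu'.1.trans hu.2⟩)
          · exact h
          · exact absurd hg.2.2.2.1 (hg'.2.2.2.2.2 s ⟨h, hu.1.trans hu'.2⟩)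
        subst hss
        exact ⟨_, hs, hs'⟩
      · exact absurd (hPT e e' hee ⟨⟨u, huI, rfl⟩, ⟨u', huI', heq⟩⟩) hno

theorem Wd_joined (hcont : ∀ e, ContinuousOn (c e) (Set.Icc 0 1)) {X : Set (ℝ × ℝ)} {p q : ℝ × ℝ}
    (hp : p ∈ X) (hpP : p ∈ PT) (h : Rch (Gam c PT) X p q) : JoinedIn (Wd c PT X) p q := by
  induction h with
  | refl => exact JoinedIn.refl (Or.inl ⟨hp, hpP⟩)
  | @tail x y _ hxy ih =>
    refine ih.trans ?_
    obtain ⟨⟨e, s, t, hg, hst⟩, hx, hy⟩ := hxy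
    have key : c e s ∈ X → c e t ∈ X → JoinedIn (Wd c PT X) (c e s) (c e t) := by
      intro h1 h2
      have hpc : IsPathConnected (c e '' Set.Icc s t) := by
        apply IsPathConnected.image'
        · exact (convex_Icc s t).isPathConnected ⟨s, le_rfl, hg.2.2.1.le⟩
        · exact (hcont e).mono (Set.Icc_subset_Icc hg.1.1 hg.2.1.2)
      refine (hpc.joinedIn _ ⟨s, ⟨le_rfl, hg.2.2.1.le⟩, rfl⟩ _ ⟨t, ⟨hg.2.2.1.le, le_rfl⟩, rfl⟩).mono ?_
      rintro _ ⟨u, hu, rfl⟩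
      rcases eq_or_lt_of_le hu.1 with h | h
      · subst h; exact Or.inl ⟨h1, hg.2.2.2.1⟩
      rcases eq_or_lt_of_le hu.2 with h' | h'
      · subst h'; exact Or.inl ⟨h2, hg.2.2.2.2.1⟩
      exact Or.inr ⟨e, s, t, hg, h1, h2, u, ⟨h, h'⟩, rfl⟩
    rcases hst with ⟨rfl, rfl⟩ | ⟨rfl, rfl⟩
    · exact key hx hy
    · exact (key hy hx).symm

theorem Gam_NPl (hcont : ∀ e, ContinuousOn (c e) (Set.Icc 0 1)) (hinj : ∀ e, Set.InjOn (c e) (Set.Icc 0 1))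
    (hPT : ∀ e f, e ≠ f → c e '' Set.Icc 0 1 ∩ c f '' Set.Icc 0 1 ⊆ PT) : NPl (Gam c PT) := by
  intro a b P haP hR
  by_cases hall : ∀ i, a i ∈ PT
  · have hj : ∀ i j, JoinedIn (Wd c PT (P i j)) (a i) (b j) := fun i j =>
      Wd_joined hcont (haP i j) (hall i) (hR i j)
    choose γ hγ using hj
    let φ := Complex.equivRealProdCLM.symm
    obtain ⟨i, k, j, l, hik, hjl, s, t, hst⟩ := K33_plane (fun i => φ (a i)) (fun j => φ (b j))
      (fun i j t => φ ((γ i j).extend t)) (fun i j => φ.continuous.comp (γ i j).continuous_extend)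
      (fun i j => by simp) (fun i j => by simp)
    refine ⟨i, k, j, l, hik, hjl, Wd_inter hinj hPT ⟨(γ i j).extend s, ?_, ?_⟩⟩
    · exact hγ i j _
    · rw [φ.injective hst]; exact hγ k l _
  · push Not at hall
    obtain ⟨i, hi⟩ := hall
    have hb : ∀ j, a i = b j := by
      intro j
      rcases (hR i j).cases_head with h | ⟨x, hx, -⟩
      · exact h
      · exfalso
        obtain ⟨⟨e, s, t, hg, hst⟩, -, -⟩ := hx
        rcases hst with ⟨h, -⟩ | ⟨-, h⟩
        · exact hi (h ▸ hg.2.2.2.1)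
        · exact hi (h ▸ hg.2.2.2.2.1)
    obtain ⟨k, hk⟩ : ∃ k : Fin 3, i ≠ k := ⟨i + 1, by fin_cases i <;> decide⟩
    refine ⟨i, k, 0, 1, hk, by decide, a i, haP _ _, ?_⟩
    rw [hb 1]
    exact (hR k 1).mem (haP _ _)

end Planar

section Group
variable {V : Type*} [Fintype V]

open Classical in
theorem group_classes (H : SimpleGraph V) (Q : Finset V) (w : V → ℝ) (hw : ∀ v, 0 ≤ w v)
    (hcl : ∀ v ∈ Q, (∃ u, H.Adj v u) → ∑ u ∈ Q with H.Reachable v u, w u ≤ 17 / 18 * ∑ u ∈ Q, w u) :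
    ∃ U ⊆ Q, (∀ a ∈ U, ∀ b ∈ Q, H.Adj a b → b ∈ U) ∧
      (U.card ≤ 1 ∨ ∑ u ∈ U, w u ≤ 17 / 18 * ∑ u ∈ Q, w u) ∧
      ((Q \ U).card ≤ 1 ∨ ∑ u ∈ Q \ U, w u ≤ 17 / 18 * ∑ u ∈ Q, w u) := by
  set W := ∑ u ∈ Q, w u with hW
  have hsd : ∀ U ⊆ Q, ∑ u ∈ Q \ U, w u = W - ∑ u ∈ U, w u := by
    intro U hU
    have := Finset.sum_sdiff (f := w) hU
    linarith
  by_cases hheavy : ∃ v ∈ Q, (¬ ∃ u, H.Adj v u) ∧ 17 / 18 * W < w v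
  · obtain ⟨v, hv, hno, hvw⟩ := hheavy
    refine ⟨{v}, by simpa using hv, ?_, Or.inl (by simp), Or.inr ?_⟩
    · intro a ha b _ hab
      rw [Finset.mem_singleton] at ha
      subst ha
      exact absurd ⟨b, hab⟩ hno
    · rw [hsd _ (by simpa using hv)]
      simp
      have : w v ≤ W := Finset.single_le_sum (fun u _ => hw u) hv
      have := hw v
      linarith
  push Not at hheavy
  have hW0 : 0 ≤ W := Finset.sum_nonneg fun u _ => hw u
  have hcl2 : ∀ v ∈ Q, ∑ u ∈ Q with H.Reachable v u, w u ≤ 17 / 18 * W := by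
    intro v hv
    by_cases h : ∃ u, H.Adj v u
    · exact hcl v hv h
    · have : ∀ u, H.Reachable v u → u = v := by
        rintro u ⟨p⟩
        cases p with
        | nil => rfl
        | cons h' _ => exact absurd ⟨_, h'⟩ h
      have e : Q.filter (fun u => H.Reachable v u) = {v} := by
        ext u
        simp only [Finset.mem_filter, Finset.mem_singleton]
        constructor
        · exact fun hu => this u hu.2
        · rintro rfl; exact ⟨hv, SimpleGraph.Reachable.refl _⟩
      rw [e, Finset.sum_singleton]
      exact hheavy v hv (by simpa using h)
  let F := Q.powerset.filter (fun U => (∀ a ∈ U, ∀ b ∈ Q, H.Adj a b → b ∈ U) ∧ ∑ u ∈ U, w u ≤ 17 / 18 * W)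
  have hF : F.Nonempty := ⟨∅, by simp [F]; positivity⟩
  obtain ⟨U, hUF, hmax⟩ := Finset.exists_max_image F (fun U => ∑ u ∈ U, w u) hF
  simp only [F, Finset.mem_filter, Finset.mem_powerset] at hUF hmax
  obtain ⟨hUQ, hUc, hUw⟩ := hUF
  refine ⟨U, hUQ, hUc, Or.inr hUw, Or.inr ?_⟩
  by_contra hcon
  push Not at hcon
  have hU1 : ∑ u ∈ U, w u < W / 18 := by rw [hsd U hUQ] at hcon; linarith
  obtain ⟨v, hv, hvpos⟩ : ∃ v ∈ Q \ U, 0 < w v := by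
    by_contra hno
    push Not at hno
    have := Finset.sum_nonpos hno
    linarith
  rw [Finset.mem_sdiff] at hv
  set K := Q.filter (fun u => H.Reachable v u) with hK
  have hKc : ∀ a ∈ K, ∀ b ∈ Q, H.Adj a b → b ∈ K := by
    intro a ha b hb hab
    rw [hK, Finset.mem_filter] at ha ⊢
    exact ⟨hb, ha.2.trans hab.reachable⟩
  have hKv : w v ≤ ∑ u ∈ K, w u := Finset.single_le_sum (f := w) (fun u _ => hw u)
    (by rw [hK, Finset.mem_filter]; exact ⟨hv.1, SimpleGraph.Reachable.refl _⟩)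
  have hK1 := hmax K ⟨Finset.filter_subset _ _, hKc, hcl2 v hv.1⟩
  by_cases hdis : Disjoint U K
  · have hs : ∑ u ∈ U ∪ K, w u = ∑ u ∈ U, w u + ∑ u ∈ K, w u := Finset.sum_union hdis
    have := hmax (U ∪ K) ⟨Finset.union_subset hUQ (Finset.filter_subset _ _), ?_, ?_⟩
    · linarith
    · intro a ha b hb hab
      rw [Finset.mem_union] at ha ⊢
      exact ha.imp (fun h => hUc a h b hb hab) (fun h => hKc a h b hb hab)
    · rw [hs]; linarith
  · have hKU : ∑ u ∈ U ∪ K, w u ≤ ∑ u ∈ U, w u + ∑ u ∈ K, w u := by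
      rw [← Finset.sum_union_inter]
      have := Finset.sum_nonneg (s := U ∩ K) (fun u _ => hw u)
      linarith
    have hvU : w v + ∑ u ∈ U, w u ≤ ∑ u ∈ U ∪ K, w u := by
      rw [← Finset.sum_insert hv.2]
      apply Finset.sum_le_sum_of_subset_of_nonneg
      · intro u hu
        rw [Finset.mem_insert] at hu
        rcases hu with rfl | hu
        · exact Finset.mem_union_right _ (by rw [hK, Finset.mem_filter]; exact ⟨hv.1, SimpleGraph.Reachable.refl _⟩)
        · exact Finset.mem_union_left _ hu
      · exact fun u _ _ => hw u
    have := hmax (U ∪ K) ⟨Finset.union_subset hUQ (Finset.filter_subset _ _), ?_, ?_⟩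
    · linarith
    · intro a ha b hb hab
      rw [Finset.mem_union] at ha ⊢
      exact ha.imp (fun h => hUc a h b hb hab) (fun h => hKc a h b hb hab)
    · linarith

theorem sum_ite_ncard {E : Type*} [Fintype E] (r : E → E → Prop) [∀ x y, Decidable (r x y)] :
    (∑ x, ∑ y, if r x y then (1:ℝ) else 0) = ({p : E × E | r p.1 p.2}.ncard : ℝ) := by
  classical
  rw [← Fintype.sum_prod_type' (f := fun x y => if r x y then (1:ℝ) else 0), Finset.sum_boole]
  norm_cast
  rw [← Set.ncard_coe_finset]
  congr 1
  ext p; simp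

/-- number of meeting pairs of edges inside Q -/
noncomputable def MQ {G : SimpleGraph V} {α : Type*} (pts : G.edgeSet → Set α) (Q : Finset V) : ℝ :=
  ({p : G.edgeSet × G.edgeSet | (∀ v ∈ p.1.1, v ∈ Q) ∧ (∀ v ∈ p.2.1, v ∈ Q) ∧
    (pts p.1 ∩ pts p.2).Nonempty}.ncard : ℝ)

open Classical in
theorem graph_sep {G : SimpleGraph V} {α : Type*} (pts : G.edgeSet → Set α) (Γ : α → α → Prop) (loc : V → α)
    (hs : ∀ a b, Γ a b → Γ b a) (hNP : NPl Γ)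
    (hconn : ∀ x, ∀ p ∈ pts x, ∀ q ∈ pts x, Rch Γ (pts x) p q)
    (hloc : ∀ x : G.edgeSet, ∀ v ∈ x.1, loc v ∈ pts x)
    (Q : Finset V) (w : V → ℝ) (hw : ∀ v, 0 ≤ w v) :
    ∃ U ⊆ Q, (U.card ≤ 1 ∨ ∑ u ∈ U, w u ≤ 17 / 18 * ∑ u ∈ Q, w u) ∧
      ((Q \ U).card ≤ 1 ∨ ∑ u ∈ Q \ U, w u ≤ 17 / 18 * ∑ u ∈ Q, w u) ∧
      (((U ×ˢ (Q \ U)).filter (fun p => G.Adj p.1 p.2)).card : ℝ) ≤ 2315 * √(MQ pts Q) := by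
  set W := ∑ u ∈ Q, w u with hW
  have hW0 : 0 ≤ W := Finset.sum_nonneg fun u _ => hw u
  rcases hW0.eq_or_lt with hW1 | hW1
  · refine ⟨∅, by simp, Or.inl (by simp), Or.inr ?_, by simp⟩
    simp [← hW, ← hW1]
  let E := {e : G.edgeSet // ∀ v ∈ e.1, v ∈ Q}
  have : Finite G.edgeSet := inferInstance
  have : Fintype E := Fintype.ofFinite E
  let pt : E → Set α := fun e => pts e.1
  let μ : V → ℝ := fun v => if v ∈ Q then w v / W else 0
  obtain ⟨S, hS, hS2⟩ := sep_lemma (pts := pt) (Γ := Γ) loc μ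
    (fun v => by simp only [μ]; split_ifs; exacts [div_nonneg (hw v) hW0, le_rfl])
    (by simp only [μ, Finset.sum_ite_mem, Finset.univ_inter]; rw [← Finset.sum_div]; exact div_self hW1.ne')
    hs hNP (fun x => hconn x.1) (fun x => by
      obtain ⟨⟨x, hx⟩, hQ⟩ := x
      induction x with
      | _ a b => exact ⟨loc a, hloc ⟨s(a, b), hx⟩ a (by simp)⟩)
  obtain ⟨H, hH⟩ : ∃ H : SimpleGraph V, ∀ u v, H.Adj u v ↔ ∃ e : E, e ∉ S ∧ e.1.1 = s(u, v) := by
    refine ⟨SimpleGraph.fromRel (fun u v => ∃ e : E, e ∉ S ∧ e.1.1 = s(u, v)), ?_⟩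
    intro u v
    simp only [SimpleGraph.fromRel_adj]
    constructor
    · rintro ⟨-, h | ⟨e, h1, h2⟩⟩
      · exact h
      · exact ⟨e, h1, by rw [h2, Sym2.eq_swap]⟩
    · rintro ⟨e, h1, h2⟩
      refine ⟨?_, Or.inl ⟨e, h1, h2⟩⟩
      have := e.1.2
      rw [h2, SimpleGraph.mem_edgeSet] at this
      exact this.ne
  have hcl : ∀ v ∈ Q, (∃ u, H.Adj v u) → ∑ u ∈ Q with H.Reachable v u, w u ≤ 17 / 18 * ∑ u ∈ Q, w u := by
    rintro v hv ⟨u, hvu⟩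
    obtain ⟨x, hxS, hx⟩ := (hH _ _).1 hvu
    have h1 := hS2 x hxS
    have key : ∀ u, H.Reachable v u → ∃ y, Relation.ReflTransGen
          (fun a b => a ∉ S ∧ b ∉ S ∧ (pt a ∩ pt b).Nonempty) x y ∧ y ∉ S ∧ loc u ∈ pt y := by
      intro u hu
      rw [SimpleGraph.reachable_iff_reflTransGen] at hu
      induction hu with
      | refl => exact ⟨x, Relation.ReflTransGen.refl, hxS, hloc _ _ (by rw [hx]; simp)⟩
      | @tail b c _ hbc ih =>
        obtain ⟨y, hy1, hy2, hy3⟩ := ih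
        obtain ⟨z, hzS, hz⟩ := (hH _ _).1 hbc
        exact ⟨z, hy1.tail ⟨hy2, hzS, loc b, hy3, hloc _ _ (by rw [hz]; simp)⟩, hzS, hloc _ _ (by rw [hz]; simp)⟩
    have h2 : (∑ u ∈ Q with H.Reachable v u, w u) / W ≤ 17 / 18 := by
      refine le_trans ?_ h1
      rw [Finset.sum_div]
      calc ∑ u ∈ Q with H.Reachable v u, w u / W = ∑ u ∈ Q with H.Reachable v u, μ u := by
            refine Finset.sum_congr rfl fun u hu => ?_
            simp only [μ]; rw [if_pos (Finset.mem_filter.1 hu).1]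
        _ ≤ _ := by
            apply Finset.sum_le_sum_of_subset_of_nonneg
            · intro u hu
              rw [Finset.mem_filter] at hu ⊢
              obtain ⟨y, hy1, -, hy2⟩ := key u hu.2
              exact ⟨Finset.mem_univ _, y, hy1, hy2⟩
            · intro u _ _
              simp only [μ]; split_ifs; exacts [div_nonneg (hw u) hW0, le_rfl]
    rwa [div_le_iff₀ hW1] at h2
  obtain ⟨U, hUQ, hUc, h1, h2⟩ := group_classes H Q w hw hcl
  refine ⟨U, hUQ, h1, h2, le_trans ?_ (hS.trans ?_)⟩
  · norm_cast
    rw [← Set.ncard_coe_finset]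
    have hcut : ∀ p ∈ ((U ×ˢ (Q \ U)).filter (fun p => G.Adj p.1 p.2)), ∃ e : E, e ∈ S ∧ e.1.1 = s(p.1, p.2) := by
      rintro ⟨a, b⟩ hp
      simp only [Finset.mem_filter, Finset.mem_product, Finset.mem_sdiff] at hp
      obtain ⟨⟨ha, hb, hbU⟩, hab⟩ := hp
      let e : E := ⟨⟨s(a, b), hab⟩, by
        intro v hv
        rw [Sym2.mem_iff] at hv
        rcases hv with rfl | rfl
        exacts [hUQ ha, hb]⟩
      refine ⟨e, ?_, rfl⟩
      by_contra he
      exact hbU (hUc a ha b hb ((hH _ _).2 ⟨e, he, rfl⟩))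
    refine le_trans ?_ (Set.ncard_image_le (f := fun e : E => e.1.1) (Set.toFinite S))
    apply Set.ncard_le_ncard_of_injOn (fun p : V × V => s(p.1, p.2))
    · exact fun p hp => by
        obtain ⟨e, h1, h2⟩ := hcut p hp
        exact ⟨e, h1, h2⟩
    · rintro ⟨a, b⟩ hp ⟨a', b'⟩ hp' e1
      simp only [Finset.mem_coe, Finset.mem_filter, Finset.mem_product, Finset.mem_sdiff] at hp hp'
      simp only [Sym2.eq_iff] at e1
      rcases e1 with ⟨rfl, rfl⟩ | ⟨rfl, rfl⟩
      · rfl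
      · exact absurd hp.1.1 hp'.1.2.2
  · rw [sum_ite_ncard (fun x y : E => (pt x ∩ pt y).Nonempty), MQ]
    gcongr
    apply Set.ncard_le_ncard_of_injOn (fun p : E × E => (p.1.1, p.2.1))
    · rintro p hp
      exact ⟨p.1.2, p.2.2, hp⟩
    · rintro ⟨a, b⟩ _ ⟨a', b'⟩ _ h
      simp only [Prod.mk.injEq] at h
      exact Prod.ext (Subtype.ext h.1) (Subtype.ext h.2)

theorem MQ_nonneg {G : SimpleGraph V} {α : Type*} (pts : G.edgeSet → Set α) (Q : Finset V) : 0 ≤ MQ pts Q := by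
  unfold MQ; positivity

open Classical in
theorem MQ_super {G : SimpleGraph V} {α : Type*} (pts : G.edgeSet → Set α) (Q U : Finset V) (hU : U ⊆ Q) :
    MQ pts U + MQ pts (Q \ U) ≤ MQ pts Q := by
  unfold MQ
  norm_cast
  rw [← Set.ncard_union_eq _ (Set.toFinite _) (Set.toFinite _)]
  · apply Set.ncard_le_ncard _ (Set.toFinite _)
    rintro p (⟨h1, h2, h3⟩ | ⟨h1, h2, h3⟩)
    · exact ⟨fun v hv => hU (h1 v hv), fun v hv => hU (h2 v hv), h3⟩
    · exact ⟨fun v hv => (Finset.mem_sdiff.1 (h1 v hv)).1, fun v hv => (Finset.mem_sdiff.1 (h2 v hv)).1, h3⟩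
  · rw [Set.disjoint_left]
    rintro ⟨⟨x, hx⟩, y⟩ ⟨h1, -⟩ ⟨h2, -⟩
    induction x with
    | _ a b => exact (Finset.mem_sdiff.1 (h2 a (by simp))).2 (h1 a (by simp))

end Group

section DrawSep
variable {V : Type*} [Fintype V] {G : SimpleGraph V}

theorem edge_incid_ncard (v : V) : {e : G.edgeSet | v ∈ e.1}.ncard ≤ (G.neighborSet v).ncard := by
  classical
  have h1 : (Subtype.val '' {e : G.edgeSet | v ∈ e.1}).ncard = {e : G.edgeSet | v ∈ e.1}.ncard :=
    Set.ncard_image_of_injective _ Subtype.val_injective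
  rw [← h1]
  refine le_trans ?_ (Set.ncard_image_le (f := fun u => s(v, u)) (Set.toFinite (G.neighborSet v)))
  apply Set.ncard_le_ncard _ (Set.toFinite _)
  rintro _ ⟨⟨e, he⟩, hv, rfl⟩
  obtain ⟨u, rfl⟩ := Sym2.mem_iff_exists.1 hv
  exact ⟨u, he, rfl⟩

theorem share_ncard : {p : G.edgeSet × G.edgeSet | ∃ v, v ∈ p.1.1 ∧ v ∈ p.2.1}.ncard ≤ ssqd G := by
  classical
  have e : {p : G.edgeSet × G.edgeSet | ∃ v, v ∈ p.1.1 ∧ v ∈ p.2.1} =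
      ⋃ v ∈ (Finset.univ : Finset V), {e : G.edgeSet | v ∈ e.1} ×ˢ {e : G.edgeSet | v ∈ e.1} := by
    ext p; simp
  rw [e, ssqd, finsum_eq_sum_of_fintype]
  refine (Finset.set_ncard_biUnion_le _ _).trans (Finset.sum_le_sum fun v _ => ?_)
  rw [Set.ncard_prod, sq]
  exact Nat.mul_le_mul (edge_incid_ncard v) (edge_incid_ncard v)

theorem cross_ncard (D : Drawing G) :
    {p : G.edgeSet × G.edgeSet | s(p.1, p.2) ∈ D.crossingPairs}.ncard ≤ 2 * D.numCrossingPairs := by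
  classical
  have hsub : {p : G.edgeSet × G.edgeSet | s(p.1, p.2) ∈ D.crossingPairs} ⊆
      (fun q : Sym2 G.edgeSet => Quot.out q) '' D.crossingPairs ∪
        (fun q : Sym2 G.edgeSet => (Quot.out q).swap) '' D.crossingPairs := by
    rintro ⟨e, f⟩ h
    have h0 : s((Quot.out s(e, f)).1, (Quot.out s(e, f)).2) = s(e, f) := Quot.out_eq s(e, f)
    rcases Sym2.eq_iff.1 h0 with ⟨h1, h2⟩ | ⟨h1, h2⟩
    · exact Or.inl ⟨s(e, f), h, Prod.ext h1 h2⟩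
    · exact Or.inr ⟨s(e, f), h, Prod.ext h2 h1⟩
  refine (Set.ncard_le_ncard hsub (Set.toFinite _)).trans ((Set.ncard_union_le _ _).trans ?_)
  have h1 := Set.ncard_image_le (f := fun q : Sym2 G.edgeSet => Quot.out q) (Set.toFinite D.crossingPairs)
  have h2 := Set.ncard_image_le (f := fun q : Sym2 G.edgeSet => (Quot.out q).swap) (Set.toFinite D.crossingPairs)
  unfold Drawing.numCrossingPairs
  omega

open Classical in
theorem drawing_sep (D : Drawing G) : ∃ pts : G.edgeSet → Set (ℝ × ℝ),
    (∀ (Q : Finset V) (w : V → ℝ), (∀ v, 0 ≤ w v) →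
      ∃ U ⊆ Q, (U.card ≤ 1 ∨ ∑ u ∈ U, w u ≤ 17 / 18 * ∑ u ∈ Q, w u) ∧
      ((Q \ U).card ≤ 1 ∨ ∑ u ∈ Q \ U, w u ≤ 17 / 18 * ∑ u ∈ Q, w u) ∧
      (((U ×ˢ (Q \ U)).filter (fun p => G.Adj p.1 p.2)).card : ℝ) ≤ 2315 * √(MQ pts Q)) ∧
    MQ pts Finset.univ ≤ 2 * D.numCrossingPairs + ssqd G := by
  let PT : Set (ℝ × ℝ) := Set.range D.pos ∪ ⋃ p ∈ {p : G.edgeSet × G.edgeSet | p.1 ≠ p.2},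
    D.curve p.1 '' Set.Icc 0 1 ∩ D.curve p.2 '' Set.Icc 0 1
  have hfin : PT.Finite := by
    refine (Set.finite_range _).union (Set.Finite.biUnion (Set.toFinite _) ?_)
    intro p hp
    exact D.curve_finite_inter _ _ hp
  have hPT : ∀ e f, e ≠ f → D.curve e '' Set.Icc 0 1 ∩ D.curve f '' Set.Icc 0 1 ⊆ PT := by
    intro e f hef
    refine Set.Subset.trans ?_ Set.subset_union_right
    exact Set.subset_biUnion_of_mem (u := fun p : G.edgeSet × G.edgeSet =>
      D.curve p.1 '' Set.Icc 0 1 ∩ D.curve p.2 '' Set.Icc 0 1) (show (e, f) ∈ {p : G.edgeSet × G.edgeSet | p.1 ≠ p.2} from hef)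
  refine ⟨Pts D.curve PT, fun Q w hw => ?_, ?_⟩
  · refine graph_sep (Pts D.curve PT) (Gam D.curve PT) D.pos Gam_symm (Gam_NPl D.curve_cont D.curve_inj hPT)
      (Pts_conn hfin D.curve_inj) ?_ Q w hw
    intro x v hv
    refine ⟨Or.inl ⟨v, rfl⟩, ?_⟩
    obtain ⟨a, b, hab, h0, h1⟩ := D.curve_ends x
    rw [hab, Sym2.mem_iff] at hv
    rcases hv with rfl | rfl
    · exact ⟨0, by simp, h0⟩
    · exact ⟨1, by simp, h1⟩
  · unfold MQ
    norm_cast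
    have hsub : {p : G.edgeSet × G.edgeSet | (∀ v ∈ p.1.1, v ∈ (Finset.univ : Finset V)) ∧ (∀ v ∈ p.2.1, v ∈ (Finset.univ : Finset V)) ∧
        (Pts D.curve PT p.1 ∩ Pts D.curve PT p.2).Nonempty} ⊆
        {p : G.edgeSet × G.edgeSet | s(p.1, p.2) ∈ D.crossingPairs} ∪
        {p : G.edgeSet × G.edgeSet | ∃ v, v ∈ p.1.1 ∧ v ∈ p.2.1} := by
      rintro ⟨e, f⟩ ⟨-, -, p, ⟨-, s, hs, hsp⟩, ⟨-, t, ht, htp⟩⟩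
      have hend : ∀ (e : G.edgeSet) s, s ∈ Set.Icc (0:ℝ) 1 → s ∉ Set.Ioo (0:ℝ) 1 → ∃ v ∈ e.1, D.curve e s = D.pos v := by
        intro e s hs hno
        obtain ⟨a, b, hab, h0, h1⟩ := D.curve_ends e
        have : s = 0 ∨ s = 1 := by
          by_contra hc
          push Not at hc
          exact hno ⟨lt_of_le_of_ne hs.1 (Ne.symm hc.1), lt_of_le_of_ne hs.2 hc.2⟩
        rcases this with rfl | rfl
        · exact ⟨a, by rw [hab]; simp, h0⟩
        · exact ⟨b, by rw [hab]; simp, h1⟩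
      dsimp only at hsp htp
      by_cases hs' : s ∈ Set.Ioo (0:ℝ) 1
      · by_cases ht' : t ∈ Set.Ioo (0:ℝ) 1
        · by_cases hef : e = f
          · right
            subst hef
            obtain ⟨a, b, hab, -, -⟩ := D.curve_ends e
            exact ⟨a, by rw [hab]; simp, by rw [hab]; simp⟩
          · left
            exact ⟨e, f, hef, rfl, p, ⟨s, hs', hsp⟩, ⟨t, ht', htp⟩⟩
        · exfalso
          obtain ⟨v, hv, hv2⟩ := hend f t ht ht'
          exact D.curve_avoid e s hs' ⟨v, by rw [hsp, ← htp, hv2]⟩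
      · obtain ⟨u, hu, hu2⟩ := hend e s hs hs'
        by_cases ht' : t ∈ Set.Ioo (0:ℝ) 1
        · exfalso
          exact D.curve_avoid f t ht' ⟨u, by rw [htp, ← hsp, hu2]⟩
        · obtain ⟨v, hv, hv2⟩ := hend f t ht ht'
          right
          have : u = v := D.pos_inj (by rw [← hu2, ← hv2, hsp, htp])
          subst this
          exact ⟨u, hu, hv⟩
    refine (Set.ncard_le_ncard hsub (Set.toFinite _)).trans ((Set.ncard_union_le _ _).trans ?_)
    exact Nat.add_le_add (cross_ncard D) share_ncard

end DrawSep

section Recur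
variable {V : Type*} [Fintype V] (G : SimpleGraph V)

open Classical in
noncomputable def chi (p : Prop) : ℝ := if p then 1 else 0

theorem chi_nonneg (p : Prop) : 0 ≤ chi p := by unfold chi; split_ifs <;> norm_num
theorem chi_true {p : Prop} (h : p) : chi p = 1 := by unfold chi; rw [if_pos h]
theorem chi_false {p : Prop} (h : ¬ p) : chi p = 0 := by unfold chi; rw [if_neg h]

noncomputable def II (Q : Finset V) (r : V → ℕ) : ℝ :=
  ∑ a, ∑ b, ∑ c, ∑ d, chi (a ∈ Q ∧ b ∈ Q ∧ c ∈ Q ∧ d ∈ Q ∧ G.Adj a b ∧ G.Adj c d ∧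
    r a < r c ∧ r c < r b ∧ r b < r d)

noncomputable def JJ (Q : Finset V) (o : V → ℝ) (r : V → ℕ) : ℝ :=
  ∑ a, ∑ b, ∑ x, chi (a ∈ Q ∧ b ∈ Q ∧ x ∈ Q ∧ G.Adj a b ∧ r a < r x ∧ r x < r b) * o x

noncomputable def dg (U : Finset V) (x : V) : ℝ := ∑ d, chi (d ∈ U ∧ G.Adj x d)

noncomputable def cut (U W : Finset V) : ℝ := ∑ a, ∑ b, chi (a ∈ U ∧ b ∈ W ∧ G.Adj a b)

theorem cut_nonneg (U W : Finset V) : 0 ≤ cut G U W :=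
  Finset.sum_nonneg fun _ _ => Finset.sum_nonneg fun _ _ => chi_nonneg _

theorem dg_nonneg (U : Finset V) (x : V) : 0 ≤ dg G U x := Finset.sum_nonneg fun _ _ => chi_nonneg _

theorem cut_symm (U W : Finset V) : cut G U W = cut G W U := by
  unfold cut
  rw [Finset.sum_comm]
  refine Finset.sum_congr rfl fun a _ => Finset.sum_congr rfl fun b _ => ?_
  congr 1
  rw [G.adj_comm]
  apply propext
  tauto

theorem sum_dg (U W : Finset V) : ∑ x ∈ U, dg G W x = cut G U W := by
  classical
  unfold dg cut
  rw [← Finset.sum_filter_add_sum_filter_not Finset.univ (fun a => a ∈ U)]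
  have h2 : ∑ a with a ∉ U, ∑ b, chi (a ∈ U ∧ b ∈ W ∧ G.Adj a b) = 0 := by
    refine Finset.sum_eq_zero fun a ha => Finset.sum_eq_zero fun b _ => chi_false ?_
    simp at ha
    tauto
  have h3 : Finset.univ.filter (fun a => a ∈ U) = U := by ext; simp
  rw [h2, add_zero, h3]
  refine Finset.sum_congr rfl fun a ha => Finset.sum_congr rfl fun b _ => ?_
  congr 1
  apply propext
  tauto

open Classical in
theorem cut_eq_card (U W : Finset V) :
    cut G U W = (((U ×ˢ W).filter (fun p => G.Adj p.1 p.2)).card : ℝ) := by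
  unfold cut
  rw [← Fintype.sum_prod_type' (f := fun a b => chi (a ∈ U ∧ b ∈ W ∧ G.Adj a b))]
  have h : ∀ p : V × V, chi (p.1 ∈ U ∧ p.2 ∈ W ∧ G.Adj p.1 p.2) =
      if p ∈ (U ×ˢ W).filter (fun p => G.Adj p.1 p.2) then (1:ℝ) else 0 := by
    intro p
    by_cases hp : p.1 ∈ U ∧ p.2 ∈ W ∧ G.Adj p.1 p.2
    · rw [chi_true hp, if_pos]
      simp [hp]
    · rw [chi_false hp, if_neg]
      simpa [and_assoc] using hp
  simp only [h]
  rw [Finset.sum_ite_mem, Finset.univ_inter, Finset.sum_const, nsmul_eq_mul, mul_one]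

theorem JJ_add (Q : Finset V) (o o' : V → ℝ) (r : V → ℕ) :
    JJ G Q (fun x => o x + o' x) r = JJ G Q o r + JJ G Q o' r := by
  simp only [JJ, mul_add, Finset.sum_add_distrib]

theorem sum4_comm (f : V → V → V → V → ℝ) :
    ∑ a, ∑ b, ∑ c, ∑ d, f a b c d = ∑ c, ∑ d, ∑ b, ∑ a, f a b c d := by
  have h : ∑ a, ∑ b, ∑ c, ∑ d, f a b c d = ∑ c, ∑ d, ∑ a, ∑ b, f a b c d := by
    have e1 : ∑ a, ∑ b, ∑ c, ∑ d, f a b c d = ∑ p : V × V, ∑ q : V × V, f p.1 p.2 q.1 q.2 := by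
      simp only [Fintype.sum_prod_type]
    have e2 : ∑ c, ∑ d, ∑ a, ∑ b, f a b c d = ∑ q : V × V, ∑ p : V × V, f p.1 p.2 q.1 q.2 := by
      simp only [Fintype.sum_prod_type]
    rw [e1, e2, Finset.sum_comm]
  rw [h]
  refine Finset.sum_congr rfl fun c _ => Finset.sum_congr rfl fun d _ => Finset.sum_comm

open Classical in
theorem II_split (Q U : Finset V) (hU : U ⊆ Q) (r : V → ℕ) (hr : ∀ a ∈ U, ∀ b ∈ Q \ U, r a < r b) :
    II G Q r ≤ II G U r + II G (Q \ U) r + JJ G U (dg G (Q \ U)) r + JJ G (Q \ U) (dg G U) r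
      + cut G U (Q \ U) ^ 2 := by
  set W := Q \ U with hW
  have e3 : JJ G U (dg G W) r = ∑ a, ∑ b, ∑ c, ∑ d,
      chi (a ∈ U ∧ b ∈ U ∧ c ∈ U ∧ G.Adj a b ∧ r a < r c ∧ r c < r b) * chi (d ∈ W ∧ G.Adj c d) := by
    simp only [JJ, dg, Finset.mul_sum]
  have e4 : JJ G W (dg G U) r = ∑ a, ∑ b, ∑ c, ∑ d,
      chi (c ∈ W ∧ d ∈ W ∧ b ∈ W ∧ G.Adj c d ∧ r c < r b ∧ r b < r d) * chi (a ∈ U ∧ G.Adj b a) := by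
    rw [sum4_comm (fun a b c d => chi (c ∈ W ∧ d ∈ W ∧ b ∈ W ∧ G.Adj c d ∧ r c < r b ∧ r b < r d) * chi (a ∈ U ∧ G.Adj b a))]
    simp only [JJ, dg, Finset.mul_sum]
  have e5 : cut G U W ^ 2 = ∑ a, ∑ b, ∑ c, ∑ d,
      chi (a ∈ U ∧ b ∈ W ∧ G.Adj a b) * chi (c ∈ U ∧ d ∈ W ∧ G.Adj c d) := by
    rw [sq]; unfold cut
    simp only [Finset.sum_mul]
    simp only [Finset.mul_sum]
  rw [e3, e4, e5]
  unfold II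
  simp only [← Finset.sum_add_distrib]
  refine Finset.sum_le_sum fun a _ => Finset.sum_le_sum fun b _ => Finset.sum_le_sum fun c _ => Finset.sum_le_sum fun d _ => ?_
  by_cases h : (a ∈ Q ∧ b ∈ Q ∧ c ∈ Q ∧ d ∈ Q ∧ G.Adj a b ∧ G.Adj c d ∧ r a < r c ∧ r c < r b ∧ r b < r d)
  · rw [chi_true h]
    obtain ⟨ha, hb, hc, hd, hab, hcd, h1, h2, h3⟩ := h
    have n1 := chi_nonneg (a ∈ U ∧ b ∈ U ∧ c ∈ U ∧ d ∈ U ∧ G.Adj a b ∧ G.Adj c d ∧ r a < r c ∧ r c < r b ∧ r b < r d)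
    have n2 := chi_nonneg (a ∈ W ∧ b ∈ W ∧ c ∈ W ∧ d ∈ W ∧ G.Adj a b ∧ G.Adj c d ∧ r a < r c ∧ r c < r b ∧ r b < r d)
    have n3 := mul_nonneg (chi_nonneg (a ∈ U ∧ b ∈ U ∧ c ∈ U ∧ G.Adj a b ∧ r a < r c ∧ r c < r b)) (chi_nonneg (d ∈ W ∧ G.Adj c d))
    have n4 := mul_nonneg (chi_nonneg (c ∈ W ∧ d ∈ W ∧ b ∈ W ∧ G.Adj c d ∧ r c < r b ∧ r b < r d)) (chi_nonneg (a ∈ U ∧ G.Adj b a))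
    have n5 := mul_nonneg (chi_nonneg (a ∈ U ∧ b ∈ W ∧ G.Adj a b)) (chi_nonneg (c ∈ U ∧ d ∈ W ∧ G.Adj c d))
    have hUW : ∀ x ∈ Q, x ∈ U ∨ x ∈ W := fun x hx => by
      by_cases h : x ∈ U
      · exact Or.inl h
      · exact Or.inr (by rw [hW, Finset.mem_sdiff]; exact ⟨hx, h⟩)
    have hord : ∀ x ∈ Q, ∀ y ∈ Q, r x < r y → y ∈ U → x ∈ U := by
      intro x hx y hy hxy hyU
      rcases hUW x hx with h | h
      · exact h
      · exact absurd (hr y hyU x h) (by omega)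
    rcases hUW d hd with hdU | hdW
    · have hbU := hord b hb d hd h3 hdU
      have hcU := hord c hc b hb h2 hbU
      have haU := hord a ha c hc h1 hcU
      have : chi (a ∈ U ∧ b ∈ U ∧ c ∈ U ∧ d ∈ U ∧ G.Adj a b ∧ G.Adj c d ∧ r a < r c ∧ r c < r b ∧ r b < r d) = 1 :=
        chi_true ⟨haU, hbU, hcU, hdU, hab, hcd, h1, h2, h3⟩
      linarith
    · rcases hUW b hb with hbU | hbW
      · have hcU := hord c hc b hb h2 hbU
        have haU := hord a ha c hc h1 hcU
        have t1 : chi (a ∈ U ∧ b ∈ U ∧ c ∈ U ∧ G.Adj a b ∧ r a < r c ∧ r c < r b) = 1 := chi_true ⟨haU, hbU, hcU, hab, h1, h2⟩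
        have t2 : chi (d ∈ W ∧ G.Adj c d) = 1 := chi_true ⟨hdW, hcd⟩
        rw [t1, t2] at n3 ⊢
        linarith
      · rcases hUW c hc with hcU | hcW
        · have haU := hord a ha c hc h1 hcU
          have t1 : chi (a ∈ U ∧ b ∈ W ∧ G.Adj a b) = 1 := chi_true ⟨haU, hbW, hab⟩
          have t2 : chi (c ∈ U ∧ d ∈ W ∧ G.Adj c d) = 1 := chi_true ⟨hcU, hdW, hcd⟩
          rw [t1, t2] at n5 ⊢
          linarith
        · rcases hUW a ha with haU | haW
          · have t1 : chi (c ∈ W ∧ d ∈ W ∧ b ∈ W ∧ G.Adj c d ∧ r c < r b ∧ r b < r d) = 1 := chi_true ⟨hcW, hdW, hbW, hcd, h2, h3⟩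
            have t2 : chi (a ∈ U ∧ G.Adj b a) = 1 := chi_true ⟨haU, hab.symm⟩
            rw [t1, t2] at n4 ⊢
            linarith
          · have : chi (a ∈ W ∧ b ∈ W ∧ c ∈ W ∧ d ∈ W ∧ G.Adj a b ∧ G.Adj c d ∧ r a < r c ∧ r c < r b ∧ r b < r d) = 1 :=
              chi_true ⟨haW, hbW, hcW, hdW, hab, hcd, h1, h2, h3⟩
            linarith
  · rw [chi_false h]
    have := @chi_nonneg
    have := fun p q => mul_nonneg (chi_nonneg p) (chi_nonneg q)
    refine add_nonneg (add_nonneg (add_nonneg (add_nonneg ?_ ?_) ?_) ?_) ?_ <;> first | exact chi_nonneg _ | exact mul_nonneg (chi_nonneg _) (chi_nonneg _)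

open Classical in
theorem JJ_split (Q U : Finset V) (hU : U ⊆ Q) (o : V → ℝ) (ho : ∀ v, 0 ≤ o v) (r : V → ℕ)
    (hr : ∀ a ∈ U, ∀ b ∈ Q \ U, r a < r b) :
    JJ G Q o r ≤ JJ G U o r + JJ G (Q \ U) o r + cut G U (Q \ U) * ∑ x ∈ Q, o x := by
  set W := Q \ U with hW
  have e1 : ∑ x ∈ Q, o x = ∑ x, chi (x ∈ Q) * o x := by
    simp only [chi, ite_mul, one_mul, zero_mul, Finset.sum_ite_mem, Finset.univ_inter]
  have e5 : cut G U W * ∑ x ∈ Q, o x = ∑ a, ∑ b, ∑ x, chi (a ∈ U ∧ b ∈ W ∧ G.Adj a b) * (chi (x ∈ Q) * o x) := by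
    rw [e1]; unfold cut
    simp only [Finset.sum_mul]
    simp only [Finset.mul_sum]
  rw [e5]
  unfold JJ
  simp only [← Finset.sum_add_distrib]
  refine Finset.sum_le_sum fun a _ => Finset.sum_le_sum fun b _ => Finset.sum_le_sum fun x _ => ?_
  have n1 := mul_nonneg (chi_nonneg (a ∈ U ∧ b ∈ U ∧ x ∈ U ∧ G.Adj a b ∧ r a < r x ∧ r x < r b)) (ho x)
  have n2 := mul_nonneg (chi_nonneg (a ∈ W ∧ b ∈ W ∧ x ∈ W ∧ G.Adj a b ∧ r a < r x ∧ r x < r b)) (ho x)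
  have n3 := mul_nonneg (chi_nonneg (a ∈ U ∧ b ∈ W ∧ G.Adj a b)) (mul_nonneg (chi_nonneg (x ∈ Q)) (ho x))
  by_cases h : (a ∈ Q ∧ b ∈ Q ∧ x ∈ Q ∧ G.Adj a b ∧ r a < r x ∧ r x < r b)
  · rw [chi_true h]
    obtain ⟨ha, hb, hx, hab, h1, h2⟩ := h
    have hUW : ∀ x ∈ Q, x ∈ U ∨ x ∈ W := fun x hx => by
      by_cases h : x ∈ U
      · exact Or.inl h
      · exact Or.inr (by rw [hW, Finset.mem_sdiff]; exact ⟨hx, h⟩)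
    have hord : ∀ x ∈ Q, ∀ y ∈ Q, r x < r y → y ∈ U → x ∈ U := by
      intro x hx y hy hxy hyU
      rcases hUW x hx with h | h
      · exact h
      · exact absurd (hr y hyU x h) (by omega)
    rcases hUW b hb with hbU | hbW
    · have hxU := hord x hx b hb h2 hbU
      have haU := hord a ha x hx h1 hxU
      rw [chi_true (show (a ∈ U ∧ b ∈ U ∧ x ∈ U ∧ G.Adj a b ∧ r a < r x ∧ r x < r b) from ⟨haU, hbU, hxU, hab, h1, h2⟩)] at n1 ⊢
      linarith
    · rcases hUW a ha with haU | haW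
      · rw [chi_true (show (a ∈ U ∧ b ∈ W ∧ G.Adj a b) from ⟨haU, hbW, hab⟩), chi_true hx] at n3 ⊢
        linarith
      · have hxW : x ∈ W := by
          rcases hUW x hx with h | h
          · exact absurd (hr x h a haW) (by omega)
          · exact h
        rw [chi_true (show (a ∈ W ∧ b ∈ W ∧ x ∈ W ∧ G.Adj a b ∧ r a < r x ∧ r x < r b) from ⟨haW, hbW, hxW, hab, h1, h2⟩)] at n2 ⊢
        linarith
  · rw [chi_false h]
    linarith

noncomputable def TT (Q : Finset V) (o : V → ℝ) (r : V → ℕ) : ℝ := II G Q r + JJ G Q o r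

theorem TT_congr (Q : Finset V) (o : V → ℝ) (r r' : V → ℕ)
    (h : ∀ x ∈ Q, ∀ y ∈ Q, (r x < r y ↔ r' x < r' y)) : TT G Q o r = TT G Q o r' := by
  unfold TT II JJ
  congr 1
  · refine Finset.sum_congr rfl fun a _ => Finset.sum_congr rfl fun b _ => Finset.sum_congr rfl fun c _ =>
      Finset.sum_congr rfl fun d _ => ?_
    congr 1
    apply propext
    constructor
    · rintro ⟨ha, hb, hc, hd, h1, h2, h3, h4, h5⟩
      exact ⟨ha, hb, hc, hd, h1, h2, (h _ ha _ hc).1 h3, (h _ hc _ hb).1 h4, (h _ hb _ hd).1 h5⟩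
    · rintro ⟨ha, hb, hc, hd, h1, h2, h3, h4, h5⟩
      exact ⟨ha, hb, hc, hd, h1, h2, (h _ ha _ hc).2 h3, (h _ hc _ hb).2 h4, (h _ hb _ hd).2 h5⟩
  · refine Finset.sum_congr rfl fun a _ => Finset.sum_congr rfl fun b _ => Finset.sum_congr rfl fun c _ => ?_
    congr 2
    apply propext
    constructor
    · rintro ⟨ha, hb, hc, h1, h3, h4⟩
      exact ⟨ha, hb, hc, h1, (h _ ha _ hc).1 h3, (h _ hc _ hb).1 h4⟩
    · rintro ⟨ha, hb, hc, h1, h3, h4⟩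
      exact ⟨ha, hb, hc, h1, (h _ ha _ hc).2 h3, (h _ hc _ hb).2 h4⟩

theorem TT_small (Q : Finset V) (hQ : Q.card ≤ 1) (o : V → ℝ) (r : V → ℕ) : TT G Q o r = 0 := by
  rw [Finset.card_le_one] at hQ
  unfold TT II JJ
  rw [Finset.sum_eq_zero, Finset.sum_eq_zero, add_zero]
  · refine fun a _ => Finset.sum_eq_zero fun b _ => Finset.sum_eq_zero fun c _ => ?_
    rw [chi_false, zero_mul]
    rintro ⟨ha, hb, hc, h1, h3, h4⟩
    exact h1.ne (hQ a ha b hb)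
  · refine fun a _ => Finset.sum_eq_zero fun b _ => Finset.sum_eq_zero fun c _ => Finset.sum_eq_zero fun d _ => ?_
    rw [chi_false]
    rintro ⟨ha, hb, hc, hd, h1, h3, h4⟩
    exact h1.ne (hQ a ha b hb)

open Classical in
theorem TT_combine (Q U : Finset V) (hU : U ⊆ Q) (o : V → ℝ) (ho : ∀ v, 0 ≤ o v) (r1 r2 : V → ℕ)
    (h1 : Set.InjOn r1 U) (h2 : Set.InjOn r2 (Q \ U : Finset V)) :
    ∃ r : V → ℕ, Set.InjOn r Q ∧ TT G Q o r ≤ TT G U (fun x => o x + dg G (Q \ U) x) r1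
      + TT G (Q \ U) (fun x => o x + dg G U x) r2
      + cut G U (Q \ U) ^ 2 + cut G U (Q \ U) * ∑ x ∈ Q, o x := by
  let N := ∑ v, (r1 v + 1)
  have hN : ∀ v, r1 v < N := fun v =>
    lt_of_lt_of_le (Nat.lt_succ_self _) (Finset.single_le_sum (f := fun v => r1 v + 1) (fun _ _ => Nat.zero_le _) (Finset.mem_univ v))
  let r : V → ℕ := fun v => if v ∈ U then r1 v else N + r2 v
  have hrU : ∀ v ∈ U, r v = r1 v := fun v hv => if_pos hv
  have hrW : ∀ v ∈ Q \ U, r v = N + r2 v := fun v hv => if_neg (Finset.mem_sdiff.1 hv).2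
  have hord : ∀ a ∈ U, ∀ b ∈ Q \ U, r a < r b := by
    intro a ha b hb
    rw [hrU a ha, hrW b hb]
    have := hN a
    omega
  refine ⟨r, ?_, ?_⟩
  · intro x hx y hy hxy
    by_cases hxU : x ∈ U <;> by_cases hyU : y ∈ U
    · rw [hrU x hxU, hrU y hyU] at hxy; exact h1 hxU hyU hxy
    · have := hord x hxU y (Finset.mem_sdiff.2 ⟨hy, hyU⟩); omega
    · have := hord y hyU x (Finset.mem_sdiff.2 ⟨hx, hxU⟩); omega
    · have hx' := Finset.mem_sdiff.2 ⟨hx, hxU⟩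
      have hy' := Finset.mem_sdiff.2 ⟨hy, hyU⟩
      rw [hrW x hx', hrW y hy'] at hxy
      exact h2 hx' hy' (by omega)
  · rw [← TT_congr G U _ r r1 (fun x hx y hy => by rw [hrU x hx, hrU y hy]),
      ← TT_congr G (Q \ U) _ r r2 (fun x hx y hy => by rw [hrW x hx, hrW y hy]; omega)]
    unfold TT
    rw [JJ_add, JJ_add]
    have := II_split G Q U hU r hord
    have := JJ_split G Q U hU o ho r hord
    linarith

open Classical in
theorem recursion (M : Finset V → ℝ) (hM0 : ∀ Q, 0 ≤ M Q)
    (hMs : ∀ Q U, U ⊆ Q → M U + M (Q \ U) ≤ M Q) (C : ℝ) (hC : 0 ≤ C)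
    (hsep : ∀ (Q : Finset V) (w : V → ℝ), (∀ v, 0 ≤ w v) →
      ∃ U ⊆ Q, (U.card ≤ 1 ∨ ∑ u ∈ U, w u ≤ 17 / 18 * ∑ u ∈ Q, w u) ∧
      ((Q \ U).card ≤ 1 ∨ ∑ u ∈ Q \ U, w u ≤ 17 / 18 * ∑ u ∈ Q, w u) ∧
      (((U ×ˢ (Q \ U)).filter (fun p => G.Adj p.1 p.2)).card : ℝ) ≤ C * √(M Q)) (n : ℕ) :
    ∀ Q : Finset V, Q.card = n → ∀ o : V → ℝ, (∀ v, 0 ≤ o v) → ∃ r : V → ℕ, Set.InjOn r Q ∧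
      TT G Q o r ≤ 311 * C ^ 2 / Real.log (18 / 17) * Real.log Q.card * M Q + (∑ x ∈ Q, o x) ^ 2 := by
  set δ := Real.log (18 / 17) with hδ
  have hδ0 : 0 < δ := Real.log_pos (by norm_num)
  set A := 311 * C ^ 2 / δ with hA
  have hA0 : 0 ≤ A := by positivity
  induction n using Nat.strong_induction_on with
  | _ n ih =>
  intro Q hQn o ho
  have htriv : ∀ W : Finset V, W.card ≤ 1 → ∀ o : V → ℝ, ∃ r : V → ℕ, Set.InjOn r W ∧ TT G W o r = 0 := by
    intro W hW o
    refine ⟨fun _ => 0, ?_, TT_small G W hW o _⟩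
    intro x hx y hy _
    exact Finset.card_le_one.1 hW x hx y hy
  by_cases hQ1 : Q.card ≤ 1
  · obtain ⟨r, h1, h2⟩ := htriv Q hQ1 o
    refine ⟨r, h1, ?_⟩
    rw [h2]
    have := hM0 Q
    have : 0 ≤ Real.log Q.card := Real.log_natCast_nonneg _
    positivity
  push Not at hQ1
  have hQ2 : (2:ℝ) ≤ Q.card := by exact_mod_cast hQ1
  set L := Real.log Q.card with hL
  have hLδ : 0 ≤ L - δ := by
    rw [hL, hδ]
    have : Real.log (18 / 17) ≤ Real.log Q.card := Real.log_le_log (by norm_num) (by linarith)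
    linarith
  have hcut : ∀ (Q' U : Finset V), (((U ×ˢ (Q' \ U)).filter (fun p => G.Adj p.1 p.2)).card : ℝ) ≤ C * √(M Q') →
      M Q' ≤ M Q → cut G U (Q' \ U) ≤ C * √(M Q) := by
    intro Q' U h h'
    rw [cut_eq_card]
    refine h.trans ?_
    gcongr
  set β := C * √(M Q) with hβ
  have hβ0 : 0 ≤ β := by positivity
  have hβ2 : β ^ 2 = C ^ 2 * M Q := by rw [hβ, mul_pow, Real.sq_sqrt (hM0 Q)]
  -- bound for a smaller piece
  have hsmall : ∀ W : Finset V, (W.card ≤ 1 ∨ (W.card : ℝ) ≤ 17 / 18 * Q.card) → ∀ o : V → ℝ, (∀ v, 0 ≤ o v) →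
      ∃ r : V → ℕ, Set.InjOn r W ∧ TT G W o r ≤ A * (L - δ) * M W + (∑ x ∈ W, o x) ^ 2 := by
    intro W hW o ho
    have hMW := hM0 W
    by_cases hW1 : W.card ≤ 1
    · obtain ⟨r, h1, h2⟩ := htriv W hW1 o
      refine ⟨r, h1, ?_⟩
      rw [h2]; positivity
    · have hW2 := hW.resolve_left hW1
      push Not at hW1
      have hlt : W.card < n := by
        rw [← hQn]
        have : (W.card : ℝ) < Q.card := by linarith
        exact_mod_cast this
      obtain ⟨r, h1, h2⟩ := ih _ hlt W rfl o ho
      refine ⟨r, h1, h2.trans ?_⟩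
      have : Real.log W.card ≤ L - δ := by
        have hWpos : (0:ℝ) < W.card := by exact_mod_cast (by omega : 0 < W.card)
        rw [hL, hδ, ← Real.log_div (by positivity) (by norm_num)]
        apply Real.log_le_log hWpos
        rw [le_div_iff₀ (by norm_num)]
        linarith
      gcongr
  -- half step
  have hhalf : ∀ Q' ⊆ Q, M Q' ≤ M Q → ∀ o : V → ℝ, (∀ v, 0 ≤ o v) →
      ∃ r : V → ℕ, Set.InjOn r Q' ∧ TT G Q' o r ≤ A * (L - δ) * M Q' + (∑ x ∈ Q', o x) ^ 2
        + 5 * β * (∑ x ∈ Q', o x) + 5 * β ^ 2 := by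
    intro Q' hQ' hMQ' o ho
    obtain ⟨U, hU, hU1, hU2, hUc⟩ := hsep Q' (fun _ => 1) (fun _ => zero_le_one)
    have hb := hcut Q' U hUc hMQ'
    have hcQ : (Q'.card : ℝ) ≤ Q.card := by exact_mod_cast Finset.card_le_card hQ'
    simp only [Finset.sum_const, nsmul_eq_mul, mul_one] at hU1 hU2
    obtain ⟨r1, hr1, hT1⟩ := hsmall U (hU1.imp id (fun h => by linarith)) (fun x => o x + dg G (Q' \ U) x)
      (fun v => add_nonneg (ho v) (dg_nonneg G _ _))
    obtain ⟨r2, hr2, hT2⟩ := hsmall (Q' \ U) (hU2.imp id (fun h => by linarith)) (fun x => o x + dg G U x)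
      (fun v => add_nonneg (ho v) (dg_nonneg G _ _))
    obtain ⟨r, hr, hT⟩ := TT_combine G Q' U hU o ho r1 r2 hr1 hr2
    refine ⟨r, hr, hT.trans ?_⟩
    rw [Finset.sum_add_distrib, sum_dg] at hT1 hT2
    rw [cut_symm G (Q' \ U) U] at hT2
    have hs : ∑ x ∈ Q', o x = ∑ x ∈ U, o x + ∑ x ∈ Q' \ U, o x := by
      have := Finset.sum_sdiff (f := o) hU; linarith
    have hs1 : 0 ≤ ∑ x ∈ U, o x := Finset.sum_nonneg fun x _ => ho x
    have hs2 : 0 ≤ ∑ x ∈ Q' \ U, o x := Finset.sum_nonneg fun x _ => ho x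
    have hb0 := cut_nonneg G U (Q' \ U)
    have hm : A * (L - δ) * (M U + M (Q' \ U)) ≤ A * (L - δ) * M Q' :=
      mul_le_mul_of_nonneg_left (hMs Q' U hU) (mul_nonneg hA0 hLδ)
    rw [hs]
    generalize ∑ x ∈ U, o x = s1 at *
    generalize ∑ x ∈ Q' \ U, o x = s2 at *
    generalize cut G U (Q' \ U) = b at *
    have p1 : b * (s1 + s2) ≤ β * (s1 + s2) := mul_le_mul_of_nonneg_right hb (by linarith)
    have p2 : b ^ 2 ≤ β ^ 2 := pow_le_pow_left₀ hb0 hb 2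
    have p3 : 0 ≤ s1 * s2 := mul_nonneg hs1 hs2
    have p4 : 0 ≤ b * (s1 + s2) := mul_nonneg hb0 (by linarith)
    have p5 : 0 ≤ b ^ 2 := sq_nonneg b
    nlinarith
  obtain ⟨U, hU, hU1, hU2, hUc⟩ := hsep Q o ho
  have hb := hcut Q U hUc le_rfl
  have hsup := hMs Q U hU
  have hs : ∑ x ∈ Q, o x = ∑ x ∈ U, o x + ∑ x ∈ Q \ U, o x := by
    have := Finset.sum_sdiff (f := o) hU; linarith
  have hs1 : 0 ≤ ∑ x ∈ U, o x := Finset.sum_nonneg fun x _ => ho x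
  have hs2 : 0 ≤ ∑ x ∈ Q \ U, o x := Finset.sum_nonneg fun x _ => ho x
  have hb0 := cut_nonneg G U (Q \ U)
  have hpart : ∀ U' ⊆ Q, M U' ≤ M Q → ∀ W : Finset V, cut G U' W ≤ β →
      (U'.card ≤ 1 ∨ ∑ u ∈ U', o u ≤ 17 / 18 * ∑ u ∈ Q, o u) →
      ∃ r : V → ℕ, Set.InjOn r U' ∧ TT G U' (fun x => o x + dg G W x) r ≤ A * (L - δ) * M U'
        + 17 / 18 * (∑ x ∈ Q, o x) * (∑ x ∈ U', o x) + 7 * β * (∑ x ∈ U', o x) + 11 * β ^ 2 := by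
    intro U' hU' hM' W hcW hsU
    have hs0 : 0 ≤ ∑ x ∈ U', o x := Finset.sum_nonneg fun x _ => ho x
    have hsQ : 0 ≤ ∑ x ∈ Q, o x := Finset.sum_nonneg fun x _ => ho x
    have hMU := hM0 U'
    by_cases h1 : U'.card ≤ 1
    · obtain ⟨r, h1, h2⟩ := htriv U' h1 (fun x => o x + dg G W x)
      refine ⟨r, h1, ?_⟩
      rw [h2]; positivity
    · have h2 := hsU.resolve_left h1
      obtain ⟨r, hr, hT⟩ := hhalf U' hU' hM' (fun x => o x + dg G W x) (fun v => add_nonneg (ho v) (dg_nonneg G _ _))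
      refine ⟨r, hr, hT.trans ?_⟩
      rw [Finset.sum_add_distrib, sum_dg]
      have hc0 := cut_nonneg G U' W
      generalize ∑ x ∈ U', o x = s1 at *
      generalize ∑ x ∈ Q, o x = s at *
      generalize cut G U' W = b at *
      have q1 : (s1 + b) ^ 2 ≤ (s1 + β) ^ 2 := pow_le_pow_left₀ (by linarith) (by linarith) 2
      have q2 : 5 * β * (s1 + b) ≤ 5 * β * (s1 + β) := mul_le_mul_of_nonneg_left (by linarith) (by linarith)
      have q3 : s1 * s1 ≤ 17 / 18 * s * s1 := mul_le_mul_of_nonneg_right h2 hs0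
      nlinarith
  have hM1 : M U ≤ M Q := by have := hM0 (Q \ U); linarith
  have hM2 : M (Q \ U) ≤ M Q := by have := hM0 U; linarith
  obtain ⟨r1, hr1, hT1⟩ := hpart U hU hM1 (Q \ U) hb hU1
  obtain ⟨r2, hr2, hT2⟩ := hpart (Q \ U) Finset.sdiff_subset hM2 U (by rw [cut_symm]; exact hb) hU2
  obtain ⟨r, hr, hT⟩ := TT_combine G Q U hU o ho r1 r2 hr1 hr2
  refine ⟨r, hr, hT.trans ?_⟩
  have hm : A * (L - δ) * (M U + M (Q \ U)) ≤ A * (L - δ) * M Q :=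
    mul_le_mul_of_nonneg_left hsup (mul_nonneg hA0 hLδ)
  have hAδ : A * δ * M Q = 311 * β ^ 2 := by
    rw [hβ2, hA]; field_simp
  have p2 : cut G U (Q \ U) ^ 2 ≤ β ^ 2 := pow_le_pow_left₀ hb0 hb 2
  have p1 : cut G U (Q \ U) * ∑ x ∈ Q, o x ≤ β * ∑ x ∈ Q, o x :=
    mul_le_mul_of_nonneg_right hb (by linarith)
  generalize cut G U (Q \ U) = b at *
  generalize ∑ x ∈ U, o x = s1 at *
  generalize ∑ x ∈ Q \ U, o x = s2 at *
  generalize ∑ x ∈ Q, o x = s at *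
  subst hs
  have q1 : 8 * β * (s1 + s2) ≤ (s1 + s2) ^ 2 / 18 + 288 * β ^ 2 := by
    nlinarith [sq_nonneg ((s1 + s2) / 18 - 4 * β)]
  have z1 : A * (L - δ) * (M U + M (Q \ U)) = A * (L - δ) * M U + A * (L - δ) * M (Q \ U) := by ring
  have z2 : A * (L - δ) * M Q = A * L * M Q - A * δ * M Q := by ring
  have z3 : 17 / 18 * (s1 + s2) * s1 + 17 / 18 * (s1 + s2) * s2 = 17 / 18 * (s1 + s2) ^ 2 := by ring
  have z4 : 7 * β * s1 + 7 * β * s2 + β * (s1 + s2) = 8 * β * (s1 + s2) := by ring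
  linarith

end Recur

section Parab

theorem triple_aux (a b c d e f T : ℤ) (x : ℝ) (ha : 0 ≤ a) (hab : a < b) (hb : b ≤ T)
    (hc : 0 ≤ c) (hcd : c < d) (hd : d ≤ T) (he : 0 ≤ e) (heT : e ≤ T) (hf : 4 * T ^ 3 < f)
    (hea : e ≠ a) (heb : e ≠ b) (hne : ¬ (a = c ∧ b = d))
    (h1 : ((a:ℝ) + b) * x - a * b = (c + d) * x - c * d)
    (h2 : ((a:ℝ) + b) * x - a * b = (e + f) * x - e * f) : False := by
  have key : ((a * b - c * d - e * (a + b - c - d)) * f +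
      ((a + b - c - d) * (a * b) - (a + b - e) * (a * b - c * d)) : ℤ) = 0 := by
    have : ((a * b - c * d - e * (a + b - c - d)) * f +
      ((a + b - c - d) * (a * b) - (a + b - e) * (a * b - c * d)) : ℝ) = 0 := by
      linear_combination ((a:ℝ) + b - e - f) * h1 - ((a:ℝ) + b - c - d) * h2
    exact_mod_cast this
  have hT : 0 ≤ T := by omega
  have hf0 : 0 < f := lt_of_le_of_lt (by positivity) hf
  set α := a * b - c * d - e * (a + b - c - d) with hα
  by_cases h0 : α = 0
  · rw [h0, zero_mul, zero_add] at key
    have k2 : (a + b - c - d) * ((e - a) * (e - b)) = 0 := by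
      have : a * b - c * d = e * (a + b - c - d) := by linarith
      rw [this] at key
      linear_combination key
    have hs : a + b - c - d = 0 := by
      rcases mul_eq_zero.1 k2 with h | h
      · exact h
      · rcases mul_eq_zero.1 h with h | h <;> omega
    have hp : a * b - c * d = 0 := by rw [hs, mul_zero] at hα; linarith
    have h3 : (a - c) * (a - d) = 0 := by
      have : d = a + b - c := by linarith
      subst this
      linear_combination (-1 : ℤ) * hp
    rcases mul_eq_zero.1 h3 with h | h
    · exact hne ⟨by omega, by omega⟩
    · omega
  · have hα1 : 1 ≤ |α| := Int.one_le_abs h0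
    have e1 : |α| * f = |(a + b - c - d) * (a * b) - (a + b - e) * (a * b - c * d)| := by
      rw [← abs_of_pos hf0, ← abs_mul, ← abs_neg (α * f)]
      congr 1; linarith
    have b1 : |a + b - c - d| ≤ 2 * T := by rw [abs_le]; constructor <;> omega
    have b2 : |a + b - e| ≤ 2 * T := by rw [abs_le]; constructor <;> omega
    have m1 : a * b ≤ T * T := mul_le_mul (by omega) hb (by omega) hT
    have m2 : c * d ≤ T * T := mul_le_mul (by omega) hd (by omega) hT
    have m3 : 0 ≤ a * b := mul_nonneg ha (by omega)
    have m4 : 0 ≤ c * d := mul_nonneg hc (by omega)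
    have b3 : |a * b| ≤ T * T := by rw [abs_le]; constructor <;> linarith
    have b4 : |a * b - c * d| ≤ T * T := by rw [abs_le]; constructor <;> linarith
    have c1 : |(a + b - c - d) * (a * b)| ≤ 2 * T * (T * T) := by
      rw [abs_mul]; exact mul_le_mul b1 b3 (abs_nonneg _) (by omega)
    have c2 : |(a + b - e) * (a * b - c * d)| ≤ 2 * T * (T * T) := by
      rw [abs_mul]; exact mul_le_mul b2 b4 (abs_nonneg _) (by omega)
    have c3 := abs_sub ((a + b - c - d) * (a * b)) ((a + b - e) * (a * b - c * d))
    have c4 : f ≤ |α| * f := by nlinarith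
    have c5 : 2 * T * (T * T) + 2 * T * (T * T) = 4 * T ^ 3 := by ring
    linarith

variable {V : Type*} (G : SimpleGraph V) (τ : V → ℤ)

theorem exists_lohi (hτ : Function.Injective τ) (e : G.edgeSet) : ∃ p : V × V, e.1 = s(p.1, p.2) ∧ τ p.1 < τ p.2 := by
  obtain ⟨e, he⟩ := e
  induction e with
  | _ a b =>
    have hab : a ≠ b := G.ne_of_adj he
    rcases lt_or_gt_of_ne (hτ.ne hab) with h | h
    · exact ⟨(a, b), rfl, h⟩
    · exact ⟨(b, a), Sym2.eq_swap, h⟩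

/-- chord point -/
def chord (a b : ℝ) (s : ℝ) : ℝ × ℝ := (a + s * (b - a), a ^ 2 + s * (b ^ 2 - a ^ 2))

theorem chord_line (a b s : ℝ) : (chord a b s).2 = (a + b) * (chord a b s).1 - a * b := by
  simp only [chord]; ring

theorem chord_inner {a b s : ℝ} (hab : a < b) (hs : s ∈ Set.Ioo (0:ℝ) 1) :
    a < (chord a b s).1 ∧ (chord a b s).1 < b := by
  simp only [chord]
  have := sub_pos.2 hab
  constructor
  · nlinarith [mul_pos hs.1 this]
  · nlinarith [mul_pos (sub_pos.2 hs.2) this]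

theorem chord_uniq {a b c d : ℝ} (hab : a < b) (hcd : c < d) (hne : ¬ (a = c ∧ b = d)) {p q : ℝ × ℝ}
    (h1 : p.2 = (a + b) * p.1 - a * b) (h2 : p.2 = (c + d) * p.1 - c * d)
    (h3 : q.2 = (a + b) * q.1 - a * b) (h4 : q.2 = (c + d) * q.1 - c * d) : p = q := by
  by_cases hx : p.1 = q.1
  · exact Prod.ext hx (by rw [h1, h3, hx])
  exfalso
  have h5 : (a + b - c - d) * (p.1 - q.1) = 0 := by linear_combination h2 - h1 + h3 - h4
  have hs : a + b - c - d = 0 := (mul_eq_zero.1 h5).resolve_right (sub_ne_zero.2 hx)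
  have hd : d = a + b - c := by linarith
  subst hd
  have h6 : (a - c) * (a - (a + b - c)) = 0 := by linear_combination h2 - h1
  rcases mul_eq_zero.1 h6 with h | h
  · exact hne ⟨by linarith, by linarith⟩
  · linarith

theorem chord_share {a b c d : ℝ} {p : ℝ × ℝ} (ha : a < p.1) (hb : p.1 < b) (hc : c < p.1) (hd : p.1 < d)
    (h1 : p.2 = (a + b) * p.1 - a * b) (h2 : p.2 = (c + d) * p.1 - c * d) :
    (a < c → b < d) ∧ (a = c → b = d) ∧ (b = d → a = c) := by
  have h : (p.1 - a) * (b - p.1) = (p.1 - c) * (d - p.1) := by linear_combination h2 - h1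
  refine ⟨fun hac => ?_, fun hac => ?_, fun hbd => ?_⟩
  · nlinarith
  · subst hac
    have := mul_left_cancel₀ (sub_pos.2 ha).ne' h
    linarith
  · subst hbd
    have := mul_right_cancel₀ (sub_pos.2 hb).ne' h
    linarith

theorem no_triple_chord (hpos : ∀ v, 0 ≤ τ v) (hgap : ∀ u v, τ u < τ v → 4 * τ u ^ 3 < τ v)
    (a b c d e f : V) (p : ℝ × ℝ) 
    (ha : (τ a:ℝ) < p.1) (hb : p.1 < τ b) (hc : (τ c:ℝ) < p.1) (hd : p.1 < τ d) (he : (τ e:ℝ) < p.1) (hf : p.1 < τ f)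
    (h1 : p.2 = (τ a + τ b) * p.1 - τ a * τ b) (h2 : p.2 = (τ c + τ d) * p.1 - τ c * τ d)
    (h3 : p.2 = (τ e + τ f) * p.1 - τ e * τ f)
    (hne : ¬ (τ a = τ c ∧ τ b = τ d)) (hne2 : ¬ (τ a = τ e ∧ τ b = τ f))
    (hbf : τ b < τ f) (hdf : τ d < τ f) : False := by
  have hab : τ a < τ b := by exact_mod_cast ha.trans hb
  have hcd : τ c < τ d := by exact_mod_cast hc.trans hd
  have heb : τ e < τ b := by exact_mod_cast he.trans hb
  have hea : τ e ≠ τ a := by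
    intro h
    have := (chord_share ha hb he hf h1 h3).2.1 (by rw [h])
    exact hne2 ⟨h.symm, by exact_mod_cast this⟩
  rcases le_total (τ b) (τ d) with h | h
  · exact triple_aux (τ a) (τ b) (τ c) (τ d) (τ e) (τ f) (τ d) p.1 (hpos a) hab h (hpos c) hcd le_rfl
      (hpos e) (by omega) (hgap _ _ hdf) hea heb.ne hne (by rw [← h1, ← h2]) (by rw [← h1, ← h3])
  · exact triple_aux (τ a) (τ b) (τ c) (τ d) (τ e) (τ f) (τ b) p.1 (hpos a) hab le_rfl (hpos c) hcd h
      (hpos e) (by omega) (hgap _ _ hbf) hea heb.ne hne (by rw [← h1, ← h2]) (by rw [← h1, ← h3])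

open Classical in
theorem parab_drawing (hτ : Function.Injective τ) (hpos : ∀ v, 0 ≤ τ v)
    (hgap : ∀ u v, τ u < τ v → 4 * τ u ^ 3 < τ v) :
    ∃ D : Drawing G, D.IsConvex ∧ ∃ (lo hi : G.edgeSet → V),
      (∀ e, e.1 = s(lo e, hi e) ∧ τ (lo e) < τ (hi e)) ∧
      ∀ e s, D.curve e s = chord (τ (lo e)) (τ (hi e)) s := by
  choose lh hlh using exists_lohi G τ hτ
  have hlt : ∀ e, (τ (lh e).1 : ℝ) < τ (lh e).2 := fun e => by exact_mod_cast (hlh e).2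
  have huni : ∀ e f, ((τ (lh e).1 = τ (lh f).1) ∧ τ (lh e).2 = τ (lh f).2) → e = f := by
    rintro e f ⟨h1, h2⟩
    apply Subtype.ext
    rw [(hlh e).1, (hlh f).1, hτ h1, hτ h2]
  have huni' : ∀ e f, e ≠ f → ¬ ((τ (lh e).1 : ℝ) = τ (lh f).1 ∧ (τ (lh e).2 : ℝ) = τ (lh f).2) := by
    rintro e f hef ⟨h1, h2⟩
    exact hef (huni e f ⟨by exact_mod_cast h1, by exact_mod_cast h2⟩)
  let D : Drawing G :=
    { pos := fun v => ((τ v : ℝ), (τ v : ℝ) ^ 2)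
      pos_inj := fun u v h => by
        simp only [Prod.mk.injEq] at h
        exact hτ (by exact_mod_cast h.1)
      curve := fun e s => chord (τ (lh e).1) (τ (lh e).2) s
      curve_cont := fun e => by
        apply Continuous.continuousOn
        unfold chord
        fun_prop
      curve_inj := fun e s _ t _ h => by
        simp only [chord, Prod.mk.injEq] at h
        have := hlt e
        have h1 : (s - t) * ((τ (lh e).2 : ℝ) - τ (lh e).1) = 0 := by linear_combination h.1
        rcases mul_eq_zero.1 h1 with h2 | h2
        · linarith
        · linarith
      curve_ends := fun e => ⟨(lh e).1, (lh e).2, (hlh e).1, by simp [chord], by simp [chord]⟩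
      curve_avoid := fun e t ht => by
        rintro ⟨v, hv⟩
        have h1 := chord_inner (hlt e) ht
        have h2 := chord_line (τ (lh e).1) (τ (lh e).2) t
        simp only at hv
        rw [← hv] at h1 h2
        simp only at h1 h2
        nlinarith [mul_pos (sub_pos.2 h1.1) (sub_pos.2 h1.2)]
      curve_finite_inter := fun e f hef => by
        apply Set.Subsingleton.finite
        rintro p ⟨⟨s, _, hs⟩, ⟨t, _, ht⟩⟩ q ⟨⟨s', _, hs'⟩, ⟨t', _, ht'⟩⟩
        have h1 := chord_line (τ (lh e).1) (τ (lh e).2) s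
        have h2 := chord_line (τ (lh f).1) (τ (lh f).2) t
        have h3 := chord_line (τ (lh e).1) (τ (lh e).2) s'
        have h4 := chord_line (τ (lh f).1) (τ (lh f).2) t'
        simp only at hs ht hs' ht'
        rw [hs] at h1; rw [ht] at h2; rw [hs'] at h3; rw [ht'] at h4
        exact chord_uniq (hlt e) (hlt f) (huni' e f hef) h1 h2 h3 h4
      no_triple_point := fun e f g hef hfg heg p => by
        rintro ⟨⟨s, hs, hsp⟩, ⟨t, ht, htp⟩, ⟨u, hu, hup⟩⟩
        simp only at hsp htp hup
        have e1 := chord_line (τ (lh e).1) (τ (lh e).2) s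
        have f1 := chord_line (τ (lh f).1) (τ (lh f).2) t
        have g1 := chord_line (τ (lh g).1) (τ (lh g).2) u
        have e2 := chord_inner (hlt e) hs
        have f2 := chord_inner (hlt f) ht
        have g2 := chord_inner (hlt g) hu
        rw [hsp] at e1 e2
        rw [htp] at f1 f2
        rw [hup] at g1 g2
        have nef : τ (lh e).2 ≠ τ (lh f).2 := fun h => huni' e f hef
          ⟨(chord_share e2.1 e2.2 f2.1 f2.2 e1 f1).2.2 (by rw [h]), by rw [h]⟩
        have nfg : τ (lh f).2 ≠ τ (lh g).2 := fun h => huni' f g hfg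
          ⟨(chord_share f2.1 f2.2 g2.1 g2.2 f1 g1).2.2 (by rw [h]), by rw [h]⟩
        have neg : τ (lh e).2 ≠ τ (lh g).2 := fun h => huni' e g heg
          ⟨(chord_share e2.1 e2.2 g2.1 g2.2 e1 g1).2.2 (by rw [h]), by rw [h]⟩
        by_cases hg : τ (lh e).2 < τ (lh g).2 ∧ τ (lh f).2 < τ (lh g).2
        · exact no_triple_chord τ hpos hgap _ _ _ _ _ _ p e2.1 e2.2 f2.1 f2.2 g2.1 g2.2 e1 f1 g1
            (fun h => hef (huni e f h)) (fun h => heg (huni e g h)) hg.1 hg.2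
        by_cases hf : τ (lh e).2 < τ (lh f).2 ∧ τ (lh g).2 < τ (lh f).2
        · exact no_triple_chord τ hpos hgap _ _ _ _ _ _ p e2.1 e2.2 g2.1 g2.2 f2.1 f2.2 e1 g1 f1
            (fun h => heg (huni e g h)) (fun h => hef (huni e f h)) hf.1 hf.2
        have he : τ (lh f).2 < τ (lh e).2 ∧ τ (lh g).2 < τ (lh e).2 := by omega
        exact no_triple_chord τ hpos hgap _ _ _ _ _ _ p f2.1 f2.2 g2.1 g2.2 e2.1 e2.2 f1 g1 e1
            (fun h => hfg (huni f g h)) (fun h => hef (huni f e h).symm) he.1 he.2 }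
  refine ⟨D, ⟨?_, ?_⟩, fun e => (lh e).1, fun e => (lh e).2, hlh, fun e s => rfl⟩
  · intro S x hx
    by_contra hxS
    have hconv : Convex ℝ {z : ℝ × ℝ | -(τ x : ℝ) ^ 2 < z.2 - 2 * τ x * z.1} := by
      apply convex_halfSpace_gt (f := fun z : ℝ × ℝ => z.2 - 2 * τ x * z.1)
      constructor
      · intro u v; simp only [Prod.fst_add, Prod.snd_add]; ring
      · intro c u; simp only [Prod.smul_fst, Prod.smul_snd, smul_eq_mul]; ring
    have hsub : D.pos '' S ⊆ {z : ℝ × ℝ | -(τ x : ℝ) ^ 2 < z.2 - 2 * τ x * z.1} := by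
      rintro _ ⟨v, hv, rfl⟩
      have hne : (τ v : ℝ) - τ x ≠ 0 := by
        rw [sub_ne_zero]
        intro h
        exact hxS ((hτ (by exact_mod_cast h) : v = x) ▸ hv)
      have : 0 < ((τ v : ℝ) - τ x) ^ 2 := by positivity
      show -(τ x : ℝ) ^ 2 < (τ v : ℝ) ^ 2 - 2 * τ x * τ v
      nlinarith
    have h := convexHull_min hsub hconv hx
    have h' : -(τ x : ℝ) ^ 2 < (τ x : ℝ) ^ 2 - 2 * τ x * τ x := h
    nlinarith
  · intro e t _
    show chord _ _ t = chord _ _ 0 + t • (chord _ _ 1 - chord _ _ 0)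
    unfold chord
    ext
    · simp
    · simp

theorem II_eq_ncard [Fintype V] (r : V → ℕ) : II G Finset.univ r =
    ({q : V × V × V × V | G.Adj q.1 q.2.1 ∧ G.Adj q.2.2.1 q.2.2.2 ∧
      r q.1 < r q.2.2.1 ∧ r q.2.2.1 < r q.2.1 ∧ r q.2.1 < r q.2.2.2}.ncard : ℝ) := by
  classical
  rw [Set.ncard_eq_toFinset_card']
  have h : II G Finset.univ r = ∑ q : V × V × V × V, chi (G.Adj q.1 q.2.1 ∧ G.Adj q.2.2.1 q.2.2.2 ∧
      r q.1 < r q.2.2.1 ∧ r q.2.2.1 < r q.2.1 ∧ r q.2.1 < r q.2.2.2) := by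
    simp only [II, Fintype.sum_prod_type, Finset.mem_univ, true_and]
  rw [h, Finset.card_eq_sum_ones, Nat.cast_sum, ← Finset.sum_subset (Finset.subset_univ _)]
  · refine Finset.sum_congr rfl fun q hq => ?_
    rw [chi_true]
    · simp
    · simpa using hq
  · intro q _ hq
    apply chi_false
    simpa using hq

theorem convex_of_order [Fintype V] (r : V → ℕ) (hr : Function.Injective r) :
    ∃ D : Drawing G, D.IsConvex ∧ (D.numCrossings : ℝ) ≤ II G Finset.univ r := by
  classical
  let t : ℕ → ℤ := fun i => 8 ^ (4 ^ i)
  have ht8 : ∀ i, 8 ≤ t i := fun i => by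
    have : (8:ℤ) ^ 1 ≤ 8 ^ (4 ^ i) := pow_le_pow_right₀ (by norm_num) (Nat.one_le_pow _ _ (by norm_num))
    simpa using this
  have htm : StrictMono t := by
    apply strictMono_nat_of_lt_succ
    intro i
    exact pow_lt_pow_right₀ (by norm_num) (Nat.pow_lt_pow_right (by norm_num) (Nat.lt_succ_self i))
  have htg : ∀ i, 4 * t i ^ 3 < t (i + 1) := by
    intro i
    have e : t (i + 1) = t i ^ 3 * t i := by
      simp only [t]
      rw [pow_succ 4 i, pow_mul]; ring
    have h8 := ht8 i
    have h3 : 0 < t i ^ 3 := by positivity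
    rw [e]; nlinarith
  let τ : V → ℤ := fun v => t (r v)
  have hτ : Function.Injective τ := htm.injective.comp hr
  have hrt : ∀ u v, τ u < τ v ↔ r u < r v := fun u v => htm.lt_iff_lt
  obtain ⟨D, hD, lo, hi, hlh, hcv⟩ := parab_drawing G τ hτ (fun v => le_trans (by norm_num) (ht8 (r v))) (by
    intro u v huv
    have h1 : r u + 1 ≤ r v := (hrt u v).1 huv
    exact lt_of_lt_of_le (htg (r u)) (htm.monotone h1))
  refine ⟨D, hD, ?_⟩
  have hlt : ∀ e, (τ (lo e) : ℝ) < τ (hi e) := fun e => by exact_mod_cast (hlh e).2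
  have huni' : ∀ e f, e ≠ f → ¬ ((τ (lo e) : ℝ) = τ (lo f) ∧ (τ (hi e) : ℝ) = τ (hi f)) := by
    rintro e f hef ⟨h1, h2⟩
    apply hef
    apply Subtype.ext
    have h1' : τ (lo e) = τ (lo f) := by exact_mod_cast h1
    have h2' : τ (hi e) = τ (hi f) := by exact_mod_cast h2
    rw [(hlh e).1, (hlh f).1, hτ h1', hτ h2']
  have hadj : ∀ e, G.Adj (lo e) (hi e) := fun e => by
    have := e.2
    rw [(hlh e).1] at this
    exact this
  rw [II_eq_ncard]
  norm_cast
  unfold Drawing.numCrossings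
  have hcross : ∀ e f p, D.IsCross e f p → ((τ (lo e) : ℝ) < p.1 ∧ p.1 < τ (hi e) ∧ p.2 = (τ (lo e) + τ (hi e)) * p.1 - τ (lo e) * τ (hi e)) ∧
      ((τ (lo f) : ℝ) < p.1 ∧ p.1 < τ (hi f) ∧ p.2 = (τ (lo f) + τ (hi f)) * p.1 - τ (lo f) * τ (hi f)) := by
    rintro e f p ⟨⟨s, hs, hsp⟩, ⟨u, hu, hup⟩⟩
    rw [hcv] at hsp hup
    have e1 := chord_line (τ (lo e)) (τ (hi e)) s
    have f1 := chord_line (τ (lo f)) (τ (hi f)) u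
    have e2 := chord_inner (hlt e) hs
    have f2 := chord_inner (hlt f) hu
    rw [hsp] at e1 e2
    rw [hup] at f1 f2
    exact ⟨⟨e2.1, e2.2, e1⟩, ⟨f2.1, f2.2, f1⟩⟩
  have hex : ∀ z ∈ D.crossings, ∃ e f : G.edgeSet, e ≠ f ∧ z.1 = s(e, f) ∧ D.IsCross e f z.2 ∧ τ (lo e) < τ (lo f) := by
    rintro ⟨z, p⟩ ⟨e, f, hef, hz, hc⟩
    obtain ⟨⟨a1, a2, a3⟩, ⟨b1, b2, b3⟩⟩ := hcross e f p hc
    have hsh := (chord_share a1 a2 b1 b2 a3 b3).2.1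
    have hne : τ (lo e) ≠ τ (lo f) := fun h => huni' e f hef ⟨by rw [h], hsh (by rw [h])⟩
    rcases lt_or_gt_of_ne hne with h | h
    · exact ⟨e, f, hef, hz, hc, h⟩
    · exact ⟨f, e, hef.symm, by simp only at hz ⊢; rw [hz, Sym2.eq_swap], ⟨hc.2, hc.1⟩, h⟩
  let Φ : Sym2 G.edgeSet × (ℝ × ℝ) → V × V × V × V := fun z =>
    if h : z ∈ D.crossings then
      (lo (hex z h).choose, hi (hex z h).choose, lo (hex z h).choose_spec.choose, hi (hex z h).choose_spec.choose)
    else (lo z.1.out.1, hi z.1.out.1, lo z.1.out.1, hi z.1.out.1)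
  have hΦ : ∀ z ∈ D.crossings, ∃ e f : G.edgeSet, e ≠ f ∧ z.1 = s(e, f) ∧ D.IsCross e f z.2 ∧ τ (lo e) < τ (lo f) ∧
      Φ z = (lo e, hi e, lo f, hi f) := by
    intro z hz
    have h := (hex z hz).choose_spec.choose_spec
    exact ⟨_, _, h.1, h.2.1, h.2.2.1, h.2.2.2, by simp only [Φ]; rw [dif_pos hz]⟩
  apply Set.ncard_le_ncard_of_injOn Φ
  · intro z hz
    obtain ⟨e, f, hef, hz1, hc, hlo, hΦz⟩ := hΦ z hz
    rw [hΦz]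
    obtain ⟨⟨a1, a2, a3⟩, ⟨b1, b2, b3⟩⟩ := hcross e f _ hc
    refine ⟨hadj e, hadj f, (hrt _ _).1 hlo, (hrt _ _).1 ?_, (hrt _ _).1 ?_⟩
    · exact_mod_cast b1.trans a2
    · have := (chord_share a1 a2 b1 b2 a3 b3).1 (by exact_mod_cast hlo)
      exact_mod_cast this
  · intro z hz z' hz' heq
    obtain ⟨e, f, hef, hz1, hc, hlo, hΦz⟩ := hΦ z hz
    obtain ⟨e', f', hef', hz1', hc', hlo', hΦz'⟩ := hΦ z' hz'
    rw [hΦz, hΦz'] at heq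
    simp only [Prod.mk.injEq] at heq
    obtain ⟨h1, h2, h3, h4⟩ := heq
    have hee : e = e' := by apply Subtype.ext; rw [(hlh e).1, (hlh e').1, h1, h2]
    have hff : f = f' := by apply Subtype.ext; rw [(hlh f).1, (hlh f').1, h3, h4]
    subst hee hff
    obtain ⟨⟨a1, a2, a3⟩, ⟨b1, b2, b3⟩⟩ := hcross e f _ hc
    obtain ⟨⟨c1, c2, c3⟩, ⟨d1, d2, d3⟩⟩ := hcross e f _ hc'
    refine Prod.ext (by rw [hz1, hz1']) (chord_uniq (hlt e) (hlt f) (huni' e f hef) a3 b3 c3 d3)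

end Parab

open Classical in
theorem final_bound {n : ℕ} (G : SimpleGraph (Fin n)) :
    ∃ D : Drawing G, D.IsConvex ∧
      (D.numCrossings : ℝ) ≤ 2 * (311 * 2315 ^ 2 / Real.log (18 / 17)) * Real.log n *
        ((pcrNum G : ℝ) + (ssqd G : ℝ)) := by
  obtain ⟨D1, -, -⟩ := convex_of_order G (fun v : Fin n => (v : ℕ)) Fin.val_injective
  have hne : {m | ∃ D : Drawing G, D.numCrossingPairs = m}.Nonempty := ⟨_, D1, rfl⟩
  obtain ⟨D0, hD0⟩ := Nat.sInf_mem hne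
  obtain ⟨pts, hsep, hM⟩ := drawing_sep D0
  obtain ⟨r, hr, hT⟩ := recursion G (MQ pts) (MQ_nonneg pts) (MQ_super pts) 2315 (by norm_num)
    hsep _ Finset.univ rfl (fun _ => 0) (fun _ => le_refl _)
  have hr' : Function.Injective r := by
    rw [← Set.injOn_univ]; simpa using hr
  obtain ⟨D, hD, hle⟩ := convex_of_order G r hr'
  refine ⟨D, hD, ?_⟩
  have hJ : JJ G Finset.univ (fun _ => 0) r = 0 := by simp [JJ]
  have hl : 0 ≤ Real.log n := Real.log_natCast_nonneg n
  have hA : 0 < 311 * 2315 ^ 2 / Real.log (18 / 17) := by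
    have : 0 < Real.log (18 / 17) := Real.log_pos (by norm_num)
    positivity
  unfold TT at hT
  rw [hJ] at hT
  simp only [Finset.card_univ, Fintype.card_fin, Finset.sum_const_zero, add_zero, ne_eq,
    OfNat.ofNat_ne_zero, not_false_eq_true, zero_pow] at hT
  have hp : (D0.numCrossingPairs : ℝ) = pcrNum G := by rw [hD0]; rfl
  rw [hp] at hM
  have hs : (0 : ℝ) ≤ ssqd G := Nat.cast_nonneg _
  calc (D.numCrossings : ℝ) ≤ _ := hle
    _ ≤ _ := hT
    _ ≤ 311 * 2315 ^ 2 / Real.log (18 / 17) * Real.log n * (2 * ((pcrNum G : ℝ) + ssqd G)) := by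
      apply mul_le_mul_of_nonneg_left _ (by positivity)
      linarith
    _ = _ := by ring

/-- There exists an absolute constant `c > 0` such that every simple graph `G` on `n ≥ 2`
vertices admits a convex drawing (vertices in convex position, edges drawn as straight-line
segments) with at most `c · log n · (pcr(G) + Σ d_k²)` crossings. -/
theorem exists_convex_drawing :
    ∃ c : ℝ, 0 < c ∧ ∀ (n : ℕ) (G : SimpleGraph (Fin n)), 2 ≤ n →
      ∃ D : Drawing G, D.IsConvex ∧
        (D.numCrossings : ℝ) ≤ c * Real.log n * ((pcrNum G : ℝ) + (ssqd G : ℝ)) := by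
  refine ⟨2 * (311 * 2315 ^ 2 / Real.log (18 / 17)), ?_, fun n G _ => final_bound G⟩
  have : 0 < Real.log (18 / 17) := Real.log_pos (by norm_num)
  positivity
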